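/- arXiv:math/0106185 — 2 statements merged into one kernel-verified Lean document; each statement's English description precedes it below -/
import Mathlib

section
/- Let K be a field, let q ∈ K have multiplicative order e with e ≥ 3 (e may be infinite), and let f be an integer with 0 ≤ f and 2f ≤ e. If n ≥ 2f + 4 then the Iwahori–Hecke algebra H_q(B_n) has infinite representation type. -/
/-- A finite-dimensional right `A`-module, where `A` is a `K`-algebra.
Right modules are modules over the opposite ring `Aᵐᵒᵖ`. -/
structure FDRightModule (K A : Type) [Field K] [Ring A] [Algebra K A] : Type 1 where
  carrier : Type
  [isAddCommGroup : AddCommGroup carrier]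
  [isModuleK : Module K carrier]
  [isModuleA : Module Aᵐᵒᵖ carrier]
  [isTower : IsScalarTower K Aᵐᵒᵖ carrier]
  [isFinDim : FiniteDimensional K carrier]

attribute [instance] FDRightModule.isAddCommGroup FDRightModule.isModuleK
  FDRightModule.isModuleA FDRightModule.isTower FDRightModule.isFinDim

/-- A module is indecomposable if it is nonzero and is not the (internal) direct
sum of two nonzero submodules. -/
def IsIndecomposableModule (R M : Type*) [Ring R] [AddCommGroup M] [Module R M] : Prop :=
  Nontrivial M ∧ ∀ N₁ N₂ : Submodule R M, IsCompl N₁ N₂ → N₁ = ⊥ ∨ N₂ = ⊥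

/-- A `K`-algebra `A` has finite representation type if there are only finitely many
isomorphism classes of indecomposable finite-dimensional right `A`-modules. -/
def HasFiniteRepresentationType (K A : Type) [Field K] [Ring A] [Algebra K A] : Prop :=
  Finite (Quot fun M N : {M : FDRightModule K A // IsIndecomposableModule Aᵐᵒᵖ M.carrier} =>
    Nonempty (M.1.carrier ≃ₗ[Aᵐᵒᵖ] N.1.carrier))
/-- The multiplicative order of an element, valued in `ℕ∞`, with `⊤` for infinite order. -/
noncomputable def multOrder {M : Type*} [Monoid M] (x : M) : ℕ∞ :=
  if orderOf x = 0 then ⊤ else (orderOf x : ℕ∞)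
/-- The defining relations of the Iwahori--Hecke algebra of type `Bₙ` with generators
`T_0, …, T_{n-1}`, where `T_0` satisfies `(T_0 - α)(T_0 - β) = 0` and the other
generators satisfy `(T_i + 1)(T_i - q) = 0`. -/
inductive HeckeBRel (K : Type) [Field K] (α β q : K) (n : ℕ) :
    FreeAlgebra K (Fin n) → FreeAlgebra K (Fin n) → Prop
  | quad_zero (i : Fin n) (hi : (i : ℕ) = 0) :
      HeckeBRel K α β q n
        ((FreeAlgebra.ι K i - algebraMap K (FreeAlgebra K (Fin n)) α) *
          (FreeAlgebra.ι K i - algebraMap K (FreeAlgebra K (Fin n)) β)) 0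
  | quad (i : Fin n) (hi : 0 < (i : ℕ)) :
      HeckeBRel K α β q n
        ((FreeAlgebra.ι K i + 1) * (FreeAlgebra.ι K i - algebraMap K (FreeAlgebra K (Fin n)) q)) 0
  | braid_zero (i j : Fin n) (hi : (i : ℕ) = 0) (hj : (j : ℕ) = 1) :
      HeckeBRel K α β q n
        (FreeAlgebra.ι K i * FreeAlgebra.ι K j * FreeAlgebra.ι K i * FreeAlgebra.ι K j)
        (FreeAlgebra.ι K j * FreeAlgebra.ι K i * FreeAlgebra.ι K j * FreeAlgebra.ι K i)
  | braid (i j : Fin n) (hi : 0 < (i : ℕ)) (hij : (j : ℕ) = (i : ℕ) + 1) :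
      HeckeBRel K α β q n
        (FreeAlgebra.ι K j * FreeAlgebra.ι K i * FreeAlgebra.ι K j)
        (FreeAlgebra.ι K i * FreeAlgebra.ι K j * FreeAlgebra.ι K i)
  | comm (i j : Fin n) (hij : (i : ℕ) + 1 < (j : ℕ)) :
      HeckeBRel K α β q n (FreeAlgebra.ι K i * FreeAlgebra.ι K j)
        (FreeAlgebra.ι K j * FreeAlgebra.ι K i)

/-- The Iwahori--Hecke algebra of type `Bₙ`: the quotient of the free algebra on
`T_0, …, T_{n-1}` by the two-sided ideal generated by the defining relations, where
`T_0` satisfies `(T_0 - α)(T_0 - β) = 0`. -/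
abbrev HeckeB (K : Type) [Field K] (α β q : K) (n : ℕ) : Type := RingQuot (HeckeBRel K α β q n)

/-- The defining relations of `H_q(B_n)` for a sequence `t 0, …, t (n - 1)` in an algebra. -/
structure IsHeckeSeq {K : Type} [Field K] (d q : K) (n : ℕ) {A : Type*} [Ring A] [Algebra K A]
    (t : ℕ → A) : Prop where
  quad_zero : 0 < n → (t 0 - 1) * (t 0 - algebraMap K A d) = 0
  quad : ∀ i, 0 < i → i < n → (t i + 1) * (t i - algebraMap K A q) = 0
  braid_zero : 1 < n → t 0 * t 1 * t 0 * t 1 = t 1 * t 0 * t 1 * t 0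
  braid : ∀ i, 0 < i → i + 1 < n → t (i + 1) * t i * t (i + 1) = t i * t (i + 1) * t i
  comm : ∀ i j, i + 1 < j → j < n → t i * t j = t j * t i

namespace HeckeB

variable {K : Type} [Field K]

/-- The algebra `H_q(B_n)` with parameters `1` and `d` for `T_0`. -/
abbrev H (d q : K) (n : ℕ) : Type := HeckeB K 1 d q n

/-- The generators `T_i`, extended by zero to all `i : ℕ`. -/
noncomputable def gen (d q : K) (n i : ℕ) : H d q n :=
  if h : i < n then RingQuot.mkAlgHom K (HeckeBRel K 1 d q n) (FreeAlgebra.ι K ⟨i, h⟩) else 0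

variable {d q : K} {n : ℕ}

theorem mk_ι (i : Fin n) :
    RingQuot.mkAlgHom K (HeckeBRel K 1 d q n) (FreeAlgebra.ι K i) = gen d q n i := by
  simp [gen]

theorem isHeckeSeq_gen (d q : K) (n : ℕ) : IsHeckeSeq d q n (gen d q n) where
  quad_zero h := by
    have := RingQuot.mkAlgHom_rel K (HeckeBRel.quad_zero (K := K) (α := 1) (β := d) (q := q)
      (n := n) ⟨0, h⟩ rfl)
    simpa [mk_ι] using this
  quad i hi h := by
    have := RingQuot.mkAlgHom_rel K (HeckeBRel.quad (K := K) (α := 1) (β := d) (q := q)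
      (n := n) ⟨i, h⟩ hi)
    simpa [mk_ι] using this
  braid_zero h := by
    have := RingQuot.mkAlgHom_rel K (HeckeBRel.braid_zero (K := K) (α := 1) (β := d) (q := q)
      (n := n) ⟨0, by omega⟩ ⟨1, h⟩ rfl rfl)
    simpa [mk_ι] using this
  braid i hi h := by
    have := RingQuot.mkAlgHom_rel K (HeckeBRel.braid (K := K) (α := 1) (β := d) (q := q)
      (n := n) ⟨i, by omega⟩ ⟨i + 1, h⟩ hi rfl)
    simpa [mk_ι] using this
  comm i j hij h := by
    have := RingQuot.mkAlgHom_rel K (HeckeBRel.comm (K := K) (α := 1) (β := d) (q := q)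
      (n := n) ⟨i, by omega⟩ ⟨j, h⟩ hij)
    simpa [mk_ι] using this

section lift

variable {A : Type*} [Ring A] [Algebra K A]

/-- The algebra homomorphism defined by a sequence satisfying the defining relations. -/
noncomputable def lift {t : ℕ → A} (ht : IsHeckeSeq d q n t) : H d q n →ₐ[K] A :=
  RingQuot.liftAlgHom K ⟨FreeAlgebra.lift K (fun i : Fin n => t i), by
    intro a b h
    induction h with
    | quad_zero i hi =>
      simpa [hi] using ht.quad_zero (by have := i.2; omega)
    | quad i hi => simpa using ht.quad i hi i.2
    | braid_zero i j hi hj =>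
      simpa [hi, hj] using ht.braid_zero (by have := j.2; omega)
    | braid i j hi hij =>
      simpa [hij] using ht.braid i hi (by have := j.2; omega)
    | comm i j hij => simpa using ht.comm i j hij j.2⟩

theorem lift_gen {t : ℕ → A} (ht : IsHeckeSeq d q n t) {i : ℕ} (hi : i < n) :
    lift ht (gen d q n i) = t i := by
  simp [lift, gen, hi]

end lift

theorem adjoin_gen (d q : K) (n : ℕ) :
    Algebra.adjoin K (gen d q n '' Set.Iio n) = ⊤ := by
  rw [eq_top_iff]
  rintro x -
  obtain ⟨x, rfl⟩ := RingQuot.mkAlgHom_surjective K (HeckeBRel K 1 d q n) x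
  induction x using FreeAlgebra.induction with
  | grade0 r => rw [AlgHom.commutes]; exact Subalgebra.algebraMap_mem _ r
  | grade1 i => rw [mk_ι]; exact Algebra.subset_adjoin ⟨i, i.2, rfl⟩
  | mul a b ha hb => rw [map_mul]; exact mul_mem ha hb
  | add a b ha hb => rw [map_add]; exact add_mem ha hb

theorem induction_gen {P : H d q n → Prop} (hs : ∀ r : K, P (algebraMap K _ r))
    (hg : ∀ i < n, P (gen d q n i)) (hm : ∀ a b, P a → P b → P (a * b))
    (ha : ∀ a b, P a → P b → P (a + b)) (x : H d q n) : P x := by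
  have hx : x ∈ Algebra.adjoin K (gen d q n '' Set.Iio n) := by rw [adjoin_gen]; trivial
  induction hx using Algebra.adjoin_induction with
  | mem y hy => obtain ⟨i, hi, rfl⟩ := hy; exact hg i hi
  | algebraMap r => exact hs r
  | add a b _ _ h₁ h₂ => exact ha a b h₁ h₂
  | mul a b _ _ h₁ h₂ => exact hm a b h₁ h₂

end HeckeB

theorem IsHeckeSeq.mono {K : Type} [Field K] {d q : K} {m n : ℕ} {A : Type*} [Ring A] [Algebra K A]
    {t : ℕ → A} (h : IsHeckeSeq d q n t) (hmn : m ≤ n) : IsHeckeSeq d q m t where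
  quad_zero h0 := h.quad_zero (by omega)
  quad i hi h0 := h.quad i hi (by omega)
  braid_zero h0 := h.braid_zero (by omega)
  braid i hi h0 := h.braid i hi (by omega)
  comm i j hij h0 := h.comm i j hij (by omega)

namespace HeckeB

variable {K : Type} [Field K]

section ell

variable {d q : K} {n : ℕ} {A : Type*} [Ring A] [Algebra K A]

/-- The Jucys-Murphy elements attached to a sequence of generators. -/
noncomputable def ell (q : K) (t : ℕ → A) : ℕ → A
  | 0 => t 0
  | k + 1 => q⁻¹ • (t (k + 1) * ell q t k * t (k + 1))

theorem ell_map {B : Type*} [Ring B] [Algebra K B] (φ : A →ₐ[K] B) (t : ℕ → A) (k : ℕ) :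
    φ (ell q t k) = ell q (fun i => φ (t i)) k := by
  induction k with
  | zero => rfl
  | succ k ih => simp [ell, ih]

theorem ell_congr {s t : ℕ → A} {k : ℕ} (h : ∀ i ≤ k, s i = t i) : ell q s k = ell q t k := by
  induction k with
  | zero => exact h 0 le_rfl
  | succ k ih => rw [ell, ell, ih fun i hi => h i (by omega), h (k + 1) le_rfl]

variable {t : ℕ → A} (ht : IsHeckeSeq d q n t)
include ht

theorem commute_ell_of_gt {i k : ℕ} (hk : k + 1 < i) (hi : i < n) : Commute (t i) (ell q t k) := by
  induction k with
  | zero => exact (ht.comm 0 i hk hi).symm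
  | succ k ih =>
    have h1 : Commute (t i) (t (k + 1)) := (ht.comm (k + 1) i hk hi).symm
    exact ((h1.mul_right (ih (by omega))).mul_right h1).smul_right _

theorem commute_ell_of_lt {i k : ℕ} (hi : i < k) (hk : k < n) : Commute (t i) (ell q t k) := by
  induction k generalizing i with
  | zero => omega
  | succ k ih =>
    rcases Nat.lt_succ_iff_lt_or_eq.1 hi with h | rfl
    · have h1 : Commute (t i) (t (k + 1)) := ht.comm i (k + 1) (by omega) hk
      exact ((h1.mul_right (ih h (by omega))).mul_right h1).smul_right _
    · refine Commute.smul_right ?_ _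
      rcases i with _ | j
      · have := ht.braid_zero hk
        simp only [ell, zero_add, Commute, SemiconjBy]
        simpa only [mul_assoc] using this
      · have hb := ht.braid (j + 1) (by omega) hk
        have hc : t (j + 2) * ell q t j = ell q t j * t (j + 2) :=
          commute_ell_of_gt ht (by omega) hk
        simp only [ell, mul_smul_comm, smul_mul_assoc, Commute, SemiconjBy]
        congr 1
        calc t (j + 1) * (t (j + 2) * (t (j + 1) * ell q t j * t (j + 1)) * t (j + 2))
            = (t (j + 1) * t (j + 2) * t (j + 1)) * ell q t j * t (j + 1) * t (j + 2) := by
              noncomm_ring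
          _ = t (j + 2) * t (j + 1) * (t (j + 2) * ell q t j) * t (j + 1) * t (j + 2) := by
              rw [← hb]; noncomm_ring
          _ = t (j + 2) * t (j + 1) * ell q t j * (t (j + 2) * t (j + 1) * t (j + 2)) := by
              rw [hc]; noncomm_ring
          _ = _ := by rw [hb]; noncomm_ring

theorem mul_self_of_pos {i : ℕ} (hi : 0 < i) (hn : i < n) :
    t i * t i = (q - 1) • t i + q • (1 : A) := by
  have := ht.quad i hi hn
  rw [Algebra.algebraMap_eq_smul_one] at this
  rw [← sub_eq_zero, ← this]
  simp only [add_mul, mul_sub, sub_smul, smul_add, mul_smul_comm, mul_one, one_mul, one_smul]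
  abel

theorem mul_self_zero (hn : 0 < n) : t 0 * t 0 = (1 + d) • t 0 + (-d) • (1 : A) := by
  have := ht.quad_zero hn
  rw [Algebra.algebraMap_eq_smul_one] at this
  rw [← sub_eq_zero, ← this]
  simp only [sub_mul, mul_sub, add_smul, neg_smul, smul_sub, mul_smul_comm, mul_one, one_mul,
    one_smul]
  abel

theorem ell_succ_mul (hq : q ≠ 0) {k : ℕ} (hk : k + 1 < n) :
    ell q t (k + 1) * t (k + 1) = t (k + 1) * ell q t k + (q - 1) • ell q t (k + 1) := by
  simp only [ell, smul_mul_assoc, mul_assoc, mul_self_of_pos ht k.succ_pos hk]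
  simp only [mul_add, mul_smul_comm, smul_add, smul_smul, mul_one, inv_mul_cancel₀ hq, one_smul]
  rw [add_comm, mul_comm q⁻¹]

theorem mul_ell_succ (hq : q ≠ 0) {k : ℕ} (hk : k + 1 < n) :
    t (k + 1) * ell q t (k + 1) = ell q t k * t (k + 1) + (q - 1) • ell q t (k + 1) := by
  simp only [ell, mul_smul_comm, ← mul_assoc, mul_self_of_pos ht k.succ_pos hk]
  simp only [add_mul, smul_mul_assoc, smul_add, smul_smul, one_mul, inv_mul_cancel₀ hq, one_smul]
  rw [add_comm, mul_comm q⁻¹]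

end ell

/-- The natural homomorphism `H_q(B_n) → H_q(B_{n+1})`. -/
noncomputable def inc (d q : K) (n : ℕ) : H d q n →ₐ[K] H d q (n + 1) :=
  lift ((isHeckeSeq_gen d q (n + 1)).mono n.le_succ)

/-- The last generator of `H_q(B_{n+1})`. -/
noncomputable def top (d q : K) (n : ℕ) : H d q (n + 1) := gen d q (n + 1) n

/-- The last Jucys-Murphy element of `H_q(B_{n+1})`. -/
noncomputable def jm (d q : K) (n : ℕ) : H d q (n + 1) := ell q (gen d q (n + 1)) n

variable {d q : K} {n : ℕ}

theorem inc_gen {i : ℕ} (hi : i < n) : inc d q n (gen d q n i) = gen d q (n + 1) i :=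
  lift_gen _ hi

theorem inc_top : inc d q (n + 1) (top d q n) = gen d q (n + 2) n := inc_gen (by omega)

theorem inc_jm : inc d q (n + 1) (jm d q n) = ell q (gen d q (n + 2)) n := by
  rw [jm, ell_map]
  exact ell_congr fun i hi => inc_gen (by omega)

theorem jm_zero : jm d q 0 = top d q 0 := rfl

theorem jm_succ : jm d q (n + 1) =
    q⁻¹ • (top d q (n + 1) * inc d q (n + 1) (jm d q n) * top d q (n + 1)) := by
  rw [inc_jm]; rfl

theorem algebraMap_surjective_zero : Function.Surjective (algebraMap K (H d q 0)) := by
  intro x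
  induction x using induction_gen with
  | hs r => exact ⟨r, rfl⟩
  | hg i hi => omega
  | hm a b ha hb =>
    obtain ⟨r, rfl⟩ := ha
    obtain ⟨s, rfl⟩ := hb
    exact ⟨r * s, map_mul _ _ _⟩
  | ha a b ha hb =>
    obtain ⟨r, rfl⟩ := ha
    obtain ⟨s, rfl⟩ := hb
    exact ⟨r + s, map_add _ _ _⟩

theorem commute_of_commute_gen {x : H d q (n + 1)}
    (h : ∀ i < n, Commute x (gen d q (n + 1) i)) (a : H d q n) : Commute x (inc d q n a) := by
  induction a using induction_gen with
  | hs r => rw [AlgHom.commutes]; exact Algebra.commutes' r x |>.symm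
  | hg i hi => rw [inc_gen hi]; exact h i hi
  | hm a b ha hb => rw [map_mul]; exact ha.mul_right hb
  | ha a b ha hb => rw [map_add]; exact ha.add_right hb

theorem commute_jm (a : H d q n) : Commute (jm d q n) (inc d q n a) :=
  commute_of_commute_gen (fun _ hi =>
    (commute_ell_of_lt (isHeckeSeq_gen d q (n + 1)) hi n.lt_succ_self).symm) a

theorem commute_top (a : H d q n) :
    Commute (top d q (n + 1)) (inc d q (n + 1) (inc d q n a)) := by
  induction a using induction_gen with
  | hs r => rw [AlgHom.commutes, AlgHom.commutes]; exact Algebra.commutes' r _ |>.symm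
  | hg i hi =>
    rw [inc_gen hi, inc_gen (by omega)]
    exact ((isHeckeSeq_gen d q (n + 2)).comm i (n + 1) (by omega) (by omega)).symm
  | hm a b ha hb => rw [map_mul, map_mul]; exact ha.mul_right hb
  | ha a b ha hb => rw [map_add, map_add]; exact ha.add_right hb

theorem top_mul_top : top d q (n + 1) * top d q (n + 1) = (q - 1) • top d q (n + 1) + q • 1 :=
  mul_self_of_pos (isHeckeSeq_gen d q (n + 2)) n.succ_pos (by omega)

theorem top_zero_mul_top_zero : top d q 0 * top d q 0 = (1 + d) • top d q 0 + (-d) • 1 :=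
  mul_self_zero (isHeckeSeq_gen d q 1) one_pos

theorem jm_mul_top (hq : q ≠ 0) : jm d q (n + 1) * top d q (n + 1) =
    top d q (n + 1) * inc d q (n + 1) (jm d q n) + (q - 1) • jm d q (n + 1) := by
  rw [inc_jm]; exact ell_succ_mul (isHeckeSeq_gen d q (n + 2)) hq (by omega)

theorem top_mul_jm (hq : q ≠ 0) : top d q (n + 1) * jm d q (n + 1) =
    inc d q (n + 1) (jm d q n) * top d q (n + 1) + (q - 1) • jm d q (n + 1) := by
  rw [inc_jm]; exact mul_ell_succ (isHeckeSeq_gen d q (n + 2)) hq (by omega)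

theorem top_braid : top d q (n + 2) * inc d q (n + 2) (top d q (n + 1)) * top d q (n + 2) =
    inc d q (n + 2) (top d q (n + 1)) * top d q (n + 2) * inc d q (n + 2) (top d q (n + 1)) := by
  rw [inc_top]
  exact (isHeckeSeq_gen d q (n + 3)).braid (n + 1) (by omega) (by omega)

/-- A family of additive generators of `H_q(B_{n+1})`. -/
def spanSet (d q : K) (n : ℕ) : Set (H d q (n + 1)) :=
  {x | (∃ a, x = inc d q n a) ∨ (∃ a, x = jm d q n * inc d q n a) ∨
    ∃ a b, x = inc d q n a * top d q n * inc d q n b}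

theorem closure_spanSet_mul_inc {x : H d q (n + 1)} (hx : x ∈ AddSubmonoid.closure (spanSet d q n))
    (c : H d q n) : x * inc d q n c ∈ AddSubmonoid.closure (spanSet d q n) := by
  induction hx using AddSubmonoid.closure_induction with
  | mem x hx =>
    apply AddSubmonoid.subset_closure
    rcases hx with ⟨a, rfl⟩ | ⟨a, rfl⟩ | ⟨a, b, rfl⟩
    · exact Or.inl ⟨a * c, by rw [map_mul]⟩
    · exact Or.inr (Or.inl ⟨a * c, by rw [map_mul, mul_assoc]⟩)
    · exact Or.inr (Or.inr ⟨a, b * c, by rw [map_mul, mul_assoc (_ * _)]⟩)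
  | zero => rw [zero_mul]; exact zero_mem _
  | add x y _ _ hx hy => rw [add_mul]; exact add_mem hx hy

theorem inc_mul_closure_spanSet {x : H d q (n + 1)} (hx : x ∈ AddSubmonoid.closure (spanSet d q n))
    (c : H d q n) : inc d q n c * x ∈ AddSubmonoid.closure (spanSet d q n) := by
  induction hx using AddSubmonoid.closure_induction with
  | mem x hx =>
    apply AddSubmonoid.subset_closure
    rcases hx with ⟨a, rfl⟩ | ⟨a, rfl⟩ | ⟨a, b, rfl⟩
    · exact Or.inl ⟨c * a, by rw [map_mul]⟩
    · exact Or.inr (Or.inl ⟨c * a, by rw [map_mul, ← mul_assoc, ← (commute_jm c).eq, mul_assoc]⟩)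
    · exact Or.inr (Or.inr ⟨c * a, b, by rw [map_mul]; simp only [mul_assoc]⟩)
  | zero => rw [mul_zero]; exact zero_mem _
  | add x y _ _ hx hy => rw [mul_add]; exact add_mem hx hy

theorem smul_mem_closure_spanSet {x : H d q (n + 1)}
    (hx : x ∈ AddSubmonoid.closure (spanSet d q n)) (r : K) :
    r • x ∈ AddSubmonoid.closure (spanSet d q n) := by
  rw [Algebra.smul_def, ← (inc d q n).commutes]
  exact inc_mul_closure_spanSet hx _

theorem inc_mem_closure_spanSet (a : H d q n) :
    inc d q n a ∈ AddSubmonoid.closure (spanSet d q n) :=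
  AddSubmonoid.subset_closure (Or.inl ⟨a, rfl⟩)

theorem jm_mem_closure_spanSet : jm d q n ∈ AddSubmonoid.closure (spanSet d q n) :=
  AddSubmonoid.subset_closure (Or.inr (Or.inl ⟨1, by simp⟩))

theorem top_mem_closure_spanSet : top d q n ∈ AddSubmonoid.closure (spanSet d q n) :=
  AddSubmonoid.subset_closure (Or.inr (Or.inr ⟨1, 1, by simp⟩))

theorem closure_spanSet_eq_top_of_mul_top
    (h : ∀ b, top d q n * inc d q n b * top d q n ∈ AddSubmonoid.closure (spanSet d q n))
    (h' : jm d q n * top d q n ∈ AddSubmonoid.closure (spanSet d q n)) (y : H d q (n + 1)) :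
    y ∈ AddSubmonoid.closure (spanSet d q n) := by
  suffices ∀ x ∈ AddSubmonoid.closure (spanSet d q n),
      x * y ∈ AddSubmonoid.closure (spanSet d q n) by
    simpa using this 1 (by simpa using inc_mem_closure_spanSet (d := d) (q := q) (n := n) 1)
  induction y using induction_gen with
  | hs r =>
    intro x hx
    simpa using closure_spanSet_mul_inc hx (algebraMap K _ r)
  | hg i hi =>
    intro x hx
    rcases Nat.lt_succ_iff_lt_or_eq.1 hi with h1 | rfl
    · rw [← inc_gen h1]
      exact closure_spanSet_mul_inc hx _
    · change x * top d q i ∈ _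
      induction hx using AddSubmonoid.closure_induction with
      | mem x hx =>
        rcases hx with ⟨a, rfl⟩ | ⟨a, rfl⟩ | ⟨a, b, rfl⟩
        · exact inc_mul_closure_spanSet top_mem_closure_spanSet a
        · rw [(commute_jm a).eq, mul_assoc]
          exact inc_mul_closure_spanSet h' a
        · have := inc_mul_closure_spanSet (h b) a
          simpa only [mul_assoc] using this
      | zero => rw [zero_mul]; exact zero_mem _
      | add x y _ _ hx hy => rw [add_mul]; exact add_mem hx hy
  | hm a b ha hb =>
    intro x hx
    rw [← mul_assoc]
    exact hb _ (ha _ hx)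
  | ha a b ha hb =>
    intro x hx
    rw [mul_add]
    exact add_mem (ha _ hx) (hb _ hx)

theorem mem_closure_spanSet (hq : q ≠ 0) (n : ℕ) (x : H d q (n + 1)) :
    x ∈ AddSubmonoid.closure (spanSet d q n) := by
  induction n with
  | zero =>
    have h0 : top d q 0 * top d q 0 ∈ AddSubmonoid.closure (spanSet d q 0) := by
      rw [top_zero_mul_top_zero]
      refine add_mem (smul_mem_closure_spanSet top_mem_closure_spanSet _)
        (smul_mem_closure_spanSet ?_ _)
      simpa using inc_mem_closure_spanSet (d := d) (q := q) (n := 0) 1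
    refine closure_spanSet_eq_top_of_mul_top (fun b => ?_) h0 x
    obtain ⟨r, rfl⟩ := algebraMap_surjective_zero b
    rw [AlgHom.commutes, ← Algebra.commutes, mul_assoc, ← Algebra.smul_def]
    exact smul_mem_closure_spanSet h0 _
  | succ n ih =>
    refine closure_spanSet_eq_top_of_mul_top (fun b => ?_) ?_ x
    · induction ih b using AddSubmonoid.closure_induction with
      | mem b hb =>
        rcases hb with ⟨a, rfl⟩ | ⟨a, rfl⟩ | ⟨a, b, rfl⟩
        · rw [mul_assoc, ← (commute_top a).eq, ← mul_assoc]
          refine closure_spanSet_mul_inc ?_ _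
          rw [top_mul_top]
          refine add_mem (smul_mem_closure_spanSet top_mem_closure_spanSet _)
            (smul_mem_closure_spanSet ?_ _)
          simpa using inc_mem_closure_spanSet (d := d) (q := q) (n := n + 1) 1
        · rw [map_mul, mul_assoc, mul_assoc (inc d q (n + 1) _), ← (commute_top a).eq, ← mul_assoc,
            ← mul_assoc]
          refine closure_spanSet_mul_inc ?_ _
          have := smul_mem_closure_spanSet (jm_mem_closure_spanSet (d := d) (q := q) (n := n + 1)) q
          rwa [jm_succ, smul_smul, mul_inv_cancel₀ hq, one_smul] at this
        · have h1 : top d q (n + 1) * inc d q (n + 1) (top d q n) * top d q (n + 1) ∈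
              AddSubmonoid.closure (spanSet d q (n + 1)) := by
            rcases n with _ | n
            · have := smul_mem_closure_spanSet
                (jm_mem_closure_spanSet (d := d) (q := q) (n := 1)) q
              rwa [jm_succ, smul_smul, mul_inv_cancel₀ hq, one_smul] at this
            · rw [top_braid]
              exact closure_spanSet_mul_inc (inc_mul_closure_spanSet top_mem_closure_spanSet _) _
          have h2 := closure_spanSet_mul_inc (inc_mul_closure_spanSet h1 (inc d q n a))
            (inc d q n b)
          have e : top d q (n + 1) * inc d q (n + 1) (inc d q n a * top d q n * inc d q n b) *
              top d q (n + 1) = inc d q (n + 1) (inc d q n a) *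
                (top d q (n + 1) * inc d q (n + 1) (top d q n) * top d q (n + 1)) *
                inc d q (n + 1) (inc d q n b) := by
            rw [map_mul, map_mul, mul_assoc, mul_assoc _ (inc d q (n + 1) (inc d q n b)),
              ← (commute_top b).eq]
            simp only [← mul_assoc, (commute_top a).eq]
          rw [e]
          exact h2
      | zero => rw [map_zero, mul_zero, zero_mul]; exact zero_mem _
      | add a b _ _ ha hb => rw [map_add, mul_add, add_mul]; exact add_mem ha hb
    · rw [jm_mul_top hq]
      exact add_mem (closure_spanSet_mul_inc top_mem_closure_spanSet _)
        (smul_mem_closure_spanSet jm_mem_closure_spanSet _)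

theorem induction_span (hq : q ≠ 0) {P : H d q (n + 1) → Prop}
    (hadd : ∀ x y, P x → P y → P (x + y)) (hinc : ∀ a, P (inc d q n a))
    (hjm : ∀ a, P (jm d q n * inc d q n a))
    (htop : ∀ a b, P (inc d q n a * top d q n * inc d q n b)) (x : H d q (n + 1)) : P x := by
  induction mem_closure_spanSet hq n x using AddSubmonoid.closure_induction with
  | mem x hx =>
    rcases hx with ⟨a, rfl⟩ | ⟨a, rfl⟩ | ⟨a, b, rfl⟩
    · exact hinc a
    · exact hjm a
    · exact htop a b
  | zero => simpa using hinc 0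
  | add x y _ _ hx hy => exact hadd x y hx hy

theorem finite_H (hq : q ≠ 0) (n : ℕ) : Module.Finite K (H d q n) := by
  induction n with
  | zero =>
    exact Module.Finite.of_surjective (Algebra.linearMap K (H d q 0)) algebraMap_surjective_zero
  | succ n ih =>
    have : (⊤ : Submodule K (H d q (n + 1))) =
        LinearMap.range (inc d q n).toLinearMap ⊔
        LinearMap.range (LinearMap.mulLeft K (jm d q n) ∘ₗ (inc d q n).toLinearMap) ⊔
        Submodule.map₂ (LinearMap.mul K _)
          (LinearMap.range (LinearMap.mulRight K (top d q n) ∘ₗ (inc d q n).toLinearMap))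
          (LinearMap.range (inc d q n).toLinearMap) := by
      symm
      rw [eq_top_iff]
      rintro x -
      induction x using induction_span hq with
      | hadd x y hx hy => exact add_mem hx hy
      | hinc a =>
        exact Submodule.mem_sup_left (Submodule.mem_sup_left ⟨a, rfl⟩)
      | hjm a =>
        exact Submodule.mem_sup_left (Submodule.mem_sup_right ⟨a, rfl⟩)
      | htop a b =>
        exact Submodule.mem_sup_right (Submodule.apply_mem_map₂ _ ⟨a, rfl⟩ ⟨b, rfl⟩)
    refine ⟨?_⟩
    rw [this]
    refine Submodule.FG.sup (Submodule.FG.sup ?_ ?_) (Submodule.FG.map₂ _ ?_ ?_) <;>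
    exact Submodule.FG.of_finite

end HeckeB

namespace HeckeB

variable {K : Type} [Field K]

section indOp

variable {d q : K} {n : ℕ} {A : Type*} [Ring A] [Algebra K A]

/-- The scalar by which `T_i` acts on the component at `a` of the induced module when
`a ∉ {i - 1, i}`. -/
def indCoeff (q : K) (n : ℕ) (t : ℕ → A) (i a : ℕ) : A :=
  if n < a then (if i = 0 then 1 else algebraMap K A q) else if a < i then t (i - 1) else t i

/-- The action of `T_i` on the module induced from `H_q(B_n)` to `H_q(B_{n+1})`, whose underlying
space is identified with a space of functions on `(signed) coset representatives`. -/
def indOp (d q : K) (n : ℕ) (t : ℕ → A) : ℕ → Module.End K (ℕ → A × A)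
  | 0 =>
    { toFun u a := if a = 0 then (-(d • (u 0).2), (u 0).1 + (1 + d) • (u 0).2)
        else indCoeff q n t 0 a • u a
      map_add' u v := by
        ext a : 1
        split_ifs
        · ext <;> simp only [Pi.add_apply, Prod.fst_add, Prod.snd_add] <;> simp [*] <;>
            module
        · simp [*]
      map_smul' r u := by
        ext a : 1
        split_ifs
        · ext <;> simp [*, smul_comm r]
        · simp [*, smul_comm r] }
  | i + 1 =>
    { toFun u a :=
        if a = i then ((u (i + 1)).1 + (q - 1) • (u i).1, q • (u (i + 1)).2)
        else if a = i + 1 then (q • (u i).1, (u i).2 + (q - 1) • (u (i + 1)).2)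
        else indCoeff q n t (i + 1) a • u a
      map_add' u v := by
        ext a : 1
        simp only [Pi.add_apply]
        split_ifs
        · ext <;> simp; module
        · ext <;> simp; module
        · simp
      map_smul' r u := by
        ext a : 1
        simp only [Pi.smul_apply, RingHom.id_apply]
        split_ifs
        · ext <;> simp [smul_comm r]
        · ext <;> simp [smul_comm r]
        · simp [smul_comm r] }

variable (t : ℕ → A) (u : ℕ → A × A)

theorem indOp_zero_zero : indOp d q n t 0 u 0 = (-(d • (u 0).2), (u 0).1 + (1 + d) • (u 0).2) :=
  rfl

theorem indOp_zero_of_ne {a : ℕ} (h : a ≠ 0) : indOp d q n t 0 u a = indCoeff q n t 0 a • u a := by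
  simp [indOp, h]

theorem indOp_succ_self (i : ℕ) :
    indOp d q n t (i + 1) u i = ((u (i + 1)).1 + (q - 1) • (u i).1, q • (u (i + 1)).2) := by
  simp [indOp]

theorem indOp_succ_succ (i : ℕ) :
    indOp d q n t (i + 1) u (i + 1) = (q • (u i).1, (u i).2 + (q - 1) • (u (i + 1)).2) := by
  simp [indOp]

theorem indOp_succ_of_ne {i a : ℕ} (h : a ≠ i) (h' : a ≠ i + 1) :
    indOp d q n t (i + 1) u a = indCoeff q n t (i + 1) a • u a := by
  simp [indOp, h, h']

variable {t}

theorem isHeckeSeq_indOp (ht : IsHeckeSeq d q n t) : IsHeckeSeq d q (n + 1) (indOp d q n t) where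
  quad_zero _ := by
    ext u a : 2
    rcases eq_or_ne a 0 with rfl | ha
    · ext <;> simp [indOp_zero_zero] <;> module
    · have key : (indCoeff q n t 0 a - 1) * (indCoeff q n t 0 a - algebraMap K A d) = 0 := by
        by_cases h : n < a
        · simp [indCoeff, h]
        · simpa [indCoeff, h] using ht.quad_zero (by omega)
      have := congrArg (· • u a) key
      simp only [sub_mul, one_mul, sub_smul, mul_smul, smul_sub, algebraMap_smul, zero_smul] at this
      simpa [indOp_zero_of_ne _ _ ha, smul_comm d (indCoeff q n t 0 a)] using this
  quad i hi hin := by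
    obtain ⟨i, rfl⟩ := Nat.exists_eq_succ_of_ne_zero hi.ne'
    ext u a : 2
    rcases eq_or_ne a i with rfl | ha
    · ext <;> simp [indOp_succ_self, indOp_succ_succ] <;> module
    rcases eq_or_ne a (i + 1) with rfl | ha'
    · ext <;> simp [indOp_succ_self, indOp_succ_succ] <;> module
    have key : (indCoeff q n t (i + 1) a + 1) *
        (indCoeff q n t (i + 1) a - algebraMap K A q) = 0 := by
      by_cases h : n < a
      · simp [indCoeff, h]
      · rcases lt_or_gt_of_ne ha' with h' | h'
        · simpa [indCoeff, h, h'] using ht.quad i (by omega) (by omega)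
        · simpa [indCoeff, h, h'.not_gt] using ht.quad (i + 1) (by omega) (by omega)
    have := congrArg (· • u a) key
    simp only [add_mul, one_mul, add_smul, mul_smul, sub_smul, smul_sub, algebraMap_smul,
      zero_smul] at this
    simpa [indOp_succ_of_ne _ _ ha ha', smul_comm q (indCoeff q n t (i + 1) a)] using this
  braid_zero hn := by
    have e0 : ∀ v, indOp d q n t 0 v 1 = t 0 • v 1 := fun v => by
      rw [indOp_zero_of_ne _ _ one_ne_zero, indCoeff, if_neg (by omega), if_neg (by omega)]
    have hsq : ∀ x, t 0 * (t 0 * x) = (1 + d) • (t 0 * x) - d • x := fun x => by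
      rw [← mul_assoc, mul_self_zero ht (by omega)]
      simp [add_mul, sub_eq_add_neg]
    ext u a : 2
    rcases eq_or_ne a 0 with rfl | ha
    · simp only [Module.End.mul_apply, indOp_zero_zero, e0, indOp_succ_self t _ 0,
        indOp_succ_succ t _ 0, zero_add]
      ext <;> simp [mul_add, hsq] <;> module
    rcases eq_or_ne a 1 with rfl | ha'
    · have := indOp_succ_succ (d := d) (q := q) (n := n) t (i := 0)
      simp only [zero_add] at this
      simp only [Module.End.mul_apply, indOp_zero_zero, e0, indOp_succ_self t _ 0,
        this, zero_add]
      ext <;> simp [mul_add, hsq] <;> module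
    have key : indCoeff q n t 0 a * indCoeff q n t 1 a * indCoeff q n t 0 a * indCoeff q n t 1 a =
        indCoeff q n t 1 a * indCoeff q n t 0 a * indCoeff q n t 1 a * indCoeff q n t 0 a := by
      by_cases h : n < a
      · simp [indCoeff, h]
      · simpa [indCoeff, h, ha] using ht.braid_zero (by omega)
    have := congrArg (· • u a) key
    simpa [indOp_succ_of_ne t _ (i := 0) ha ha', indOp_zero_of_ne _ _ ha, mul_smul] using this
  braid i hi hin := by
    obtain ⟨i, rfl⟩ := Nat.exists_eq_succ_of_ne_zero hi.ne'
    have e1 : ∀ v, indOp d q n t (i + 1) v (i + 2) = t (i + 1) • v (i + 2) := fun v => by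
      rw [indOp_succ_of_ne _ _ (by omega) (by omega), indCoeff, if_neg (by omega),
        if_neg (by omega)]
    have e2 : ∀ v, indOp d q n t (i + 2) v i = t (i + 1) • v i := fun v => by
      rw [indOp_succ_of_ne _ _ (by omega) (by omega), indCoeff, if_neg (by omega),
        if_pos (by omega)]
      rfl
    have hsq : ∀ x, t (i + 1) * (t (i + 1) * x) = (q - 1) • (t (i + 1) * x) + q • x := fun x => by
      rw [← mul_assoc, mul_self_of_pos ht (by omega) (by omega)]
      simp [add_mul]
    ext u a : 2
    rcases eq_or_ne a i with rfl | ha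
    · simp only [Module.End.mul_apply, e1, e2, indOp_succ_self, indOp_succ_succ,
        Nat.succ_eq_add_one]
      ext <;> simp [mul_add, hsq] <;> module
    rcases eq_or_ne a (i + 1) with rfl | ha'
    · simp only [Module.End.mul_apply, e1, e2, indOp_succ_self, indOp_succ_succ,
        Nat.succ_eq_add_one]
      ext <;> simp [mul_add] <;> module
    rcases eq_or_ne a (i + 2) with rfl | ha''
    · simp only [Module.End.mul_apply, e1, e2, indOp_succ_self, indOp_succ_succ,
        Nat.succ_eq_add_one]
      ext <;> simp [mul_add, hsq] <;> module
    have key : indCoeff q n t (i + 2) a * indCoeff q n t (i + 1) a * indCoeff q n t (i + 2) a =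
        indCoeff q n t (i + 1) a * indCoeff q n t (i + 2) a * indCoeff q n t (i + 1) a := by
      by_cases h : n < a
      · simp [indCoeff, h]
      · rcases lt_or_gt_of_ne ha with h' | h'
        · simpa [indCoeff, h, show a < i + 1 by omega, show a < i + 2 by omega] using
            ht.braid i (by omega) (by omega)
        · simpa [indCoeff, h, show ¬ a < i + 1 by omega, show ¬ a < i + 2 by omega] using
            ht.braid (i + 1) (by omega) (by omega)
    have := congrArg (· • u a) key
    simpa [indOp_succ_of_ne t _ ha ha', indOp_succ_of_ne t _ (i := i + 1) ha' ha'', mul_smul]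
      using this
  comm i j hij hj := by
    obtain ⟨j, rfl⟩ := Nat.exists_eq_succ_of_ne_zero (by omega : j ≠ 0)
    have hgen : ∀ a, a ≠ i → a ≠ j → a ≠ j + 1 → indCoeff q n t i a * indCoeff q n t (j + 1) a =
        indCoeff q n t (j + 1) a * indCoeff q n t i a := by
      intro a ha haj haj'
      by_cases h : n < a
      · by_cases h0 : i = 0 <;> simp [indCoeff, h, h0, Algebra.commutes]
      · rcases lt_or_gt_of_ne ha with h' | h'
        · simpa [indCoeff, h, h', show a < j + 1 by omega] using
            ht.comm (i - 1) j (by omega) (by omega)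
        · by_cases h2 : a < j + 1
          · simpa [indCoeff, h, h'.not_gt, h2] using ht.comm i j (by omega) (by omega)
          · simpa [indCoeff, h, h'.not_gt, h2] using ht.comm i (j + 1) (by omega) (by omega)
    have hi : ∀ v a, a ≠ i → a + 1 ≠ i → indOp d q n t i v a = indCoeff q n t i a • v a := by
      intro v a h h'
      rcases i with _ | i
      · exact indOp_zero_of_ne t v h
      · exact indOp_succ_of_ne t v (by omega) h
    have hj1 : ∀ v a, a ≤ i → indOp d q n t (j + 1) v a = t j • v a := by
      intro v a h
      rw [indOp_succ_of_ne _ _ (by omega) (by omega), indCoeff, if_neg (by omega),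
        if_pos (by omega)]
      rfl
    have hj2 : ∀ v, indOp d q n t i v j = t i • v j := by
      intro v
      rw [hi v j (by omega) (by omega), indCoeff, if_neg (by omega), if_neg (by omega)]
    have hj3 : ∀ v, indOp d q n t i v (j + 1) = t i • v (j + 1) := by
      intro v
      rw [hi v _ (by omega) (by omega), indCoeff, if_neg (by omega), if_neg (by omega)]
    ext u a : 2
    rcases eq_or_ne a j with rfl | haj
    · ext <;> simp [hj2, hj3, indOp_succ_self, mul_add]
    rcases eq_or_ne a (j + 1) with rfl | haj'
    · ext <;> simp [hj2, hj3, indOp_succ_succ, mul_add]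
    rcases eq_or_ne a i with rfl | hai
    · rcases a with _ | i
      · ext <;> simp [hj1, indOp_zero_zero, mul_add]
      · ext <;> simp [hj1, indOp_succ_succ, mul_add]
    rcases eq_or_ne (a + 1) i with rfl | hai'
    · ext <;> simp [hj1, indOp_succ_self, mul_add]
    simp only [Module.End.mul_apply, hi _ a hai hai', indOp_succ_of_ne t _ haj haj', smul_smul,
      hgen a hai haj haj']

end indOp

section condExp

variable (d q : K) (n : ℕ)

/-- The representation of `H_q(B_{n+1})` induced from the left regular representation of
`H_q(B_n)`. -/
noncomputable def indRep : H d q (n + 1) →ₐ[K] Module.End K (ℕ → H d q n × H d q n) :=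
  lift (isHeckeSeq_indOp (isHeckeSeq_gen d q n))

/-- The conditional expectation `H_q(B_{n+1}) → H_q(B_n)`: the projection onto the component of
the trivial double coset. -/
noncomputable def condExp : H d q (n + 1) →ₗ[K] H d q n where
  toFun h := (indRep d q n h (Pi.single n (1, 0)) n).1
  map_add' x y := by simp
  map_smul' r x := by simp

variable {d q n}

theorem condExp_apply (h : H d q (n + 1)) :
    condExp d q n h = (indRep d q n h (Pi.single n (1, 0)) n).1 := rfl

theorem indRep_gen {i : ℕ} (hi : i < n + 1) :
    indRep d q n (gen d q (n + 1) i) = indOp d q n (gen d q n) i := lift_gen _ hi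

theorem indOp_apply_of_lt {t : ℕ → H d q n} {i : ℕ} (hi : i < n) (u : ℕ → H d q n × H d q n) :
    indOp d q n t i u n = t i • u n := by
  rcases i with _ | i
  · rw [indOp_zero_of_ne _ _ (by omega), indCoeff, if_neg (by omega), if_neg (by omega)]
  · rw [indOp_succ_of_ne _ _ (by omega) (by omega), indCoeff, if_neg (by omega),
      if_neg (by omega)]

theorem indOp_single {t : ℕ → H d q n} {i : ℕ} (hi : i < n) (m : H d q n × H d q n) :
    indOp d q n t i (Pi.single n m) = Pi.single n (t i • m) := by
  ext a : 1
  rcases eq_or_ne a n with rfl | ha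
  · simp [indOp_apply_of_lt hi]
  · rcases i with _ | i
    · rcases eq_or_ne a 0 with rfl | h0
      · simp [indOp_zero_zero, ha, ← Prod.zero_eq_mk]
      · simp [indOp_zero_of_ne _ _ h0, ha]
    · rcases eq_or_ne a i with rfl | h1
      · rw [indOp_succ_self, Pi.single_eq_of_ne (by omega), Pi.single_eq_of_ne (by omega),
          Pi.single_eq_of_ne (by omega)]
        simp
      rcases eq_or_ne a (i + 1) with rfl | h2
      · rw [indOp_succ_succ, Pi.single_eq_of_ne (by omega), Pi.single_eq_of_ne (by omega),
          Pi.single_eq_of_ne (by omega)]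
        simp
      simp [indOp_succ_of_ne _ _ h1 h2, ha]

theorem indRep_inc_apply (a : H d q n) (u : ℕ → H d q n × H d q n) :
    indRep d q n (inc d q n a) u n = a • u n := by
  induction a using induction_gen generalizing u with
  | hs r => simp
  | hg i hi => rw [inc_gen hi, indRep_gen (by omega), indOp_apply_of_lt hi]
  | hm a b ha hb => simp [ha, hb, mul_smul]
  | ha a b ha hb => simp [ha, hb, add_smul]

theorem indRep_inc_single (a : H d q n) (m : H d q n × H d q n) :
    indRep d q n (inc d q n a) (Pi.single n m) = Pi.single n (a • m) := by
  induction a using induction_gen generalizing m with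
  | hs r => simp [← Pi.single_smul]
  | hg i hi => rw [inc_gen hi, indRep_gen (by omega), indOp_single hi]
  | hm a b ha hb => simp [ha, hb, mul_smul]
  | ha a b ha hb => simp [ha, hb, add_smul, Pi.single_add]

theorem indRep_mul_right (h : H d q (n + 1)) (u : ℕ → H d q n × H d q n) (b : H d q n) :
    indRep d q n h (fun a => MulOpposite.op b • u a) =
      fun a => MulOpposite.op b • indRep d q n h u a := by
  induction h using induction_gen generalizing u with
  | hs r => ext a : 1; simp [smul_comm r]
  | hg i hi =>
    rw [indRep_gen hi]
    ext a : 1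
    rcases i with _ | i
    · rcases eq_or_ne a 0 with rfl | h0
      · ext <;> simp [indOp_zero_zero]
      · simp [indOp_zero_of_ne _ _ h0, smul_comm (indCoeff q n (gen d q n) 0 a)]
    · rcases eq_or_ne a i with rfl | h1
      · ext <;> simp [indOp_succ_self]
      rcases eq_or_ne a (i + 1) with rfl | h2
      · ext <;> simp [indOp_succ_succ]
      simp [indOp_succ_of_ne _ _ h1 h2, smul_comm (indCoeff q n (gen d q n) (i + 1) a)]
  | hm a b ha hb => simp [ha, hb]
  | ha a b ha hb => ext a : 1; simp [ha, hb]

theorem condExp_one : condExp d q n 1 = 1 := by simp [condExp_apply]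

theorem condExp_inc_mul (a : H d q n) (h : H d q (n + 1)) :
    condExp d q n (inc d q n a * h) = a * condExp d q n h := by
  simp [condExp_apply, indRep_inc_apply]

theorem condExp_mul_inc (h : H d q (n + 1)) (a : H d q n) :
    condExp d q n (h * inc d q n a) = condExp d q n h * a := by
  rw [condExp_apply, map_mul, Module.End.mul_apply, indRep_inc_single]
  have : (Pi.single n (a • ((1 : H d q n), (0 : H d q n))) : ℕ → H d q n × H d q n) =
      fun k => MulOpposite.op a • (Pi.single n ((1 : H d q n), (0 : H d q n)) :
        ℕ → H d q n × H d q n) k := by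
    ext k : 1
    rcases eq_or_ne k n with rfl | hk
    · simp
    · simp [hk]
  rw [this, indRep_mul_right]
  rfl

theorem condExp_inc (a : H d q n) : condExp d q n (inc d q n a) = a := by
  simpa [condExp_one] using condExp_inc_mul a (1 : H d q (n + 1))

theorem condExp_top : condExp d q n (top d q n) = 0 := by
  rw [condExp_apply, top, indRep_gen (by omega)]
  rcases n with _ | n
  · simp [indOp_zero_zero]
  · simp [indOp_succ_succ]

theorem ell_indOp_single {k : ℕ} (m : H d q n) :
    ∃ m', ell q (indOp d q n (gen d q n)) k (Pi.single k (m, 0)) = Pi.single k (0, m') := by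
  induction k generalizing m with
  | zero =>
    refine ⟨m, ?_⟩
    ext a : 1
    rcases eq_or_ne a 0 with rfl | ha
    · simp [ell, indOp_zero_zero]
    · simp [ell, indOp_zero_of_ne _ _ ha, ha]
  | succ k ih =>
    have h1 : ∀ m : H d q n, indOp d q n (gen d q n) (k + 1) (Pi.single (k + 1) (m, 0)) =
        Pi.single k (m, 0) := by
      intro m
      ext a : 1
      rcases eq_or_ne a k with rfl | h1
      · simp [indOp_succ_self]
      rcases eq_or_ne a (k + 1) with rfl | h2
      · simp [indOp_succ_succ]
      simp [indOp_succ_of_ne _ _ h1 h2, h1, h2]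
    have h2 : ∀ m : H d q n, indOp d q n (gen d q n) (k + 1) (Pi.single k (0, m)) =
        Pi.single (k + 1) (0, m) := by
      intro m
      ext a : 1
      rcases eq_or_ne a k with rfl | h1
      · simp [indOp_succ_self]
      rcases eq_or_ne a (k + 1) with rfl | h2
      · simp [indOp_succ_succ]
      simp [indOp_succ_of_ne _ _ h1 h2, h1, h2]
    obtain ⟨m', hm'⟩ := ih m
    refine ⟨q⁻¹ • m', ?_⟩
    rw [ell, LinearMap.smul_apply, Module.End.mul_apply, Module.End.mul_apply, h1, hm', h2,
      ← Pi.single_smul]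
    simp

theorem condExp_jm : condExp d q n (jm d q n) = 0 := by
  have h : indRep d q n (jm d q n) = ell q (indOp d q n (gen d q n)) n :=
    (ell_map (B := Module.End K (ℕ → H d q n × H d q n)) (indRep d q n) (gen d q (n + 1)) n).trans
      (ell_congr fun i hi => indRep_gen (Nat.lt_succ_of_le hi))
  rw [condExp_apply, h]
  obtain ⟨m', hm'⟩ := ell_indOp_single (d := d) (q := q) (n := n) (k := n) 1
  rw [hm']
  simp

theorem condExp_top_mul_inc_mul_top (hq : q ≠ 0) (h : H d q (n + 1)) :
    condExp d q (n + 1) (top d q (n + 1) * inc d q (n + 1) h * top d q (n + 1)) =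
      q • inc d q n (condExp d q n h) := by
  have hj : top d q (n + 1) * inc d q (n + 1) (jm d q n) * top d q (n + 1) =
      q • jm d q (n + 1) := by
    rw [jm_succ, smul_smul, mul_inv_cancel₀ hq, one_smul]
  have ht : condExp d q (n + 1) (top d q (n + 1) * inc d q (n + 1) (top d q n) *
      top d q (n + 1)) = 0 := by
    rcases n with _ | n
    · rw [← jm_zero, hj, map_smul, condExp_jm, smul_zero]
    · rw [top_braid, condExp_mul_inc, condExp_inc_mul, condExp_top, mul_zero, zero_mul]
  induction h using induction_span hq with
  | hadd x y hx hy => rw [map_add, mul_add, add_mul, map_add, hx, hy, map_add, map_add, smul_add]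
  | hinc a =>
    rw [(commute_top a).eq, mul_assoc, condExp_inc_mul, top_mul_top, map_add, map_smul, map_smul,
      condExp_top, condExp_one, condExp_inc]
    simp
  | hjm a =>
    rw [map_mul (inc d q (n + 1)), ← mul_assoc, mul_assoc _ _ (top d q (n + 1)),
      ← (commute_top a).eq, ← mul_assoc, hj, condExp_mul_inc, map_smul, condExp_jm,
        condExp_mul_inc, condExp_jm]
    simp
  | htop a b =>
    have e : top d q (n + 1) * inc d q (n + 1) (inc d q n a * top d q n * inc d q n b) *
        top d q (n + 1) = inc d q (n + 1) (inc d q n a) *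
          (top d q (n + 1) * inc d q (n + 1) (top d q n) * top d q (n + 1)) *
          inc d q (n + 1) (inc d q n b) := by
      rw [map_mul, map_mul, mul_assoc, mul_assoc _ (inc d q (n + 1) (inc d q n b)),
        ← (commute_top b).eq]
      simp only [← mul_assoc, (commute_top a).eq]
    rw [e, condExp_mul_inc, condExp_inc_mul, ht, condExp_mul_inc, condExp_inc_mul, condExp_top]
    simp

end condExp
end HeckeB

namespace HeckeB

open PowerSeries

variable {K : Type} [Field K] {d q : K} {n : ℕ}

/-- The geometric series `∑ a ^ j X ^ j`. -/
noncomputable def geom {A : Type*} [Ring A] (a : A) : A⟦X⟧ := PowerSeries.mk fun j => a ^ j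

section geom

variable {A : Type*} [Ring A] (a : A)

theorem geom_mul : geom a * (1 - C a * X) = 1 := by
  ext j
  rcases j with _ | j
  · simp [geom, mul_sub, ← mul_assoc]
  · simp [geom, mul_sub, ← mul_assoc, coeff_succ_mul_X, coeff_mul_C, pow_succ, coeff_one]

theorem mul_geom : (1 - C a * X) * geom a = 1 := by
  ext j
  rcases j with _ | j
  · simp [geom, sub_mul, mul_assoc]
  · simp [geom, sub_mul, mul_assoc, coeff_succ_X_mul, coeff_C_mul, pow_succ', coeff_one]

theorem map_geom {B : Type*} [Ring B] (φ : A →+* B) : PowerSeries.map φ (geom a) = geom (φ a) := by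
  ext j; simp [geom]

theorem C_smul [Algebra K A] (r : K) : C (r • a) = r • (C a : A⟦X⟧) := by
  ext j
  rw [coeff_smul, coeff_C, coeff_C]
  split_ifs <;> simp

end geom

section abstract_identities

variable {R : Type*} [Ring R] [Algebra K R] {τ x y g h : R}

theorem mul_geom_eq (h₂ : τ * y = x * τ + (q - 1) • y) (hg' : g * (1 - x) = 1)
    (hh : (1 - y) * h = 1) : τ * h = g * τ + (q - 1) • (g * (h - 1)) := by
  have e1 : y * h = h - 1 := by rw [sub_mul, one_mul] at hh; rw [← hh]; abel
  have e2 : (1 - x) * τ = τ * (1 - y) + (q - 1) • y := by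
    rw [mul_sub, h₂, sub_mul, one_mul, mul_one]; abel
  calc τ * h = (g * (1 - x)) * τ * h := by rw [hg', one_mul]
    _ = g * ((1 - x) * τ) * h := by rw [mul_assoc g]
    _ = g * (τ * ((1 - y) * h)) + (q - 1) • (g * (y * h)) := by
        rw [e2]; simp only [mul_add, add_mul, mul_assoc, mul_smul_comm, smul_mul_assoc]
    _ = _ := by rw [hh, e1, mul_one]

theorem smul_geom_sub_one_eq (h₁ : q • y = τ * x * τ) (h₂ : τ * y = x * τ + (q - 1) • y)
    (hg : (1 - x) * g = 1) (hg' : g * (1 - x) = 1) (hh : (1 - y) * h = 1) :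
    q • (h - 1) = τ * (g - 1) * τ + (q - 1) • (τ * (g - 1) * (h - 1)) := by
  have e1 : y * h = h - 1 := by rw [sub_mul, one_mul] at hh; rw [← hh]; abel
  have e2 : x * g = g - 1 := by rw [sub_mul, one_mul] at hg; rw [← hg]; abel
  calc q • (h - 1) = (q • y) * h := by rw [smul_mul_assoc, e1]
    _ = τ * x * (τ * h) := by rw [h₁, mul_assoc]
    _ = τ * (x * g) * τ + (q - 1) • (τ * (x * g) * (h - 1)) := by
      rw [mul_geom_eq h₂ hg' hh]; simp only [mul_add, mul_smul_comm, mul_assoc]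
    _ = _ := by rw [e2]

theorem factor_mul_factor (hq : q ≠ 0) (x : R) :
    (1 - q • x) * (1 - q⁻¹ • x) = (1 - x) * (1 - x) - (q⁻¹ * (q - 1) ^ 2) • x := by
  simp only [sub_mul, mul_sub, one_mul, mul_one, smul_mul_smul_comm, mul_inv_cancel₀ hq, one_smul]
  match_scalars <;> field_simp
  ring

theorem factor_mul_factor_mul (hx : x * y = y * x) :
    (1 - x) * (1 - d • x) * y = y - (1 + d) • (y * x) + d • (y * x * x) := by
  have : x * (x * y) = y * x * x := by rw [hx, ← mul_assoc, hx]
  simp only [mul_sub, sub_mul, mul_one, one_mul, mul_smul_comm, smul_mul_assoc, mul_assoc x, hx]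
  rw [add_smul, one_smul, smul_sub, ← this, hx]
  abel

theorem commute_factor_mul_factor (hxy : x * y = y * x) (h₂ : τ * y = x * τ + (q - 1) • y)
    (h₃ : y * τ = τ * x + (q - 1) • y) : Commute τ ((1 - y) * (1 - x)) := by
  have e : τ * (y * x) = y * x * τ := by
    rw [← mul_assoc, h₂, add_mul, mul_assoc x, eq_sub_of_add_eq h₃.symm, mul_sub, ← hxy,
      mul_assoc x, mul_smul_comm, smul_mul_assoc, hxy]
    abel
  have e' : τ * y + τ * x = y * τ + x * τ := by rw [h₂, h₃]; abel
  have e2 : (1 - y) * (1 - x) = 1 - (y + x) + y * x := by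
    simp only [mul_sub, sub_mul, mul_one, one_mul]; abel
  rw [e2]
  refine ((Commute.one_right _).sub_right ?_).add_right e
  change τ * _ = _ * τ
  rw [mul_add, add_mul, e']

end abstract_identities

/-- The conditional expectation applied coefficientwise. -/
noncomputable def condExpSeries (d q : K) (n : ℕ) (φ : (H d q (n + 1))⟦X⟧) : (H d q n)⟦X⟧ :=
  PowerSeries.mk fun j => condExp d q n (coeff j φ)

/-- The inclusion applied coefficientwise. -/
noncomputable abbrev incSeries (d q : K) (n : ℕ) : (H d q n)⟦X⟧ →+* (H d q (n + 1))⟦X⟧ :=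
  PowerSeries.map (inc d q n : H d q n →+* H d q (n + 1))

theorem condExpSeries_add (φ ψ : (H d q (n + 1))⟦X⟧) :
    condExpSeries d q n (φ + ψ) = condExpSeries d q n φ + condExpSeries d q n ψ := by
  ext j; simp [condExpSeries]

theorem condExpSeries_smul (r : K) (φ : (H d q (n + 1))⟦X⟧) :
    condExpSeries d q n (r • φ) = r • condExpSeries d q n φ := by
  ext j; simp [condExpSeries]

theorem condExpSeries_incSeries_mul (φ : (H d q n)⟦X⟧) (ψ : (H d q (n + 1))⟦X⟧) :
    condExpSeries d q n (incSeries d q n φ * ψ) = φ * condExpSeries d q n ψ := by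
  ext j; simp [condExpSeries, coeff_mul, condExp_inc_mul]

theorem condExpSeries_mul_incSeries (φ : (H d q n)⟦X⟧) (ψ : (H d q (n + 1))⟦X⟧) :
    condExpSeries d q n (ψ * incSeries d q n φ) = condExpSeries d q n ψ * φ := by
  ext j; simp [condExpSeries, coeff_mul, condExp_mul_inc]

theorem condExpSeries_C_top : condExpSeries d q n (C (top d q n)) = 0 := by
  ext j
  simp only [condExpSeries, coeff_mk, coeff_C, map_zero]
  split_ifs
  · exact condExp_top
  · exact map_zero _

theorem condExpSeries_top_mul_mul_top (hq : q ≠ 0) (φ : (H d q (n + 1))⟦X⟧) :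
    condExpSeries d q (n + 1) (C (top d q (n + 1)) * incSeries d q (n + 1) φ *
      C (top d q (n + 1))) = q • incSeries d q n (condExpSeries d q n φ) := by
  ext j
  simp [condExpSeries, coeff_mul_C, coeff_C_mul, condExp_top_mul_inc_mul_top hq]

/-- The generating function of the conditional expectations of the positive powers of the last
Jucys-Murphy element. -/
noncomputable def momentSeries (d q : K) (n : ℕ) : (H d q n)⟦X⟧ :=
  condExpSeries d q n (geom (jm d q n) - 1)

theorem momentSeries_succ_aux (hq : q ≠ 0) :
    q • momentSeries d q (n + 1) = q • incSeries d q n (momentSeries d q n) +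
      (q - 1) ^ 2 • ((geom (jm d q n) - 1) * geom (jm d q n) * momentSeries d q (n + 1)) := by
  set τ : (H d q (n + 2))⟦X⟧ := C (top d q (n + 1))
  set x : (H d q (n + 2))⟦X⟧ := C (inc d q (n + 1) (jm d q n)) * X with hx
  set y : (H d q (n + 2))⟦X⟧ := C (jm d q (n + 1)) * X with hy
  set g' : (H d q (n + 1))⟦X⟧ := geom (jm d q n)
  set g : (H d q (n + 2))⟦X⟧ := geom (inc d q (n + 1) (jm d q n)) with hg
  set h : (H d q (n + 2))⟦X⟧ := geom (jm d q (n + 1))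
  have hgg : g = incSeries d q (n + 1) g' := (map_geom _ _).symm
  have h₂ : τ * y = x * τ + (q - 1) • y := by
    ext j
    rcases j with _ | j
    · simp [τ, x, y, ← mul_assoc]
    · have := top_mul_jm (d := d) (n := n) hq
      rw [hx, hy, mul_assoc _ X, (commute_X τ).symm.eq, ← mul_assoc, ← mul_assoc]
      simp only [map_add, coeff_succ_mul_X, coeff_smul, ← map_mul, τ, coeff_C]
      split_ifs <;> simp [this]
  have h₁ : q • y = τ * x * τ := by
    have : τ * x * τ = C (q • jm d q (n + 1)) * X := by
      rw [jm_succ, smul_smul, mul_inv_cancel₀ hq, one_smul, map_mul, map_mul, hx, mul_assoc,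
        mul_assoc, (commute_X τ).symm.eq]
      simp only [mul_assoc, τ]
    rw [this]
    ext j
    rcases j with _ | j
    · simp [y]
    · simp only [y, coeff_smul, coeff_succ_mul_X, coeff_C]
      split_ifs <;> simp
  have e := smul_geom_sub_one_eq h₁ h₂ (mul_geom _) (geom_mul _) (mul_geom (jm d q (n + 1)))
  have e2 : τ * h = g * τ + (q - 1) • (g * (h - 1)) :=
    mul_geom_eq h₂ (geom_mul _) (mul_geom (jm d q (n + 1)))
  have hcomm : Commute g h := by
    ext j
    simp only [coeff_mul, g, h, geom, coeff_mk]
    rw [← Finset.Nat.sum_antidiagonal_swap]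
    refine Finset.sum_congr rfl fun p _ => ?_
    exact ((commute_jm (jm d q n)).symm.pow_pow _ _).eq
  set Ω := momentSeries d q (n + 1)
  have hΩ : condExpSeries d q (n + 1) (h - 1) = Ω := rfl
  have hcΩ : g' * Ω = Ω * g' := by
    rw [← hΩ, ← condExpSeries_incSeries_mul, ← condExpSeries_mul_incSeries, ← hgg, mul_sub, sub_mul,
      hcomm.eq, mul_one, one_mul]
  have e3 : condExpSeries d q (n + 1) (τ * (h - 1)) = (q - 1) • (g' * Ω) := by
    have : τ * (h - 1) = (g - 1) * τ + (q - 1) • (g * (h - 1)) := by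
      rw [mul_sub, e2, sub_mul, mul_one, one_mul]; abel
    have hg1 : g - 1 = incSeries d q (n + 1) (g' - 1) := by rw [map_sub, map_one, hgg]
    rw [this, condExpSeries_add, condExpSeries_smul, hg1, hgg, condExpSeries_incSeries_mul,
      condExpSeries_incSeries_mul, condExpSeries_C_top, hΩ, mul_zero, zero_add]
  have e4 : τ * (g - 1) * (h - 1) = τ * (h - 1) * incSeries d q (n + 1) (g' - 1) := by
    rw [map_sub, map_one, ← hgg, mul_assoc, mul_assoc]
    congr 1
    simp only [mul_sub, sub_mul, hcomm.eq, one_mul, mul_one]; abel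
  have := congrArg (condExpSeries d q (n + 1)) e
  rw [condExpSeries_smul, condExpSeries_add, condExpSeries_smul] at this
  change q • Ω = _ + (q - 1) • condExpSeries d q (n + 1) (τ * (g - 1) * (h - 1)) at this
  rw [e4, condExpSeries_mul_incSeries, e3] at this
  have e5 : τ * (g - 1) * τ = τ * incSeries d q (n + 1) (g' - 1) * τ := by
    rw [map_sub, map_one, ← hgg]
  change q • Ω = condExpSeries d q (n + 1) (τ * (g - 1) * τ) + _ at this
  rw [e5, condExpSeries_top_mul_mul_top hq] at this
  rw [this]
  congr 1
  rw [smul_mul_assoc, smul_smul, ← pow_two]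
  congr 1
  rw [mul_assoc g', mul_sub, ← hcΩ, mul_one, sub_mul, sub_mul, one_mul, mul_sub, ← mul_assoc]

theorem momentSeries_succ (hq : q ≠ 0) :
    (1 - q • (C (jm d q n) * X)) * (1 - q⁻¹ • (C (jm d q n) * X)) * momentSeries d q (n + 1) =
      (1 - C (jm d q n) * X) * (1 - C (jm d q n) * X) * incSeries d q n (momentSeries d q n) := by
  set x : (H d q (n + 1))⟦X⟧ := C (jm d q n) * X with hx
  have h := momentSeries_succ_aux (d := d) (n := n) hq
  set g : (H d q (n + 1))⟦X⟧ := geom (jm d q n)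
  have hg : (1 - x) * g = 1 := mul_geom _
  have hg' : g * (1 - x) = 1 := geom_mul _
  have e1 : (1 - x) * (1 - x) * ((g - 1) * g) = x := by
    have : (1 - x) * (g - 1) = x := by rw [mul_sub, hg]; simp
    rw [mul_assoc, ← mul_assoc _ (g - 1), this]
    have : (1 - x) * x = x * (1 - x) := by simp [sub_mul, mul_sub]
    rw [← mul_assoc, this, mul_assoc, hg, mul_one]
  have h2 := congrArg (fun z => q⁻¹ • ((1 - x) * (1 - x) * z)) h
  simp only [mul_add, mul_smul_comm, smul_add, smul_smul, inv_mul_cancel₀ hq, one_smul] at h2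
  rw [← mul_assoc ((1 - x) * (1 - x)) _ (momentSeries d q (n + 1)), e1] at h2
  rw [← sub_eq_iff_eq_add.2 h2, ← smul_mul_assoc (q⁻¹ * (q - 1) ^ 2) x, ← sub_mul]
  congr 1
  exact factor_mul_factor hq x

/-- The polynomial `∏ (1 - a L_k X)` over all Jucys-Murphy elements of `H_q(B_n)`. -/
noncomputable def zSeries (d q a : K) : ∀ n, (H d q n)⟦X⟧
  | 0 => 1
  | n + 1 => (1 - a • (C (jm d q n) * X)) * incSeries d q n (zSeries d q a n)

theorem commute_factor (a : K) (φ : (H d q n)⟦X⟧) :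
    Commute (1 - a • (C (jm d q n) * X)) (incSeries d q n φ) := by
  refine (Commute.one_left _).sub_left (Commute.smul_left (Commute.mul_left ?_
    (commute_X _).symm) _)
  ext j
  rw [coeff_C_mul, coeff_mul_C]
  simp [(commute_jm (coeff j φ)).eq]

theorem momentSeries_zero :
    (1 - X) * (1 - d • X) * momentSeries d q 0 = -(d • X ^ 2) := by
  have hp : ∀ j, condExp d q 0 (jm d q 0 ^ (j + 2)) =
      (1 + d) • condExp d q 0 (jm d q 0 ^ (j + 1)) - d • condExp d q 0 (jm d q 0 ^ j) := by
    intro j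
    rw [pow_add, pow_two, jm_zero, top_zero_mul_top_zero, mul_add, mul_smul_comm, mul_smul_comm,
      ← pow_succ, map_add, map_smul, map_smul, mul_one, sub_eq_add_neg]
    congr 1
    exact neg_smul d (condExp d q 0 (jm d q 0 ^ j))
  have hc : ∀ j, coeff j (momentSeries d q 0) = condExp d q 0 (jm d q 0 ^ j) - coeff j 1 := by
    intro j
    simp only [momentSeries, condExpSeries, coeff_mk, map_sub, geom, coeff_one]
    split_ifs <;> simp [condExp_one]
  have e : (1 - X) * (1 - d • X) * momentSeries d q 0 =
      momentSeries d q 0 - (1 + d) • (momentSeries d q 0 * X) +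
        d • (momentSeries d q 0 * X * X) := by
    exact factor_mul_factor_mul (commute_X _).symm.eq
  rw [e]
  ext j
  rcases j with _ | _ | j
  · have h0 : coeff 0 (momentSeries d q 0) = 0 := by rw [hc]; simp [condExp_one]
    rw [map_add, map_sub, h0, coeff_smul, coeff_smul, coeff_zero_mul_X, coeff_zero_mul_X, map_neg,
      coeff_smul, coeff_X_pow, if_neg (by decide)]
    simp
  · have : condExp d q 0 (jm d q 0) = 0 := condExp_jm
    simp [hc, condExp_one, coeff_succ_mul_X, this, coeff_X_pow]
  · simp only [map_add, map_sub, coeff_smul, coeff_succ_mul_X, hc, map_neg, coeff_X_pow, hp]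
    rcases j with _ | j
    · simp [condExp_one, coeff_one]
    · simp [coeff_one]

theorem momentSeries_eq (hq : q ≠ 0) (n : ℕ) :
    (1 - X) * (1 - d • X) * (zSeries d q q n * zSeries d q q⁻¹ n * momentSeries d q n) =
      -(d • X ^ 2) * (zSeries d q 1 n * zSeries d q 1 n) := by
  induction n with
  | zero => simp [zSeries, momentSeries_zero]
  | succ n ih =>
    have e1 : zSeries d q q (n + 1) * zSeries d q q⁻¹ (n + 1) * momentSeries d q (n + 1) =
        incSeries d q n (zSeries d q q n * zSeries d q q⁻¹ n) * ((1 - q • (C (jm d q n) * X)) *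
          (1 - q⁻¹ • (C (jm d q n) * X)) * momentSeries d q (n + 1)) := by
      simp only [zSeries]
      rw [(commute_factor q _).eq, (commute_factor q⁻¹ _).eq, map_mul]
      simp only [mul_assoc]
      rw [← mul_assoc (1 - q • _) (incSeries d q n _), (commute_factor q _).eq]
      simp only [mul_assoc]
    have e2 : incSeries d q n ((1 - X) * (1 - d • X)) = (1 - X) * (1 - d • X) := by
      have : incSeries d q n (d • X) = d • X := by
        ext j
        by_cases hj : j = 1 <;> simp [coeff_X, hj]
      rw [map_mul, map_sub, map_sub, map_one, map_X, this]
    have hX : ∀ φ : (H d q (n + 1))⟦X⟧, Commute ((1 - X) * (1 - d • X)) φ := fun φ =>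
      ((Commute.one_left _).sub_left (commute_X φ).symm).mul_left
        ((Commute.one_left _).sub_left ((commute_X φ).symm.smul_left d))
    have hu : ∀ φ : (H d q n)⟦X⟧,
        Commute (1 - C (jm d q n) * X) (incSeries d q n φ) := fun φ => by
      simpa only [one_smul] using commute_factor (d := d) (q := q) (1 : K) φ
    set u : (H d q (n + 1))⟦X⟧ := 1 - C (jm d q n) * X with hu'
    have hz : zSeries d q 1 (n + 1) = u * incSeries d q n (zSeries d q 1 n) := by
      rw [zSeries, one_smul]
    have e3 := congrArg (incSeries d q n) ih
    rw [map_mul, e2] at e3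
    have e4 : incSeries d q n (-(d • X ^ 2)) = -(d • X ^ 2) := by
      have : incSeries d q n (d • X ^ 2) = d • X ^ 2 := by
        ext j
        by_cases hj : j = 2 <;> simp [coeff_X_pow, hj]
      rw [map_neg, this]
    have hX2 : ∀ φ : (H d q (n + 1))⟦X⟧, Commute (-(d • X ^ 2)) φ := fun φ =>
      (((commute_X φ).symm.pow_left 2).smul_left d).neg_left
    rw [e1, momentSeries_succ hq]
    calc _ = (1 - X) * (1 - d • X) * (u * u * incSeries d q n
            (zSeries d q q n * zSeries d q q⁻¹ n * momentSeries d q n)) := by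
          rw [map_mul _ _ (momentSeries d q n), ← mul_assoc,
            ← mul_assoc, mul_assoc _ (incSeries d q n _), ← hu', ((hu _).mul_left (hu _)).symm.eq]
          simp only [mul_assoc]
      _ = u * u * ((1 - X) * (1 - d • X) * incSeries d q n
            (zSeries d q q n * zSeries d q q⁻¹ n * momentSeries d q n)) := by
          rw [← mul_assoc, (hX (u * u)).eq, mul_assoc]
      _ = _ := by
          rw [e3, map_mul, e4, ← mul_assoc, (hX2 (u * u)).symm.eq, mul_assoc, hz, map_mul]
          rw [(hu _).symm.mul_mul_mul_comm]

theorem coeff_zero_zSeries (a : K) (n : ℕ) : coeff 0 (zSeries d q a n) = 1 := by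
  induction n with
  | zero => simp [zSeries]
  | succ n ih =>
    rw [zSeries, sub_mul, one_mul, smul_mul_assoc, mul_assoc, map_sub, coeff_map, ih, coeff_smul,
      coeff_C_mul, coeff_zero_X_mul]
    simp

theorem coeff_zSeries (a : K) (n j : ℕ) :
    coeff j (zSeries d q a n) = a ^ j • coeff j (zSeries d q 1 n) := by
  induction n generalizing j with
  | zero =>
    simp only [zSeries, coeff_one]
    split_ifs with h <;> simp [h]
  | succ n ih =>
    rcases j with _ | j
    · simp [coeff_zero_zSeries]
    · have : ∀ b : K, coeff (j + 1) (zSeries d q b (n + 1)) =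
          inc d q n (coeff (j + 1) (zSeries d q b n)) -
            b • (jm d q n * inc d q n (coeff j (zSeries d q b n))) := fun b => by
        rw [zSeries, sub_mul, one_mul, smul_mul_assoc, mul_assoc, map_sub, coeff_smul, coeff_C_mul,
          coeff_succ_X_mul, coeff_map, coeff_map]
        rfl
      rw [this, this 1, ih, ih, map_smul, map_smul, one_smul, smul_sub, mul_smul_comm, smul_smul,
        pow_succ']

theorem coeff_succ_zSeries_succ (n j : ℕ) :
    coeff (j + 1) (zSeries d q 1 (n + 1)) = inc d q n (coeff (j + 1) (zSeries d q 1 n)) -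
      jm d q n * inc d q n (coeff j (zSeries d q 1 n)) := by
  rw [zSeries, sub_mul, one_mul, smul_mul_assoc, mul_assoc, map_sub, coeff_smul, coeff_C_mul,
    coeff_succ_X_mul, coeff_map, coeff_map, one_smul]
  rfl

theorem coeff_zSeries_of_lt {n j : ℕ} (h : n < j) : coeff j (zSeries d q 1 n) = 0 := by
  induction n generalizing j with
  | zero => rw [zSeries, coeff_one, if_neg (by omega)]
  | succ n ih =>
    obtain ⟨j, rfl⟩ := Nat.exists_eq_succ_of_ne_zero (by omega : j ≠ 0)
    rw [Nat.succ_eq_add_one, coeff_succ_zSeries_succ, ih (by omega), ih (by omega)]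
    simp

/-- The coefficients of `zSeries` are central. -/
theorem commute_coeff_zSeries (hq : q ≠ 0) (n j : ℕ) (h : H d q n) :
    Commute (coeff j (zSeries d q 1 n)) h := by
  induction n generalizing j with
  | zero =>
    obtain ⟨r, rfl⟩ := algebraMap_surjective_zero h
    exact (Algebra.commutes r _).symm
  | succ n ih =>
    have hinc : ∀ a j, Commute (coeff j (zSeries d q 1 (n + 1))) (inc d q n a) := by
      intro a j
      rcases j with _ | j
      · rw [coeff_zero_zSeries]
        exact Commute.one_left _
      · rw [coeff_succ_zSeries_succ]
        exact ((ih _ a).map (inc d q n)).sub_left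
          ((commute_jm a).mul_left ((ih _ a).map (inc d q n)))
    have htop : Commute (coeff j (zSeries d q 1 (n + 1))) (top d q n) := by
      rcases n with _ | n
      · rcases j with _ | _ | j
        · rw [coeff_zero_zSeries]
          exact Commute.one_left _
        · rw [coeff_succ_zSeries_succ, coeff_zSeries_of_lt (j := 0 + 1) one_pos,
            coeff_zero_zSeries, map_zero, map_one, mul_one, zero_sub, jm_zero]
          exact (Commute.refl (top d q 0)).neg_left
        · rw [coeff_zSeries_of_lt (by omega)]
          exact Commute.zero_left _
      · have e : Commute (C (top d q (n + 1))) (zSeries d q 1 (n + 2)) := by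
          have hm : ∀ a b : H d q (n + 2), C a * (C b * X) = C (a * b) * X := fun a b => by
            rw [← mul_assoc, map_mul]
          have hm' : ∀ a b : H d q (n + 2), C a * X * C b = C (a * b) * X := fun a b => by
            rw [mul_assoc, (commute_X _).symm.eq, ← mul_assoc, map_mul]
          rw [zSeries, zSeries, map_mul, map_sub, map_one, one_smul, one_smul, map_mul, map_X,
            map_C, ← mul_assoc]
          refine Commute.mul_right (commute_factor_mul_factor (q := q) ?_ ?_ ?_) ?_
          · rw [← mul_assoc, ← mul_assoc]
            exact congrArg (· * X) ((hm' _ _).trans ((congrArg (fun a => C a * X)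
              (commute_jm (jm d q n)).symm.eq).trans (hm' _ _).symm))
          · rw [hm, top_mul_jm hq, hm']
            rw [map_add, add_mul, C_smul, smul_mul_assoc]
            rfl
          · rw [hm, hm', jm_mul_top hq]
            rw [map_add, add_mul, C_smul, smul_mul_assoc]
            rfl
          · ext j
            rw [coeff_C_mul, coeff_mul_C, coeff_map, coeff_map]
            exact commute_top _
        have := congrArg (coeff j) e.eq
        rw [coeff_C_mul, coeff_mul_C] at this
        exact this.symm
    induction h using induction_gen with
    | hs r => exact (Algebra.commutes r _).symm
    | hg i hi =>
      rcases Nat.lt_succ_iff_lt_or_eq.1 hi with h | rfl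
      · rw [← inc_gen h]
        exact hinc _ _
      · exact htop
    | hm a b ha hb => exact ha.mul_right hb
    | ha a b ha hb => exact ha.add_right hb

end HeckeB

namespace HeckeB

section pairing

variable {R A : Type*} [CommRing R] [Ring A] [Algebra R A]

/-- The pairing `∑ f_i g_i` of a polynomial with a sequence. -/
noncomputable def pairing (g : ℕ → A) : Polynomial R →ₗ[R] A :=
  Polynomial.lsum fun i => LinearMap.toSpanSingleton R A (g i)

theorem pairing_apply (g : ℕ → A) (f : Polynomial R) :
    pairing g f = f.sum fun i r => r • g i := rfl

theorem pairing_monomial (g : ℕ → A) (i : ℕ) (r : R) :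
    pairing g (Polynomial.monomial i r) = r • g i := by
  rw [pairing_apply, Polynomial.sum_monomial_index r (fun i r => r • g i) (zero_smul _ _)]

theorem pairing_one (g : ℕ → A) : pairing g (1 : Polynomial R) = g 0 := by
  rw [← Polynomial.monomial_zero_one, pairing_monomial, one_smul]

theorem pairing_C_mul (g : ℕ → A) (r : R) (f : Polynomial R) :
    pairing g (Polynomial.C r * f) = r • pairing g f := by
  rw [← Polynomial.smul_eq_C_mul, map_smul]

theorem pairing_X_mul (g : ℕ → A) (f : Polynomial R) :
    pairing g (Polynomial.X * f) = pairing (fun i => g (i + 1)) f := by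
  induction f using Polynomial.induction_on' with
  | add p q hp hq => rw [mul_add, map_add, map_add, hp, hq]
  | monomial i r => rw [Polynomial.X_mul_monomial, pairing_monomial, pairing_monomial]

theorem pairing_X_sub_C_mul (g : ℕ → A) (r : R) (f : Polynomial R) :
    pairing g ((Polynomial.X - Polynomial.C r) * f) = pairing (fun i => g (i + 1) - r • g i) f := by
  induction f using Polynomial.induction_on' with
  | add p q hp hq => rw [mul_add, map_add, map_add, hp, hq]
  | monomial i s =>
    rw [sub_mul, map_sub, pairing_C_mul, pairing_X_mul, pairing_monomial, pairing_monomial,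
      pairing_monomial, smul_sub, smul_comm]

theorem pairing_eq_map {B : Type*} [Ring B] [Algebra R B] (φ : A →+ B)
    (hφ : ∀ (r : R) a, φ (r • a) = r • φ a) (g : ℕ → A) (f : Polynomial R) :
    pairing (fun i => φ (g i)) f = φ (pairing g f) := by
  induction f using Polynomial.induction_on' with
  | add p q hp hq => rw [map_add, map_add, map_add, hp, hq]
  | monomial i r => rw [pairing_monomial, pairing_monomial, hφ]

theorem pairing_add_left (g h : ℕ → A) (f : Polynomial R) :
    pairing (fun i => g i + h i) f = pairing g f + pairing h f := by
  induction f using Polynomial.induction_on' with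
  | add p q hp hq => rw [map_add, map_add, map_add, hp, hq]; abel
  | monomial i r => simp only [pairing_monomial, smul_add]

theorem pairing_mul_left (a : A) (g : ℕ → A) (f : Polynomial R) :
    pairing (fun i => a * g i) f = a * pairing g f :=
  pairing_eq_map (AddMonoidHom.mulLeft a) (fun r b => mul_smul_comm r a b) g f

theorem pairing_mul_right (a : A) (g : ℕ → A) (f : Polynomial R) :
    pairing (fun i => g i * a) f = pairing g f * a :=
  pairing_eq_map (AddMonoidHom.mulRight a) (fun r b => smul_mul_assoc r b a) g f

theorem pairing_pow (a : A) (f : Polynomial R) : pairing (fun i => a ^ i) f = f.aeval a := by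
  rw [pairing_apply, Polynomial.aeval_eq_sum_range, Polynomial.sum_over_range]
  simp

open PowerSeries in
/-- The power series `∏ (1 - a X)`. -/
noncomputable def factorSeries (s : Multiset R) : R⟦X⟧ := (s.map fun a => 1 - C a * X).prod

/-- The polynomial `∏ (X - a)`. -/
noncomputable def factorPoly (s : Multiset R) : Polynomial R :=
  (s.map fun a => Polynomial.X - Polynomial.C a).prod

open PowerSeries

theorem factorSeries_zero : factorSeries (0 : Multiset R) = 1 := by simp [factorSeries]

theorem factorSeries_cons (a : R) (s : Multiset R) :
    factorSeries (a ::ₘ s) = (1 - C a * X) * factorSeries s := by simp [factorSeries]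

theorem factorSeries_add (s t : Multiset R) :
    factorSeries (s + t) = factorSeries s * factorSeries t := by simp [factorSeries]

theorem factorPoly_zero : factorPoly (0 : Multiset R) = 1 := by simp [factorPoly]

theorem factorPoly_cons (a : R) (s : Multiset R) :
    factorPoly (a ::ₘ s) = (Polynomial.X - Polynomial.C a) * factorPoly s := by simp [factorPoly]

theorem eval_factorPoly (c : R) (s : Multiset R) :
    (factorPoly s).eval c = (s.map fun a => c - a).prod := by
  rw [factorPoly, Polynomial.eval_multiset_prod, Multiset.map_map]
  simp

theorem coeff_zero_factorSeries (s : Multiset R) : coeff 0 (factorSeries s) = 1 := by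
  induction s using Multiset.induction_on with
  | empty => simp [factorSeries_zero]
  | cons a s ih =>
    rw [factorSeries_cons, sub_mul, one_mul, mul_assoc, map_sub, ih, coeff_C_mul, coeff_zero_X_mul]
    simp

theorem coeff_succ_factorSeries_cons (a : R) (s : Multiset R) (j : ℕ) :
    coeff (j + 1) (factorSeries (a ::ₘ s)) =
      coeff (j + 1) (factorSeries s) - a * coeff j (factorSeries s) := by
  rw [factorSeries_cons, sub_mul, one_mul, mul_assoc, map_sub, coeff_C_mul, coeff_succ_X_mul]

theorem coeff_factorSeries_of_card_lt {s : Multiset R} {j : ℕ} (h : Multiset.card s < j) :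
    coeff j (factorSeries s) = 0 := by
  induction s using Multiset.induction_on generalizing j with
  | empty => rw [factorSeries_zero, coeff_one, if_neg (by simp at h; omega)]
  | cons a s ih =>
    rw [Multiset.card_cons] at h
    obtain ⟨j, rfl⟩ := Nat.exists_eq_succ_of_ne_zero (by omega : j ≠ 0)
    rw [Nat.succ_eq_add_one, coeff_succ_factorSeries_cons, ih (by omega), ih (by omega)]
    simp

theorem coeff_factorSeries_map_mul (r : R) (s : Multiset R) (j : ℕ) :
    coeff j (factorSeries (s.map (r * ·))) = r ^ j * coeff j (factorSeries s) := by
  induction s using Multiset.induction_on generalizing j with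
  | empty =>
    rw [Multiset.map_zero, factorSeries_zero, coeff_one]
    split_ifs with h <;> simp [h]
  | cons a s ih =>
    rcases j with _ | j
    · simp only [coeff_zero_factorSeries, pow_zero, one_mul]
    · rw [Multiset.map_cons, coeff_succ_factorSeries_cons, coeff_succ_factorSeries_cons, ih, ih]
      ring

theorem pairing_factorPoly_mul (s : Multiset R) (G : A⟦X⟧) (f : Polynomial R) :
    pairing (fun i => coeff i G) (factorPoly s * f) = pairing (fun i =>
      coeff (i + Multiset.card s) (PowerSeries.map (algebraMap R A) (factorSeries s) * G)) f := by
  induction s using Multiset.induction_on generalizing f with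
  | empty => simp [factorPoly_zero, factorSeries_zero]
  | cons a s ih =>
    rw [factorPoly_cons, mul_comm (Polynomial.X - _), mul_assoc, ih, pairing_X_sub_C_mul]
    congr 2
    funext i
    have e : PowerSeries.map (algebraMap R A) (factorSeries (a ::ₘ s)) =
        (1 - C (algebraMap R A a) * X) * PowerSeries.map (algebraMap R A) (factorSeries s) := by
      rw [factorSeries_cons, map_mul, map_sub, map_one, map_mul, map_C, map_X]
    rw [e, mul_assoc, sub_mul, one_mul, mul_assoc (C _), Multiset.card_cons, ← add_assoc, map_sub,
      coeff_C_mul, coeff_succ_X_mul, add_right_comm, Algebra.smul_def]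

theorem coeff_factorSeries_mul_geom (s : Multiset R) (a : A) :
    coeff (Multiset.card s) (PowerSeries.map (algebraMap R A) (factorSeries s) * geom a) =
      (factorPoly s).aeval a := by
  have h := pairing_factorPoly_mul s (geom a) 1
  rw [pairing_one, zero_add, mul_one] at h
  rw [← h, ← pairing_pow]
  congr 2
  funext i
  simp [geom]

end pairing
end HeckeB

namespace HeckeB

open PowerSeries

variable {K : Type} [Field K] {d q : K} {n : ℕ} {R B : Type*} [CommRing R] [Ring B]
  [Algebra K B] [Algebra R B]

/-- The coefficients of `zSeries` act as the elementary symmetric functions of the multiset `s`. -/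
def HasContent (ρ : H d q n →ₐ[K] B) (s : Multiset R) : Prop :=
  ∀ j, ρ (coeff j (zSeries d q 1 n)) = algebraMap R B (coeff j (factorSeries s))

/-- The moment functional `(f, h) ↦ ∑ f_i ρ(E(L ^ (i + 1) h))`. -/
noncomputable def theta (ρ : H d q n →ₐ[K] B) (f : Polynomial R) (h : H d q (n + 1)) : B :=
  pairing (fun i => ρ (condExp d q n (jm d q n ^ (i + 1) * h))) f

section theta

variable (ρ : H d q n →ₐ[K] B) (f : Polynomial R) (h : H d q (n + 1))

theorem theta_inc_mul (a : H d q n) : theta ρ f (inc d q n a * h) = ρ a * theta ρ f h := by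
  rw [theta, theta, ← pairing_mul_left]
  congr 2
  funext i
  rw [← map_mul, ← condExp_inc_mul, ← mul_assoc, ← mul_assoc,
    ((commute_jm (d := d) (q := q) a).pow_left (i + 1)).eq]

theorem theta_mul_inc (a : H d q n) : theta ρ f (h * inc d q n a) = theta ρ f h * ρ a := by
  rw [theta, theta, ← pairing_mul_right]
  congr 2
  funext i
  rw [← map_mul, ← condExp_mul_inc, ← mul_assoc]

theorem theta_jm_mul : theta ρ f (jm d q n * h) = theta ρ (Polynomial.X * f) h := by
  rw [theta, theta, pairing_X_mul]
  congr 2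
  funext i
  rw [← mul_assoc, ← pow_succ]

theorem theta_add_right (h' : H d q (n + 1)) :
    theta ρ f (h + h') = theta ρ f h + theta ρ f h' := by
  simp only [theta, mul_add, map_add, pairing_add_left]

theorem theta_smul_right (r : K) : theta ρ f (r • h) = r • theta ρ f h := by
  have := theta_inc_mul ρ f h (algebraMap K _ r)
  rwa [AlgHom.commutes, AlgHom.commutes, ← Algebra.smul_def, ← Algebra.smul_def] at this

theorem theta_add_left (g : Polynomial R) : theta ρ (f + g) h = theta ρ f h + theta ρ g h :=
  map_add _ _ _

theorem theta_sub_left (g : Polynomial R) : theta ρ (f - g) h = theta ρ f h - theta ρ g h :=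
  map_sub _ _ _

theorem theta_C_mul (r : R) : theta ρ (Polynomial.C r * f) h = r • theta ρ f h :=
  pairing_C_mul _ _ _

theorem theta_mul_left_eq_zero (hf : ∀ h, theta ρ f h = 0) (g : Polynomial R) :
    theta ρ (g * f) h = 0 := by
  induction g using Polynomial.induction_on generalizing h with
  | C r => rw [theta_C_mul, hf, smul_zero]
  | add p q hp hq => rw [add_mul, theta_add_left, hp, hq, add_zero]
  | monomial i r ih => rw [pow_succ', mul_left_comm, mul_assoc, ← theta_jm_mul, ih]

theorem theta_factorPoly_mul_one (s : Multiset R) :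
    theta ρ (factorPoly s * f) 1 = pairing (fun i => coeff (i + Multiset.card s)
      (PowerSeries.map (algebraMap R B) (factorSeries s) *
        PowerSeries.mk (fun i => ρ (condExp d q n (jm d q n ^ (i + 1)))))) f := by
  rw [← pairing_factorPoly_mul, theta]
  congr 2
  funext i
  rw [mul_one, coeff_mk]

variable [Algebra K R] [IsScalarTower K R B]

theorem theta_map_eq_zero {P : Polynomial K} (hP : P.aeval (jm d q n) = 0) :
    theta ρ (P.map (algebraMap K R)) h = 0 := by
  have : theta ρ (P.map (algebraMap K R)) h =
      ρ (condExp d q n (P.aeval (jm d q n) * (jm d q n * h))) := by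
    clear hP
    induction P using Polynomial.induction_on' with
    | add p q hp hq => rw [Polynomial.map_add, theta_add_left, hp, hq, map_add, add_mul, map_add,
        map_add]
    | monomial i r =>
      rw [Polynomial.map_monomial, theta, pairing_monomial, Polynomial.aeval_monomial, mul_assoc,
        ← Algebra.smul_def, map_smul, map_smul, algebraMap_smul, ← mul_assoc, ← pow_succ]
  rw [this, hP, zero_mul, map_zero, map_zero]

end theta

variable [Algebra K R] [IsScalarTower K R B]

theorem HasContent.map_zSeries {ρ : H d q n →ₐ[K] B} {s : Multiset R} (hs : HasContent ρ s)
    (r : K) : PowerSeries.map (ρ : H d q n →+* B) (zSeries d q r n) =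
      PowerSeries.map (algebraMap R B) (factorSeries (s.map (algebraMap K R r * ·))) := by
  ext j
  rw [coeff_map, coeff_map, coeff_factorSeries_map_mul, coeff_zSeries, RingHom.coe_coe, map_smul,
    hs j, ← map_pow, map_mul, ← IsScalarTower.algebraMap_apply, Algebra.smul_def]

/-- The multiset governing the moments of the last Jucys-Murphy element. -/
def bigContent (d q : K) (s : Multiset R) : Multiset R :=
  1 ::ₘ algebraMap K R d ::ₘ (s.map (algebraMap K R q * ·) + s.map (algebraMap K R q⁻¹ * ·))

theorem HasContent.factorSeries_mul_moment (hq : q ≠ 0) {ρ : H d q n →ₐ[K] B} {s : Multiset R}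
    (hs : HasContent ρ s) : PowerSeries.map (algebraMap R B) (factorSeries (bigContent d q s)) *
      PowerSeries.mk (fun i => ρ (condExp d q n (jm d q n ^ (i + 1)))) =
    PowerSeries.map (algebraMap R B)
      (-(C (algebraMap K R d) * (X * factorSeries (s + s)))) := by
  set G : B⟦X⟧ := PowerSeries.mk (fun i => ρ (condExp d q n (jm d q n ^ (i + 1))))
  have hG : PowerSeries.map (ρ : H d q n →+* B) (momentSeries d q n) = X * G := by
    ext j
    rcases j with _ | j
    · simp [momentSeries, condExpSeries, geom, condExp_one]
    · simp [momentSeries, condExpSeries, geom, coeff_succ_X_mul, G, coeff_one]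
  have h := congrArg (PowerSeries.map (ρ : H d q n →+* B)) (momentSeries_eq (d := d) hq n)
  have hd : ∀ Y : (H d q n)⟦X⟧, PowerSeries.map (ρ : H d q n →+* B) (d • Y) =
      C (algebraMap R B (algebraMap K R d)) * PowerSeries.map (ρ : H d q n →+* B) Y := fun Y => by
    ext j
    rw [coeff_map, coeff_smul, coeff_C_mul, coeff_map, RingHom.coe_coe, map_smul,
      Algebra.smul_def, ← IsScalarTower.algebraMap_apply]
  have h1 : PowerSeries.map (ρ : H d q n →+* B) (zSeries d q 1 n) =
      PowerSeries.map (algebraMap R B) (factorSeries s) := by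
    simpa using hs.map_zSeries 1
  simp only [map_mul, map_sub, map_neg, map_one, hd, map_pow, map_X, hG, hs.map_zSeries q,
    hs.map_zSeries q⁻¹, h1] at h
  have h2 : X * (PowerSeries.map (algebraMap R B) (factorSeries (bigContent d q s)) * G) =
      X * (PowerSeries.map (algebraMap R B)
        (-(C (algebraMap K R d) * (X * factorSeries (s + s))))) := by
    rw [← mul_assoc, (commute_X _).symm.eq, mul_assoc, bigContent, factorSeries_cons,
      factorSeries_cons, factorSeries_add, factorSeries_add]
    simp only [map_mul, map_sub, map_neg, map_one, map_C, map_X, one_mul]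
    calc _ = _ := by simp only [mul_assoc]
      _ = _ := h
      _ = _ := by
        rw [mul_neg, neg_mul, ← mul_assoc X, (commute_X (C _)).symm.eq]
        simp only [mul_assoc, pow_two]
  ext j
  rw [← coeff_succ_X_mul, h2, coeff_succ_X_mul]

theorem card_bigContent (s : Multiset R) :
    Multiset.card (bigContent d q s) = 2 * Multiset.card s + 2 := by
  simp [bigContent]; ring

theorem theta_factorPoly_mul_one_eq_zero (hq : q ≠ 0) {ρ : H d q n →ₐ[K] B} {s t : Multiset R}
    (hs : HasContent ρ s) (ht : factorSeries t = factorSeries (bigContent d q s))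
    (hc : Multiset.card t = 2 * Multiset.card s + 2) (f : Polynomial R) :
    theta ρ (factorPoly t * f) 1 = 0 := by
  rw [theta_factorPoly_mul_one, ht, hs.factorSeries_mul_moment hq, hc]
  have : (fun i => coeff (i + (2 * Multiset.card s + 2)) (PowerSeries.map (algebraMap R B)
      (-(C (algebraMap K R d) * (X * factorSeries (s + s)))))) = fun i => 0 * (0 : B) := by
    funext i
    rw [coeff_map, map_neg, coeff_C_mul, show i + (2 * Multiset.card s + 2) =
      i + 2 * Multiset.card s + 1 + 1 by ring, coeff_succ_X_mul,
      coeff_factorSeries_of_card_lt (by rw [Multiset.card_add]; omega)]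
    simp
  rw [this, pairing_mul_left (0 : B) (fun _ => 0), zero_mul]

theorem theta_factorPoly_one (hq : q ≠ 0) {ρ : H d q n →ₐ[K] B} {s t : Multiset R} {c : R}
    (hs : HasContent ρ s) (ht : factorSeries (c ::ₘ t) = factorSeries (bigContent d q s))
    (hc : Multiset.card t = 2 * Multiset.card s + 1) :
    theta ρ (factorPoly t) 1 =
      algebraMap R B (-(algebraMap K R d * (s.map fun a => c - a).prod ^ 2)) := by
  have h := theta_factorPoly_mul_one ρ 1 t
  rw [mul_one, pairing_one, zero_add] at h
  rw [h]
  have h1 := hs.factorSeries_mul_moment hq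
  rw [← ht, factorSeries_cons] at h1
  have h2 : PowerSeries.map (algebraMap R B) (factorSeries t) *
        PowerSeries.mk (fun i => ρ (condExp d q n (jm d q n ^ (i + 1)))) =
      PowerSeries.map (algebraMap R B)
        (-(C (algebraMap K R d) * (X * (factorSeries (s + s) * geom c)))) := by
    have e : (geom c : R⟦X⟧) * ((1 - C c * X) * factorSeries t) = factorSeries t := by
      rw [← mul_assoc, geom_mul, one_mul]
    conv_lhs => rw [← e]
    rw [map_mul, mul_assoc, h1, ← map_mul]
    congr 1
    ring
  rw [h2, hc, coeff_map, map_neg, coeff_C_mul, coeff_succ_X_mul]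
  have h3 := coeff_factorSeries_mul_geom (s + s) c
  rw [Multiset.card_add, ← two_mul, Algebra.algebraMap_self, PowerSeries.map_id] at h3
  rw [id_eq] at h3
  rw [h3, Polynomial.coe_aeval_eq_eval, eval_factorPoly, Multiset.map_add, Multiset.prod_add,
    pow_two]

end HeckeB

namespace HeckeB

open PowerSeries

variable {K : Type} [Field K] {d q : K} {n : ℕ} {R B : Type*} [CommRing R] [Ring B]
  [Algebra K B] [Algebra R B]

theorem isUnit_eval_of_isNilpotent_sub {p : Polynomial R} {a b : R} (hp : IsUnit (p.eval a))
    (hab : IsNilpotent (b - a)) : IsUnit (p.eval b) := by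
  obtain ⟨r, hr⟩ := Polynomial.sub_dvd_eval_sub b a p
  rw [eq_add_of_sub_eq' hr]
  exact ((Commute.all _ _).isNilpotent_mul_right hab).isUnit_add_left_of_commute hp
    (Commute.all _ _)

theorem commute_map_algebraMap (φ : R⟦X⟧) (ψ : B⟦X⟧) :
    Commute (PowerSeries.map (algebraMap R B) φ) ψ := by
  ext j
  rw [coeff_mul, coeff_mul, ← Finset.Nat.sum_antidiagonal_swap]
  refine Finset.sum_congr rfl fun p _ => ?_
  rw [coeff_map]
  exact Algebra.commutes _ _

theorem aeval_factorPoly_jm {ρ : H d q (n + 1) →ₐ[K] B} {s : Multiset R} (hs : HasContent ρ s)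
    (hc : Multiset.card s = n + 1) : (factorPoly s).aeval (ρ (jm d q n)) = 0 := by
  have h : PowerSeries.map (algebraMap R B) (factorSeries s) = (1 - C (ρ (jm d q n)) * X) *
      PowerSeries.map (ρ : H d q (n + 1) →+* B) (incSeries d q n (zSeries d q 1 n)) := by
    have : PowerSeries.map (algebraMap R B) (factorSeries s) =
        PowerSeries.map (ρ : H d q (n + 1) →+* B) (zSeries d q 1 (n + 1)) := by
      ext j
      rw [coeff_map, coeff_map, ← hs j]
      rfl
    rw [this, zSeries, one_smul, map_mul, map_sub, map_one, map_mul, map_C, map_X]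
    rfl
  rw [← coeff_factorSeries_mul_geom, (commute_map_algebraMap _ _).eq, h, ← mul_assoc, geom_mul,
    one_mul, coeff_map, coeff_map, hc, coeff_zSeries_of_lt n.lt_succ_self, map_zero, map_zero]

section

variable {ρ : H d q (n + 1) →ₐ[K] B} {f : Polynomial R}

theorem theta_X_mul_top (hq : q ≠ 0) : theta ρ (Polynomial.X * f) (top d q (n + 1)) =
    theta ρ f (top d q (n + 1)) * ρ (jm d q n) + (q - 1) • theta ρ (Polynomial.X * f) 1 := by
  rw [← theta_jm_mul, jm_mul_top hq, theta_add_right, theta_mul_inc, theta_smul_right,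
    ← theta_jm_mul, mul_one]

theorem theta_eq_zero_of_X_sub_C_mul (hq : q ≠ 0) {s : Multiset R} {ζ : R} (hs : HasContent ρ s)
    (hc : Multiset.card s = n + 1) (hζ : IsUnit ((factorPoly s).eval ζ))
    (hf : ∀ g, theta ρ (g * f) 1 = 0)
    (hf' : ∀ h, theta ρ ((Polynomial.X - Polynomial.C ζ) * f) h = 0) (h : H d q (n + 2)) :
    theta ρ f h = 0 := by
  have hf1 : theta ρ f 1 = 0 := by simpa using hf 1
  have htop : theta ρ f (top d q (n + 1)) = 0 := by
    set y := theta ρ f (top d q (n + 1))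
    set x := ρ (jm d q n) with hx
    have e : y * (x - algebraMap R B ζ) = 0 := by
      have := hf' (top d q (n + 1))
      rwa [sub_mul, theta_sub_left, theta_X_mul_top hq, hf, smul_zero, add_zero, theta_C_mul,
        Algebra.smul_def, Algebra.commutes, ← mul_sub] at this
    obtain ⟨g, hg⟩ := Polynomial.X_sub_C_dvd_sub_C_eval (p := factorPoly s) (a := ζ)
    have e2 := congrArg (Polynomial.aeval x) hg
    rw [map_sub, aeval_factorPoly_jm hs hc, map_mul, map_sub, Polynomial.aeval_C,
      Polynomial.aeval_C, Polynomial.aeval_X, zero_sub] at e2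
    have e3 : y * algebraMap R B ((factorPoly s).eval ζ) = 0 := by
      rw [← neg_eq_zero, ← mul_neg, e2, ← mul_assoc, e, zero_mul]
    exact (hζ.map (algebraMap R B)).mul_left_eq_zero.1 e3
  induction h using induction_span hq with
  | hadd a b ha hb => rw [theta_add_right, ha, hb, add_zero]
  | hinc a => rw [← one_mul (inc d q (n + 1) a), theta_mul_inc, hf1, zero_mul]
  | hjm a => rw [theta_mul_inc, ← mul_one (jm d q (n + 1)), theta_jm_mul, hf, zero_mul]
  | htop a b => rw [theta_mul_inc, theta_inc_mul, htop, mul_zero, zero_mul]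

theorem theta_eq_zero_of_X_sub_C_pow_mul (hq : q ≠ 0) {s : Multiset R} {ζ : R}
    (hs : HasContent ρ s) (hc : Multiset.card s = n + 1) (hζ : IsUnit ((factorPoly s).eval ζ))
    (hf : ∀ g, theta ρ (g * f) 1 = 0) (N : ℕ)
    (hf' : ∀ h, theta ρ ((Polynomial.X - Polynomial.C ζ) ^ N * f) h = 0) (h : H d q (n + 2)) :
    theta ρ f h = 0 := by
  induction N with
  | zero => simpa using hf' h
  | succ N ih =>
    refine ih (theta_eq_zero_of_X_sub_C_mul hq hs hc hζ (fun g => ?_) fun h => ?_)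
    · rw [← mul_assoc, hf]
    · rw [← mul_assoc, ← pow_succ', hf']

end

variable [Algebra K R] [IsScalarTower K R B]

theorem exists_bimodule_map (hq : q ≠ 0) (hd : d ≠ 0) {ρ : H d q (n + 1) →ₐ[K] B}
    {s t : Multiset R} {c : R} {ζ : K} (hs : HasContent ρ s) (hc : Multiset.card s = n + 1)
    (hζ : IsNilpotent (c - algebraMap K R ζ)) (hu : IsUnit ((factorPoly s).eval c))
    (ht : factorSeries (c ::ₘ t) = factorSeries (bigContent d q s))
    (htc : Multiset.card t = 2 * Multiset.card s + 1) :
    ∃ ψ : H d q (n + 2) →ₗ[K] B, ψ 1 = 1 ∧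
      (∀ a h, ψ (inc d q (n + 1) a * h) = ρ a * ψ h) ∧
      (∀ a h, ψ (h * inc d q (n + 1) a) = ψ h * ρ a) ∧
      ∀ h, ψ (jm d q (n + 1) * h) = c • ψ h := by
  have := finite_H (d := d) hq (n + 2)
  have hζ' : IsNilpotent (algebraMap K R ζ - c) := by rw [← neg_sub]; exact hζ.neg
  obtain ⟨P, hP, hP'⟩ := Polynomial.exists_eq_pow_rootMultiplicity_mul_and_not_dvd
    (minpoly K (jm d q (n + 1))) (minpoly.ne_zero (Algebra.IsIntegral.isIntegral _)) ζ
  set N := (minpoly K (jm d q (n + 1))).rootMultiplicity ζ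
  set P₁ : Polynomial R := P.map (algebraMap K R)
  have hPu : IsUnit (P₁.eval c) := by
    refine isUnit_eval_of_isNilpotent_sub ?_ hζ
    rw [Polynomial.eval_map_algebraMap, Polynomial.aeval_algebraMap_apply]
    refine IsUnit.map _ (IsUnit.mk0 _ fun h => hP' (Polynomial.dvd_iff_isRoot.2 ?_))
    simpa using h
  have h0 : ∀ g, theta ρ (g * (factorPoly (c ::ₘ t) * P₁)) 1 = 0 := fun g => by
    rw [mul_left_comm]
    exact theta_factorPoly_mul_one_eq_zero hq hs ht (by rw [Multiset.card_cons, htc]) _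
  have h1 : ∀ h, theta ρ (factorPoly (c ::ₘ t) * P₁) h = 0 := by
    refine theta_eq_zero_of_X_sub_C_pow_mul hq hs hc (isUnit_eval_of_isNilpotent_sub hu hζ') h0 N
      fun h => ?_
    have e : (Polynomial.X - Polynomial.C (algebraMap K R ζ)) ^ N * (factorPoly (c ::ₘ t) * P₁) =
        factorPoly (c ::ₘ t) * (minpoly K (jm d q (n + 1))).map (algebraMap K R) := by
      rw [hP]
      simp only [Polynomial.map_mul, Polynomial.map_pow, Polynomial.map_sub, Polynomial.map_X,
        Polynomial.map_C]
      ring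
    rw [e]
    exact theta_mul_left_eq_zero ρ _ h (fun h => theta_map_eq_zero ρ h (minpoly.aeval _ _)) _
  have h2 : theta ρ (factorPoly t * P₁) 1 = P₁.eval c • theta ρ (factorPoly t) 1 := by
    obtain ⟨g, hg⟩ := Polynomial.X_sub_C_dvd_sub_C_eval (p := P₁) (a := c)
    have e : factorPoly t * P₁ = Polynomial.C (P₁.eval c) * factorPoly t +
        factorPoly (c ::ₘ t) * g := by
      rw [factorPoly_cons]
      linear_combination factorPoly t * hg
    rw [e, theta_add_left, theta_C_mul, theta_factorPoly_mul_one_eq_zero hq hs ht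
      (by rw [Multiset.card_cons, htc]), add_zero]
  rw [theta_factorPoly_one hq hs ht htc, ← eval_factorPoly, Algebra.smul_def, ← map_mul] at h2
  obtain ⟨u, hu'⟩ : IsUnit (P₁.eval c * -(algebraMap K R d * (factorPoly s).eval c ^ 2)) :=
    hPu.mul ((((IsUnit.mk0 d hd).map _).mul (hu.pow 2)).neg)
  refine ⟨{ toFun := fun h => (↑u⁻¹ : R) • theta ρ (factorPoly t * P₁) h
            map_add' := fun x y => by rw [theta_add_right, smul_add]
            map_smul' := fun r x => by rw [theta_smul_right, smul_comm]; rfl }, ?_, ?_, ?_, ?_⟩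
  · change (↑u⁻¹ : R) • theta ρ (factorPoly t * P₁) 1 = 1
    rw [h2, ← hu', Algebra.smul_def, ← map_mul, Units.inv_mul, map_one]
  · intro a h
    change (↑u⁻¹ : R) • theta ρ (factorPoly t * P₁) _ = _ * (↑u⁻¹ : R) • theta ρ _ _
    rw [theta_inc_mul, mul_smul_comm]
  · intro a h
    change (↑u⁻¹ : R) • theta ρ (factorPoly t * P₁) _ = (↑u⁻¹ : R) • theta ρ _ _ * _
    rw [theta_mul_inc, smul_mul_assoc]
  · intro h
    change (↑u⁻¹ : R) • theta ρ (factorPoly t * P₁) _ = c • (↑u⁻¹ : R) • theta ρ _ _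
    rw [smul_comm c, theta_jm_mul, ← sub_add_cancel Polynomial.X (Polynomial.C c), add_mul,
      theta_add_left, theta_C_mul, ← mul_assoc, ← factorPoly_cons, h1, zero_add]

end HeckeB

namespace HeckeB

open PowerSeries

section coind

variable {K A R M : Type*} [Field K] [Ring A] [Algebra K A] [CommRing R] [Algebra K R]
  [AddCommGroup M] [Module K M] [Module R M] [IsScalarTower K R M]

/-- The action of `A` by right translation on a stable space of maps `A → M`. -/
def translation (F : Submodule R (A →ₗ[K] M))
    (hF : ∀ φ ∈ F, ∀ a, φ ∘ₗ LinearMap.mulRight K a ∈ F) : A →ₐ[K] Module.End R F where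
  toFun a :=
    { toFun := fun φ => ⟨φ.1 ∘ₗ LinearMap.mulRight K a, hF _ φ.2 a⟩
      map_add' := fun _ _ => rfl
      map_smul' := fun _ _ => rfl }
  map_one' := by ext φ a; simp
  map_mul' a b := by ext φ x; simp [mul_assoc]
  map_zero' := by ext φ x; simp
  map_add' a b := by ext φ x; simp [mul_add]
  commutes' r := by
    ext φ x
    simp [← Algebra.commutes, ← Algebra.smul_def, Module.algebraMap_end_apply]

theorem translation_apply (F : Submodule R (A →ₗ[K] M))
    (hF : ∀ φ ∈ F, ∀ a, φ ∘ₗ LinearMap.mulRight K a ∈ F) (a : A) (φ : F) (x : A) :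
    (translation F hF a φ).1 x = φ.1 (x * a) := rfl

theorem finite_of_submodule [Module.Finite K A] [Module.Finite K M]
    (F : Submodule R (A →ₗ[K] M)) : Module.Finite K F :=
  inferInstanceAs (Module.Finite K (F.restrictScalars K))

end coind

variable {K : Type} [Field K] {d q : K} {n : ℕ} {R M : Type} [CommRing R] [Algebra K R]
  [AddCommGroup M] [Module K M] [Module R M] [IsScalarTower K R M]

/-- The eigenspace for left translation by the last Jucys-Murphy element in the coinduced
module. -/
def eigenCoind (ρ : H d q n →ₐ[K] Module.End R M) (c : R) :
    Submodule R (H d q (n + 1) →ₗ[K] M) where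
  carrier := {φ | (∀ a h, φ (inc d q n a * h) = ρ a (φ h)) ∧ ∀ h, φ (jm d q n * h) = c • φ h}
  add_mem' {φ ψ} hφ hψ := ⟨fun a h => by simp [hφ.1, hψ.1], fun h => by simp [hφ.2, hψ.2]⟩
  zero_mem' := ⟨fun a h => by simp, fun h => by simp⟩
  smul_mem' r φ hφ := ⟨fun a h => by simp [hφ.1], fun h => by simp [hφ.2, smul_comm r c]⟩

theorem eigenCoind_translation {ρ : H d q n →ₐ[K] Module.End R M} {c : R} (φ)
    (hφ : φ ∈ eigenCoind ρ c) (a : H d q (n + 1)) :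
    φ ∘ₗ LinearMap.mulRight K a ∈ eigenCoind ρ c :=
  ⟨fun b h => by simp [mul_assoc, hφ.1], fun h => by simp [mul_assoc, hφ.2]⟩

theorem hasContent_eigenCoind (hq : q ≠ 0) {ρ : H d q n →ₐ[K] Module.End R M} {s : Multiset R}
    (hs : HasContent ρ s) (c : R) :
    HasContent (B := Module.End R (eigenCoind ρ c))
      (translation (eigenCoind ρ c) eigenCoind_translation) (c ::ₘ s) := by
  intro j
  ext φ h
  rw [translation_apply, ← (commute_coeff_zSeries hq (n + 1) j h).eq]
  cases j with
  | zero => simp [coeff_zero_zSeries, coeff_zero_factorSeries]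
  | succ j =>
    rw [coeff_succ_zSeries_succ, coeff_succ_factorSeries_cons, sub_mul, mul_assoc, map_sub,
      φ.2.1, φ.2.2, φ.2.1, hs, hs]
    simp [Module.algebraMap_end_apply, smul_comm c]

omit [Algebra K R] in
theorem map_mul_jm (hq : q ≠ 0) {B : Type*} [Ring B] [Algebra K B] [Algebra R B]
    {ρ : H d q n →ₐ[K] B} {s : Multiset R} {c : R}
    (hs : HasContent ρ s) {ψ : H d q (n + 1) →ₗ[K] B}
    (hl : ∀ a h, ψ (inc d q n a * h) = ρ a * ψ h)
    (hr : ∀ a h, ψ (h * inc d q n a) = ψ h * ρ a)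
    (hc : ∀ h, ψ (jm d q n * h) = c • ψ h) (h : H d q (n + 1)) :
    ψ (h * jm d q n) = c • ψ h := by
  have e := coeff_succ_zSeries_succ (d := d) (q := q) n 0
  rw [coeff_zero_zSeries, map_one, mul_one] at e
  have e1 := congrArg ψ (commute_coeff_zSeries hq (n + 1) (0 + 1) h).eq
  rw [e, sub_mul, mul_sub, map_sub, map_sub, hl, hr, hc, hs, Algebra.commutes] at e1
  exact (sub_right_injective e1).symm

theorem exists_module_step (hq : q ≠ 0) (hd : d ≠ 0) [Module.Finite K M]
    {ρ : H d q (n + 1) →ₐ[K] Module.End R M}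
    {s t : Multiset R} {c : R} {ζ : K} (hs : HasContent ρ s) (hc : Multiset.card s = n + 1)
    (hζ : IsNilpotent (c - algebraMap K R ζ)) (hu : IsUnit ((factorPoly s).eval c))
    (ht : factorSeries (c ::ₘ t) = factorSeries (bigContent d q s))
    (htc : Multiset.card t = 2 * Multiset.card s + 1) :
    ∃ (F : Type) (_ : AddCommGroup F) (_ : Module K F) (_ : Module R F)
      (_ : IsScalarTower K R F) (_ : Module.Finite K F)
      (ρ' : H d q (n + 2) →ₐ[K] Module.End R F) (j : M →ₗ[R] F) (k : F →ₗ[R] M),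
      HasContent ρ' (c ::ₘ s) ∧ (∀ m, k (j m) = m) ∧
      (∀ a m, ρ' (inc d q (n + 1) a) (j m) = j (ρ a m)) ∧
      (∀ a φ, k (ρ' (inc d q (n + 1) a) φ) = ρ a (k φ)) ∧
      (∀ m, ρ' (jm d q (n + 1)) (j m) = c • j m) ∧
      ∀ φ, k (ρ' (jm d q (n + 1)) φ) = c • k φ := by
  obtain ⟨ψ, h1, hl, hr, hjm⟩ := exists_bimodule_map hq hd hs hc hζ hu ht htc
  have := finite_H (d := d) hq (n + 2)
  let j : M →ₗ[R] eigenCoind ρ c :=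
    { toFun := fun m => ⟨{ toFun := fun h => ψ h m
                           map_add' := fun x y => by simp
                           map_smul' := fun x y => by simp },
        fun a h => by simp [hl], fun h => by simp [hjm]⟩
      map_add' := fun x y => by ext h; simp
      map_smul' := fun x y => by ext h; simp }
  let k : eigenCoind ρ c →ₗ[R] M :=
    { toFun := fun φ => φ.1 1
      map_add' := fun _ _ => rfl
      map_smul' := fun _ _ => rfl }
  refine ⟨eigenCoind ρ c, inferInstance, inferInstance, inferInstance, inferInstance,
    finite_of_submodule _, translation _ eigenCoind_translation, j, k,
    hasContent_eigenCoind hq hs c, fun m => ?_, fun a m => ?_, fun a φ => ?_, fun m => ?_,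
    fun φ => ?_⟩
  · change ψ 1 m = m
    rw [h1, Module.End.one_apply]
  · ext h
    change ψ (h * _) m = ψ h (ρ a m)
    rw [hr, Module.End.mul_apply]
  · change φ.1 (1 * _) = ρ a (φ.1 1)
    rw [one_mul, ← φ.2.1, mul_one]
  · ext h
    change ψ (h * _) m = c • ψ h m
    rw [map_mul_jm hq hs hl hr hjm, LinearMap.smul_apply]
  · change φ.1 (1 * _) = c • φ.1 1
    rw [one_mul, ← φ.2.2, mul_one]

end HeckeB

namespace HeckeB

open Module

section smallEnd

variable {K A B M N : Type*} [Field K] [Ring A] [Algebra K A] [Ring B] [Algebra K B]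
  [AddCommGroup M] [Module K M] [AddCommGroup N] [Module K N]

/-- The additive group generated by the endomorphisms of a representation whose rank is at
most `b`. -/
def smallEnd (ρ : A →ₐ[K] Module.End K M) (b : ℕ) : AddSubgroup (Module.End K M) :=
  AddSubgroup.closure {θ | (∀ a, Commute θ (ρ a)) ∧ finrank K (LinearMap.range θ) ≤ b}

theorem finrank_range_comp_comp_le [Module.Finite K M] (f : M →ₗ[K] N) (g : N →ₗ[K] M)
    (θ : Module.End K M) :
    finrank K (LinearMap.range (f ∘ₗ θ ∘ₗ g)) ≤ finrank K (LinearMap.range θ) := by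
  rw [LinearMap.range_comp]
  refine (Submodule.finrank_map_le _ _).trans (Submodule.finrank_mono ?_)
  exact LinearMap.range_comp_le_range _ _

theorem comp_comp_mem_smallEnd [Module.Finite K M] (φ : B →ₐ[K] A) {ρ : A →ₐ[K] Module.End K M}
    {σ : B →ₐ[K] Module.End K N} {f : M →ₗ[K] N} {g : N →ₗ[K] M}
    (hf : ∀ a x, f (ρ (φ a) x) = σ a (f x)) (hg : ∀ a x, g (σ a x) = ρ (φ a) (g x)) {b : ℕ}
    {θ : Module.End K M} (hθ : θ ∈ smallEnd ρ b) : f ∘ₗ θ ∘ₗ g ∈ smallEnd σ b := by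
  induction hθ using AddSubgroup.closure_induction with
  | mem θ h =>
    refine AddSubgroup.subset_closure ⟨fun a => ?_, (finrank_range_comp_comp_le f g θ).trans h.2⟩
    ext x
    have := LinearMap.congr_fun (h.1 (φ a)) (g x)
    simp only [Module.End.mul_apply, LinearMap.comp_apply] at this ⊢
    rw [hg, this, hf]
  | zero => simp
  | add x y _ _ hx hy => simpa [LinearMap.add_comp, LinearMap.comp_add] using add_mem hx hy
  | neg x _ hx => simpa [LinearMap.neg_comp, LinearMap.comp_neg] using neg_mem hx

end smallEnd

/-- Every finite-dimensional representation is a sum of pieces of dimension at most `b`, in the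
sense that its identity map is a sum of endomorphisms of rank at most `b`. -/
def BoundedBy (K A : Type) [Field K] [Ring A] [Algebra K A] (b : ℕ) : Prop :=
  ∀ (M : Type) [AddCommGroup M] [Module K M] [Module.Finite K M] (ρ : A →ₐ[K] Module.End K M),
    1 ∈ smallEnd ρ b

variable {K A : Type} [Field K] [Ring A] [Algebra K A]

theorem exists_finrank_le_of_hasFiniteRepresentationType (h : HasFiniteRepresentationType K A) :
    ∃ b : ℕ, ∀ M : FDRightModule K A, IsIndecomposableModule Aᵐᵒᵖ M.carrier →
      finrank K M.carrier ≤ b := by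
  have : Finite (Quot fun M N :
    {M : FDRightModule K A // IsIndecomposableModule Aᵐᵒᵖ M.carrier} =>
      Nonempty (M.1.carrier ≃ₗ[Aᵐᵒᵖ] N.1.carrier)) := h
  let F := Quot.lift (r := fun M N :
    {M : FDRightModule K A // IsIndecomposableModule Aᵐᵒᵖ M.carrier} =>
      Nonempty (M.1.carrier ≃ₗ[Aᵐᵒᵖ] N.1.carrier)) (fun M => finrank K M.1.carrier)
      (fun M N ⟨e⟩ => (e.restrictScalars K).finrank_eq)
  obtain ⟨b, hb⟩ := (Set.finite_range F).bddAbove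
  exact ⟨b, fun M hM => hb ⟨Quot.mk _ ⟨M, hM⟩, rfl⟩⟩

theorem one_mem_smallEnd_lsmul {b : ℕ} (hb : ∀ M : FDRightModule K A,
    IsIndecomposableModule Aᵐᵒᵖ M.carrier → finrank K M.carrier ≤ b) (r : ℕ)
    (M : FDRightModule K A) (hM : finrank K M.carrier ≤ r) :
    1 ∈ smallEnd (Algebra.lsmul K K M.carrier : Aᵐᵒᵖ →ₐ[K] _) b := by
  induction r generalizing M with
  | zero =>
    have : Subsingleton M.carrier := finrank_zero_iff.1 (Nat.le_zero.1 hM)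
    rw [Subsingleton.elim 1 (0 : Module.End K M.carrier)]
    exact zero_mem _
  | succ r ih =>
    by_cases hi : IsIndecomposableModule Aᵐᵒᵖ M.carrier
    · refine AddSubgroup.subset_closure ⟨fun a => Commute.one_left _, ?_⟩
      exact (LinearMap.finrank_range_le _).trans (hb M hi)
    · by_cases hn : Nontrivial M.carrier
      · rw [IsIndecomposableModule, not_and] at hi
        have hi := hi hn
        push Not at hi
        obtain ⟨N₁, N₂, hN, h₁, h₂⟩ := hi
        have key : ∀ N N' : Submodule Aᵐᵒᵖ M.carrier, ∀ hN : IsCompl N N', N' ≠ ⊥ →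
            ((N.subtype ∘ₗ N.projectionOnto N' hN).restrictScalars K) ∈
              smallEnd (Algebra.lsmul K K M.carrier : Aᵐᵒᵖ →ₐ[K] _) b := by
          intro N N' hN h'
          have hlt : finrank K N < finrank K M.carrier := by
            refine Submodule.finrank_lt (s := N.restrictScalars K) fun h => h' ?_
            have : N = ⊤ := (Submodule.restrictScalars_eq_top_iff K Aᵐᵒᵖ _).1 h
            simpa [this] using hN.inf_eq_bot
          have : Module.Finite K N := inferInstanceAs (Module.Finite K (N.restrictScalars K))
          have := ih ⟨N⟩ (by change finrank K N ≤ r; omega)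
          exact comp_comp_mem_smallEnd (AlgHom.id K Aᵐᵒᵖ) (f := N.subtype.restrictScalars K)
            (g := (N.projectionOnto N' hN).restrictScalars K) (fun a x => rfl)
            (fun a x => map_smul (N.projectionOnto N' hN) a x) this
        have := add_mem (key _ _ hN h₂) (key _ _ hN.symm h₁)
        convert this using 1
        ext x
        exact (Submodule.projection_add_projection_eq_self hN x).symm
      · have : Subsingleton M.carrier := not_nontrivial_iff_subsingleton.1 hn
        rw [Subsingleton.elim 1 (0 : Module.End K M.carrier)]
        exact zero_mem _

theorem exists_boundedBy_of_hasFiniteRepresentationType (h : HasFiniteRepresentationType K A)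
    (τ : Aᵐᵒᵖ →ₐ[K] A) (hτ : Function.Surjective τ) : ∃ b, BoundedBy K A b := by
  obtain ⟨b, hb⟩ := exists_finrank_le_of_hasFiniteRepresentationType h
  refine ⟨b, fun M _ _ _ ρ => ?_⟩
  let : Module Aᵐᵒᵖ M := Module.compHom M (ρ.comp τ).toRingHom
  have hs : ∀ (a : Aᵐᵒᵖ) (m : M), a • m = ρ (τ a) m := fun _ _ => rfl
  have : IsScalarTower K Aᵐᵒᵖ M := ⟨fun k a m => by
    rw [hs, hs, map_smul, map_smul, LinearMap.smul_apply]⟩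
  refine AddSubgroup.closure_mono ?_ (one_mem_smallEnd_lsmul hb _ ⟨M⟩ le_rfl)
  rintro θ ⟨h1, h2⟩
  refine ⟨fun a => ?_, h2⟩
  obtain ⟨a, rfl⟩ := hτ a
  exact h1 a

end HeckeB

namespace HeckeB

open Module

section hecke

variable {K : Type} [Field K] {d q : K} {n : ℕ}

theorem exists_opposite_hom (d q : K) (n : ℕ) :
    ∃ τ : (H d q n)ᵐᵒᵖ →ₐ[K] H d q n, Function.Surjective τ := by
  have ht : IsHeckeSeq d q n fun i => MulOpposite.op (gen d q n i) := by
    have h := isHeckeSeq_gen d q n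
    constructor
    · intro h0
      apply MulOpposite.unop_injective
      have := h.quad_zero h0
      simp only [MulOpposite.unop_mul, MulOpposite.unop_sub, MulOpposite.unop_op,
        MulOpposite.unop_one, MulOpposite.algebraMap_apply, MulOpposite.unop_zero]
      rw [← this]
      exact (((Commute.refl _).sub_left (Commute.one_left _)).sub_right
        (Algebra.commute_algebraMap_right _ _)).symm
    · intro i hi hn
      apply MulOpposite.unop_injective
      have := h.quad i hi hn
      simp only [MulOpposite.unop_mul, MulOpposite.unop_sub, MulOpposite.unop_op,
        MulOpposite.unop_one, MulOpposite.algebraMap_apply, MulOpposite.unop_zero,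
        MulOpposite.unop_add]
      rw [← this]
      exact (((Commute.refl _).add_left (Commute.one_left _)).sub_right
        (Algebra.commute_algebraMap_right _ _)).symm
    · intro h1
      apply MulOpposite.unop_injective
      simpa [mul_assoc] using (h.braid_zero h1).symm
    · intro i hi hn
      apply MulOpposite.unop_injective
      simpa [mul_assoc] using h.braid i hi hn
    · intro i j hij hn
      apply MulOpposite.unop_injective
      simpa using (h.comm i j hij hn).symm
  refine ⟨AlgHom.opComm (lift ht), fun x => ?_⟩
  induction x using induction_gen with
  | hs r => exact ⟨algebraMap K _ r, AlgHom.commutes _ _⟩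
  | hg i hi => exact ⟨MulOpposite.op (gen d q n i), by simp [AlgHom.opComm, lift_gen ht hi]⟩
  | hm a b ha hb =>
    obtain ⟨x, rfl⟩ := ha
    obtain ⟨y, rfl⟩ := hb
    exact ⟨x * y, map_mul _ _ _⟩
  | ha a b ha hb =>
    obtain ⟨x, rfl⟩ := ha
    obtain ⟨y, rfl⟩ := hb
    exact ⟨x + y, map_add _ _ _⟩

/-- The module coinduced from `H_q(B_n)` to `H_q(B_{n+1})`. -/
def coind {M : Type} [AddCommGroup M] [Module K M] (ρ : H d q n →ₐ[K] Module.End K M) :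
    Submodule K (H d q (n + 1) →ₗ[K] M) where
  carrier := {φ | ∀ a h, φ (inc d q n a * h) = ρ a (φ h)}
  add_mem' {φ ψ} hφ hψ := fun a h => by simp [hφ a h, hψ a h]
  zero_mem' := fun a h => by simp
  smul_mem' r φ hφ := fun a h => by simp [hφ a h]

theorem BoundedBy.of_succ (hq : q ≠ 0) {b : ℕ} (h : BoundedBy K (H d q (n + 1)) b) :
    BoundedBy K (H d q n) b := by
  intro M _ _ _ ρ
  have := finite_H (d := d) hq (n + 1)
  have : Module.Finite K (coind ρ) := finite_of_submodule _
  have h1 := h (coind ρ) (translation (coind ρ) fun φ hφ a b h => by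
    simpa [mul_assoc] using hφ b (h * a))
  let j : M →ₗ[K] coind ρ :=
    { toFun := fun m => ⟨{ toFun := fun h => ρ (condExp d q n h) m
                           map_add' := fun x y => by simp
                           map_smul' := fun x y => by simp },
        fun a h => by simp [condExp_inc_mul]⟩
      map_add' := fun x y => by ext h; simp
      map_smul' := fun x y => by ext h; simp }
  let k : coind ρ →ₗ[K] M :=
    { toFun := fun φ => φ.1 1
      map_add' := fun _ _ => rfl
      map_smul' := fun _ _ => rfl }
  have h2 := comp_comp_mem_smallEnd (inc d q n) (σ := ρ) (f := k) (g := j) (fun a φ => ?_)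
    (fun a x => ?_) h1
  · convert h2 using 1
    ext m
    change m = ρ (condExp d q n 1) m
    rw [condExp_one, map_one, Module.End.one_apply]
  · change φ.1 (1 * _) = ρ a (φ.1 1)
    rw [one_mul, ← φ.2, mul_one]
  · ext h
    change ρ (condExp d q n h) (ρ a x) = ρ (condExp d q n (h * inc d q n a)) x
    rw [condExp_mul_inc, map_mul, Module.End.mul_apply]

theorem BoundedBy.of_le (hq : q ≠ 0) {b m : ℕ} (hmn : m ≤ n) (h : BoundedBy K (H d q n) b) :
    BoundedBy K (H d q m) b := by
  induction n, hmn using Nat.le_induction with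
  | base => exact h
  | succ n _ ih => exact ih (h.of_succ hq)

end hecke

/-- The algebra `A` has representations, over all finite-dimensional algebras `R` with square-zero
pairs `x, y`, containing `R` as a retract on which two fixed elements of `A` act by `x` and `y`. -/
def HasDeformation (K A : Type) [Field K] [Ring A] [Algebra K A] : Prop :=
  ∃ a b : A, ∀ (R : Type) [CommRing R] [Algebra K R] [Module.Finite K R] (x y : R),
    x * x = 0 → y * y = 0 → y * x = 0 →
    ∃ (F : Type) (_ : AddCommGroup F) (_ : Module K F) (_ : Module R F)
      (_ : IsScalarTower K R F) (_ : Module.Finite K F)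
      (ρ : A →ₐ[K] Module.End R F) (v : F) (κ : F →ₗ[R] R), κ v = 1 ∧
      ρ a v = x • v ∧ ρ b v = y • v ∧ (∀ φ, κ (ρ a φ) = x * κ φ) ∧ ∀ φ, κ (ρ b φ) = y * κ φ

variable {K A : Type} [Field K] [Ring A] [Algebra K A]

/-- Restriction of scalars for linear endomorphisms. -/
def restrictEnd (K R F : Type*) [Field K] [CommRing R] [Algebra K R] [AddCommGroup F]
    [Module K F] [Module R F] [IsScalarTower K R F] : Module.End R F →ₐ[K] Module.End K F where
  toFun φ := φ.restrictScalars K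
  map_one' := rfl
  map_mul' _ _ := rfl
  map_zero' := rfl
  map_add' _ _ := rfl
  commutes' _ := rfl

section truncated

variable {N : ℕ}

theorem isUnit_or_mem_span_root (a : AdjoinRoot ((Polynomial.X : Polynomial K) ^ N)) :
    IsUnit a ∨ a ∈ Ideal.span {AdjoinRoot.root ((Polynomial.X : Polynomial K) ^ N)} := by
  induction a using AdjoinRoot.induction_on with
  | ih p =>
    have hs : IsNilpotent (AdjoinRoot.root ((Polynomial.X : Polynomial K) ^ N)) :=
      ⟨N, by rw [← AdjoinRoot.mk_X, ← map_pow, AdjoinRoot.mk_self]⟩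
    obtain ⟨g, hg⟩ := Polynomial.X_dvd_sub_C (p := p)
    have e : AdjoinRoot.mk (Polynomial.X ^ N) p = AdjoinRoot.of _ (p.coeff 0) +
        AdjoinRoot.root _ * AdjoinRoot.mk _ g := by
      have := congrArg (AdjoinRoot.mk (Polynomial.X ^ N)) hg
      rw [map_sub, map_mul, AdjoinRoot.mk_X, AdjoinRoot.mk_C] at this
      exact eq_add_of_sub_eq' this
    by_cases h : p.coeff 0 = 0
    · right
      rw [e, h, map_zero, zero_add]
      exact Ideal.mul_mem_right _ _ (Ideal.mem_span_singleton_self _)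
    · left
      rw [e, add_comm]
      exact ((Commute.all _ _).isNilpotent_mul_right hs).isUnit_add_right_of_commute
        ((IsUnit.mk0 _ h).map _) (Commute.all _ _)

theorem apply_one_mem_span_root
    {θ : Module.End K (AdjoinRoot ((Polynomial.X : Polynomial K) ^ N))}
    (hθ : ∀ a, θ (AdjoinRoot.root _ * a) = AdjoinRoot.root _ * θ a)
    (hr : finrank K (LinearMap.range θ) < N) :
    θ 1 ∈ Ideal.span {AdjoinRoot.root ((Polynomial.X : Polynomial K) ^ N)} := by
  refine (isUnit_or_mem_span_root (θ 1)).resolve_left fun hu => ?_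
  have key : ∀ a, θ a = a * θ 1 := by
    intro a
    induction a using AdjoinRoot.induction_on with
    | ih p =>
      induction p using Polynomial.induction_on with
      | C r => rw [AdjoinRoot.mk_C, ← AdjoinRoot.algebraMap_eq, ← Algebra.smul_def,
          Algebra.algebraMap_eq_smul_one, map_smul]
      | add p q hp hq => rw [map_add, map_add, hp, hq, add_mul]
      | monomial n r ih =>
        rw [pow_succ, ← mul_assoc, map_mul, AdjoinRoot.mk_X, mul_comm, hθ, ih, mul_assoc]
  have ht : LinearMap.range θ = ⊤ := by
    refine LinearMap.range_eq_top.2 fun a => ?_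
    obtain ⟨u, hu⟩ := hu
    exact ⟨a * ↑u⁻¹, by rw [key, ← hu, mul_assoc, Units.inv_mul, mul_one]⟩
  rw [ht, finrank_top, (AdjoinRoot.powerBasis' (Polynomial.monic_X_pow N)).finrank,
    AdjoinRoot.powerBasis'_dim, Polynomial.natDegree_X_pow] at hr
  exact hr.false

theorem one_notMem_span_root (hN : 0 < N) :
    (1 : AdjoinRoot ((Polynomial.X : Polynomial K) ^ N)) ∉
      Ideal.span {AdjoinRoot.root ((Polynomial.X : Polynomial K) ^ N)} := by
  rw [Ideal.mem_span_singleton, ← isUnit_iff_dvd_one]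
  intro h
  have h0 : (AdjoinRoot.root ((Polynomial.X : Polynomial K) ^ N)) ^ N = 0 := by
    rw [← AdjoinRoot.mk_X, ← map_pow, AdjoinRoot.mk_self]
  have h1 := h.pow N
  rw [h0, isUnit_zero_iff, eq_comm, ← map_one (AdjoinRoot.mk _), AdjoinRoot.mk_eq_zero,
    ← isUnit_iff_dvd_one, isUnit_pow_iff hN.ne'] at h1
  exact Polynomial.not_isUnit_X h1

end truncated

theorem HasDeformation.not_boundedBy (h : HasDeformation K A) (b : ℕ) : ¬ BoundedBy K A b := by
  obtain ⟨a₁, a₂, h⟩ := h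
  intro hb
  set N := b + 1
  have hm := Polynomial.monic_X_pow (R := K) N
  have hfin : Module.Finite K (AdjoinRoot ((Polynomial.X : Polynomial K) ^ N)) :=
    hm.finite_adjoinRoot
  set s := AdjoinRoot.root ((Polynomial.X : Polynomial K) ^ N)
  have hfin' : Module.Finite K (DualNumber (AdjoinRoot ((Polynomial.X : Polynomial K) ^ N))) :=
    inferInstanceAs (Module.Finite K (AdjoinRoot ((Polynomial.X : Polynomial K) ^ N) ×
      AdjoinRoot ((Polynomial.X : Polynomial K) ^ N)))
  obtain ⟨F, _, _, _, _, _, ρ, v, κ, hκ, h1, h2, h3, h4⟩ := h (DualNumber _)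
    (TrivSqZeroExt.inr 1) (TrivSqZeroExt.inr s) (TrivSqZeroExt.inr_mul_inr _ _ _)
    (TrivSqZeroExt.inr_mul_inr _ _ _) (TrivSqZeroExt.inr_mul_inr _ _ _)
  let Φ : Module.End K F →+ AdjoinRoot ((Polynomial.X : Polynomial K) ^ N) :=
    { toFun := fun θ => (κ (θ v)).fst
      map_zero' := by simp
      map_add' := fun x y => by simp }
  have key : smallEnd ((restrictEnd K _ F).comp ρ) b ≤
      AddSubgroup.comap Φ (Ideal.span {s}).toAddSubgroup := by
    rw [smallEnd, AddSubgroup.closure_le]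
    rintro θ ⟨hθ, hr⟩
    let f : F →ₗ[K] AdjoinRoot ((Polynomial.X : Polynomial K) ^ N) :=
      (TrivSqZeroExt.fstHom K _ _).toLinearMap ∘ₗ κ.restrictScalars K
    let g : AdjoinRoot ((Polynomial.X : Polynomial K) ^ N) →ₗ[K] F :=
      (LinearMap.toSpanSingleton (DualNumber _) F v).restrictScalars K ∘ₗ
        (TrivSqZeroExt.inlAlgHom K _ _).toLinearMap
    have h0 := apply_one_mem_span_root (θ := f ∘ₗ θ ∘ₗ g) (fun a => ?_)
      ((finrank_range_comp_comp_le f g θ).trans_lt (by omega))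
    · simpa [f, g, Φ] using h0
    · have hτ : ∀ (x : DualNumber (AdjoinRoot ((Polynomial.X : Polynomial K) ^ N))) (a : A),
          ρ a v = x • v → (∀ φ, κ (ρ a φ) = x * κ φ) → ∀ r, κ (θ ((x * r) • v)) =
            x * κ (θ (r • v)) := by
        intro x a h h' r
        rw [mul_comm, mul_smul, ← h, ← map_smul, ← h']
        exact congrArg κ (LinearMap.congr_fun (hθ a) (r • v))
      have e1 := hτ _ _ h1 h3 (TrivSqZeroExt.inl (s * a))
      have e2 := hτ _ _ h2 h4 (TrivSqZeroExt.inl a)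
      rw [TrivSqZeroExt.inr_mul_inl, op_smul_eq_mul] at e1 e2
      rw [one_mul, e2] at e1
      simpa [f, g] using (congrArg TrivSqZeroExt.snd e1).symm
  have := key (hb F ((restrictEnd K _ F).comp ρ))
  exact one_notMem_span_root (K := K) b.succ_pos (by simpa [Φ, hκ] using this)

end HeckeB

namespace HeckeB

open PowerSeries

section content

variable {K R : Type} [Field K] [CommRing R] [Algebra K R] {d q : K}

theorem bigContent_map (s : Multiset K) :
    bigContent d q (s.map (algebraMap K R)) = (bigContent d q s).map (algebraMap K R) := by
  simp [bigContent, Multiset.map_map]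

theorem bigContent_cons (c : R) (s : Multiset R) : bigContent d q (c ::ₘ s) =
    (algebraMap K R q * c) ::ₘ (algebraMap K R q⁻¹ * c) ::ₘ bigContent d q s := by
  rw [bigContent, bigContent, Multiset.map_cons, Multiset.map_cons]
  simp only [← Multiset.singleton_add]
  abel

theorem factorSeries_deform {y z : R} (hy : y * y = 0) (hyz : y * z = 0) (c : R)
    (s : Multiset R) : factorSeries ((c + y) ::ₘ (c + z - y) ::ₘ s) =
      factorSeries (c ::ₘ (c + z) ::ₘ s) := by
  simp only [factorSeries_cons, ← mul_assoc]
  congr 1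
  have e : (c + y) * (c + z - y) = c * (c + z) := by linear_combination hyz - hy
  have e' := congrArg (C (R := R)) e
  simp only [map_add, map_sub, map_mul] at e' ⊢
  linear_combination X ^ 2 * e'

theorem isUnit_eval_factorPoly {s : Multiset K} {ζ : K} (h : ζ ∉ s) :
    IsUnit ((factorPoly (s.map (algebraMap K R))).eval (algebraMap K R ζ)) := by
  rw [eval_factorPoly, Multiset.map_map]
  have : (s.map ((fun a => algebraMap K R ζ - a) ∘ algebraMap K R)).prod =
      algebraMap K R (s.map fun a => ζ - a).prod := by
    rw [map_multiset_prod, Multiset.map_map]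
    simp
  rw [this]
  refine (IsUnit.mk0 _ fun h0 => ?_).map _
  rw [Multiset.prod_eq_zero_iff, Multiset.mem_map] at h0
  obtain ⟨a, ha, ha'⟩ := h0
  exact h (sub_eq_zero.1 ha' ▸ ha)

end content

variable {K : Type} [Field K] {d q : K} {n : ℕ}

theorem hasDeformation_of_content (hq : q ≠ 0) (hd : d ≠ 0) {ζ ζ' : K} {s₀ : Multiset K}
    (hc : Multiset.card s₀ = n + 1) (hζ : ζ ∉ s₀) (hζ' : ζ' ∉ s₀) (hne : ζ' ≠ ζ)
    (h₁ : ∃ u, bigContent d q s₀ = ζ ::ₘ ζ ::ₘ u)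
    (h₂ : (∃ u, bigContent d q s₀ = ζ' ::ₘ ζ' ::ₘ u) ∨ ζ' = q * ζ ∧ ζ' ∈ bigContent d q s₀)
    (hM : ∀ (R : Type) [CommRing R] [Algebra K R] [Module.Finite K R],
      ∃ (M : Type) (_ : AddCommGroup M) (_ : Module K M) (_ : Module R M)
        (_ : IsScalarTower K R M) (_ : Module.Finite K M)
        (ρ : H d q (n + 1) →ₐ[K] Module.End R M) (v : M) (κ : M →ₗ[R] R),
        κ v = 1 ∧ HasContent ρ (s₀.map (algebraMap K R))) :
    HasDeformation K (H d q (n + 3)) := by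
  refine ⟨inc d q (n + 2) (jm d q (n + 1)) - algebraMap K _ ζ,
    jm d q (n + 2) - algebraMap K _ ζ', fun R _ _ _ x y hx hy hyx => ?_⟩
  obtain ⟨M, _, _, _, _, _, ρ, v, κ, hκ, hs⟩ := hM R
  have hxn : IsNilpotent x := ⟨2, by rw [pow_two, hx]⟩
  have hyn : IsNilpotent y := ⟨2, by rw [pow_two, hy]⟩
  obtain ⟨u, hu⟩ := h₁
  have hbig : bigContent d q (s₀.map (algebraMap K R)) =
      algebraMap K R ζ ::ₘ algebraMap K R ζ ::ₘ u.map (algebraMap K R) := by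
    rw [bigContent_map, hu, Multiset.map_cons, Multiset.map_cons]
  have hcard := congrArg Multiset.card hbig
  rw [card_bigContent] at hcard
  simp only [Multiset.card_cons] at hcard
  obtain ⟨F₁, _, _, _, _, _, ρ₁, j₁, k₁, hs₁, hkj₁, hj₁, hk₁, hjm₁, hkm₁⟩ :=
    exists_module_step (c := algebraMap K R ζ + x) (ζ := ζ)
      (t := (algebraMap K R ζ - x) ::ₘ u.map (algebraMap K R)) hq hd hs (by simpa using hc)
      (by simpa using hxn)
      (isUnit_eval_of_isNilpotent_sub (isUnit_eval_factorPoly hζ) (by simpa using hxn))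
      (by
        rw [hbig]
        simpa using factorSeries_deform hx (mul_zero x) (algebraMap K R ζ)
          (u.map (algebraMap K R)))
      (by rw [Multiset.card_cons]; omega)
  obtain ⟨z, u', hyz, hu'⟩ : ∃ (z : R) (u' : Multiset R), y * z = 0 ∧
      bigContent d q ((algebraMap K R ζ + x) ::ₘ s₀.map (algebraMap K R)) =
        algebraMap K R ζ' ::ₘ (algebraMap K R ζ' + z) ::ₘ u' := by
    rw [bigContent_cons, bigContent_map]
    rcases h₂ with ⟨u', hu'⟩ | ⟨e, he⟩
    · refine ⟨0, (algebraMap K R q * (algebraMap K R ζ + x)) ::ₘ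
        (algebraMap K R q⁻¹ * (algebraMap K R ζ + x)) ::ₘ u'.map (algebraMap K R),
        mul_zero _, ?_⟩
      rw [hu', Multiset.map_cons, Multiset.map_cons, add_zero]
      simp only [← Multiset.singleton_add]
      abel
    · obtain ⟨u', hu'⟩ := Multiset.exists_cons_of_mem he
      refine ⟨algebraMap K R q * x, (algebraMap K R q⁻¹ * (algebraMap K R ζ + x)) ::ₘ
        u'.map (algebraMap K R), by rw [mul_left_comm, hyx, mul_zero], ?_⟩
      rw [hu', Multiset.map_cons, mul_add, ← map_mul, ← e]
      simp only [← Multiset.singleton_add]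
      abel
  have hcard' := congrArg Multiset.card hu'
  rw [card_bigContent] at hcard'
  simp only [Multiset.card_cons, Multiset.card_map] at hcard'
  have hunit : IsUnit ((factorPoly ((algebraMap K R ζ + x) ::ₘ
      s₀.map (algebraMap K R))).eval (algebraMap K R ζ' + y)) := by
    refine isUnit_eval_of_isNilpotent_sub (a := algebraMap K R ζ') ?_ (by simpa using hyn)
    rw [factorPoly_cons, Polynomial.eval_mul]
    refine IsUnit.mul ?_ (isUnit_eval_factorPoly hζ')
    have : IsUnit (algebraMap K R (ζ' - ζ)) := (IsUnit.mk0 _ (sub_ne_zero.2 hne)).map _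
    have h2 := hxn.neg.isUnit_add_right_of_commute this (Commute.all _ _)
    convert h2 using 1
    simp
    ring
  obtain ⟨F₂, _, _, _, _, _, ρ₂, j₂, k₂, hs₂, hkj₂, hj₂, hk₂, hjm₂, hkm₂⟩ :=
    exists_module_step (c := algebraMap K R ζ' + y) (ζ := ζ')
      (t := (algebraMap K R ζ' + z - y) ::ₘ u') hq hd hs₁ (by simp [hc])
      (by simpa using hyn) hunit
      (by rw [hu']; exact factorSeries_deform hy hyz _ _)
      (by simp only [Multiset.card_cons, Multiset.card_map]; omega)
  refine ⟨F₂, inferInstance, inferInstance, inferInstance, inferInstance, inferInstance, ρ₂,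
    j₂ (j₁ v), κ ∘ₗ k₁ ∘ₗ k₂, ?_, ?_, ?_, fun φ => ?_, fun φ => ?_⟩
  · simp [hkj₁, hkj₂, hκ]
  · rw [map_sub, AlgHom.commutes, LinearMap.sub_apply, Module.algebraMap_end_apply, hj₂, hjm₁,
      map_smul, add_smul, algebraMap_smul, add_sub_cancel_left]
  · rw [map_sub, AlgHom.commutes, LinearMap.sub_apply, Module.algebraMap_end_apply, hjm₂,
      add_smul, algebraMap_smul, add_sub_cancel_left]
  · rw [map_sub, AlgHom.commutes, LinearMap.sub_apply, Module.algebraMap_end_apply]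
    simp only [LinearMap.comp_apply, map_sub, hk₂, hkm₁]
    rw [map_smul, ← algebraMap_smul R ζ φ, map_smul, map_smul, map_smul, add_smul,
      add_sub_cancel_left, smul_eq_mul]
  · rw [map_sub, AlgHom.commutes, LinearMap.sub_apply, Module.algebraMap_end_apply]
    simp only [LinearMap.comp_apply, map_sub, hkm₂]
    rw [map_smul, map_smul, ← algebraMap_smul R ζ' φ, map_smul, map_smul, map_smul, add_smul,
      add_sub_cancel_left, smul_eq_mul]

end HeckeB

namespace HeckeB

open PowerSeries

variable {K : Type} [Field K] {d q : K} {R M : Type} [CommRing R] [Algebra K R]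
  [AddCommGroup M] [Module K M] [Module R M] [IsScalarTower K R M]

theorem coeff_zSeries_apply_eigenvector {n : ℕ} {ρ : H d q n →ₐ[K] Module.End R M} {v : M}
    {a : ℕ → R} (h : ∀ k < n, ρ (ell q (gen d q n) k) v = a k • v) (j : ℕ) :
    ρ (coeff j (zSeries d q 1 n)) v =
      coeff j (factorSeries ((Multiset.range n).map a)) • v := by
  induction n generalizing j with
  | zero =>
    cases j with
    | zero => simp [coeff_zero_zSeries, coeff_zero_factorSeries]
    | succ j => simp [coeff_zSeries_of_lt, factorSeries_zero, coeff_one]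
  | succ n ih =>
    have h' : ∀ k < n, ρ.comp (inc d q n) (ell q (gen d q n) k) v = a k • v := by
      intro k hk
      rw [AlgHom.comp_apply, ell_map, ← h k (by omega)]
      congr 2
      exact ell_congr fun i hi => inc_gen (by omega)
    cases j with
    | zero => simp [coeff_zero_zSeries, coeff_zero_factorSeries]
    | succ j =>
      have h1 := ih h' (j + 1)
      have h2 := ih h' j
      rw [AlgHom.comp_apply] at h1 h2
      have h3 : ρ (jm d q n) v = a n • v := h n n.lt_succ_self
      rw [Multiset.range_succ, Multiset.map_cons, coeff_succ_factorSeries_cons,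
        coeff_succ_zSeries_succ, map_sub, LinearMap.sub_apply, h1, map_mul, Module.End.mul_apply,
        h2, map_smul, h3, sub_smul, mul_comm, mul_smul]

theorem hasContent_of_eigenvector (hq : q ≠ 0) {n : ℕ} {ρ : H d q n →ₐ[K] Module.End R M} {v : M}
    {a : ℕ → R} (h : ∀ k < n, ρ (ell q (gen d q n) k) v = a k • v)
    (hv : ∀ m, m ∈ Submodule.span R (Set.range fun x => ρ x v)) :
    HasContent ρ ((Multiset.range n).map a) := by
  intro j
  ext m
  rw [Module.algebraMap_end_apply]
  induction hv m using Submodule.span_induction with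
  | mem m hm =>
    obtain ⟨x, rfl⟩ := hm
    simp only
    rw [← Module.End.mul_apply, ← map_mul, (commute_coeff_zSeries hq n j x).eq, map_mul,
      Module.End.mul_apply, coeff_zSeries_apply_eigenvector h, map_smul]
  | zero => simp
  | add x y _ _ hx hy => rw [map_add, hx, hy, smul_add]
  | smul r x _ hx => rw [map_smul, hx, smul_comm]

/-- The defining relations hold for the trivial representation. -/
theorem isHeckeSeq_trivial (n : ℕ) :
    IsHeckeSeq d q n fun i => if i = 0 then (1 : Module.End R R) else algebraMap K _ q := by
  constructor
  · simp
  · intro i hi hn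
    simp [hi.ne']
  · intro
    simp [Algebra.commutes]
  · intro i hi hn
    simp [hi.ne']
  · intro i j hij hn
    by_cases hi : i = 0 <;> by_cases hj : j = 0 <;> simp [hi, hj]

theorem exists_trivial_module (hq : q ≠ 0) (R : Type) [CommRing R] [Algebra K R]
    [Module.Finite K R] (n : ℕ) : ∃ (M : Type) (_ : AddCommGroup M) (_ : Module K M)
      (_ : Module R M) (_ : IsScalarTower K R M) (_ : Module.Finite K M)
      (ρ : H d q n →ₐ[K] Module.End R M) (v : M) (κ : M →ₗ[R] R),
      κ v = 1 ∧ HasContent ρ (((Multiset.range n).map (q ^ ·)).map (algebraMap K R)) := by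
  refine ⟨R, inferInstance, inferInstance, inferInstance, inferInstance, inferInstance,
    lift (isHeckeSeq_trivial n), 1, LinearMap.id, rfl, ?_⟩
  rw [Multiset.map_map]
  refine hasContent_of_eigenvector hq (v := 1) (fun k hk => ?_) fun m => ?_
  · have e : lift (isHeckeSeq_trivial (d := d) (q := q) (R := R) n) (ell q (gen d q n) k) =
        algebraMap K _ (q ^ k) := by
      induction k with
      | zero =>
        rw [ell, lift_gen _ hk, pow_zero, map_one, if_pos rfl]
      | succ k ih =>
        rw [ell, map_smul, map_mul, map_mul, ih (by omega), lift_gen _ hk, if_neg k.succ_ne_zero,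
          ← map_mul, ← map_mul, Algebra.smul_def, ← map_mul]
        congr 1
        field_simp
        ring
    rw [e, Module.algebraMap_end_apply, Algebra.smul_def, Function.comp_apply, smul_eq_mul]
  · have := Submodule.smul_mem _ m (Submodule.subset_span (R := R) (s := Set.range fun x =>
      lift (isHeckeSeq_trivial (d := d) (q := q) (R := R) n) x 1) ⟨1, rfl⟩)
    simpa using this

end HeckeB

namespace HeckeB

open CliffordAlgebra

section transvection

variable {R U : Type*} [CommRing R] [AddCommGroup U] [Module R U]

/-- The transvection-like map `u ↦ u + φ(u) α`. -/
def transvec (φ : Module.Dual R U) (α : U) : Module.End R U := 1 + φ.smulRight α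

theorem transvec_apply (φ : Module.Dual R U) (α u : U) : transvec φ α u = u + φ u • α := rfl

theorem transvec_mul_self (φ : Module.Dual R U) (α : U) :
    (transvec φ α - 1) * (transvec φ α - algebraMap R _ (1 + φ α)) = 0 := by
  ext u
  simp [transvec_apply, Module.algebraMap_end_apply]
  module

theorem transvec_commute {φ ψ : Module.Dual R U} {α β : U} (h : φ β = 0) (h' : ψ α = 0) :
    transvec φ α * transvec ψ β = transvec ψ β * transvec φ α := by
  ext u
  simp [transvec_apply, h, h']
  module

theorem transvec_braid {φ ψ : Module.Dual R U} {α β : U} (h : φ α = ψ β)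
    (h' : 1 + φ α + φ β * ψ α = 0) :
    transvec φ α * transvec ψ β * transvec φ α = transvec ψ β * transvec φ α * transvec ψ β := by
  ext u
  simp only [Module.End.mul_apply, transvec_apply, map_add, map_smul]
  match_scalars
  · ring
  · linear_combination φ u * h'
  · linear_combination -ψ u * h' + ψ u * h

theorem transvec_braid_four {φ ψ : Module.Dual R U} {α β : U}
    (h : (1 + φ α) + (1 + ψ β) + φ β * ψ α = 0) :
    transvec φ α * transvec ψ β * transvec φ α * transvec ψ β =
      transvec ψ β * transvec φ α * transvec ψ β * transvec φ α := by
  ext u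
  simp only [Module.End.mul_apply, transvec_apply, map_add, map_smul]
  match_scalars
  · ring
  · linear_combination (ψ u * φ β) * h
  · linear_combination -(φ u * ψ α) * h

theorem exteriorMap_transvec (φ : Module.Dual R U) (α : U) (x : ExteriorAlgebra R U) :
    ExteriorAlgebra.map (transvec φ α) x = x + ExteriorAlgebra.ι R α * contractLeft φ x := by
  induction x using CliffordAlgebra.left_induction with
  | algebraMap r => simp [contractLeft_algebraMap]
  | add x y hx hy => simp only [map_add, hx, hy, mul_add]; abel
  | ι_mul x m hx =>
    have e : ExteriorAlgebra.ι R m * ExteriorAlgebra.ι R α =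
        -(ExteriorAlgebra.ι R α * ExteriorAlgebra.ι R m) :=
      eq_neg_of_add_eq_zero_left (ExteriorAlgebra.ι_add_mul_swap m α)
    rw [contractLeft_ι_mul]
    change ExteriorAlgebra.map (transvec φ α) (ExteriorAlgebra.ι R m * x) =
      ExteriorAlgebra.ι R m * x + ExteriorAlgebra.ι R α * (φ m • x -
        ExteriorAlgebra.ι R m * contractLeft φ x)
    have e' : ExteriorAlgebra.ι R α * (ExteriorAlgebra.ι R α * contractLeft φ x) = 0 := by
      rw [← mul_assoc, ExteriorAlgebra.ι_sq_zero, zero_mul]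
    rw [map_mul, ExteriorAlgebra.map_apply_ι, hx, transvec_apply, map_add, map_smul, add_mul,
      mul_add, mul_add, smul_mul_assoc, smul_mul_assoc, e', ← mul_assoc, e, mul_sub,
      mul_smul_comm, smul_zero, neg_mul, mul_assoc]
    abel

theorem exteriorMap_transvec_mul_self (φ : Module.Dual R U) (α : U) :
    ((ExteriorAlgebra.map (transvec φ α)).toLinearMap - 1 : Module.End R (ExteriorAlgebra R U)) *
      ((ExteriorAlgebra.map (transvec φ α)).toLinearMap - algebraMap R _ (1 + φ α)) = 0 := by
  refine LinearMap.ext fun x => ?_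
  have e : contractLeft φ (ExteriorAlgebra.ι R α * contractLeft φ x) = φ α • contractLeft φ x := by
    erw [contractLeft_ι_mul, contractLeft_contractLeft, mul_zero, sub_zero]
  rw [Module.End.mul_apply, LinearMap.sub_apply, LinearMap.sub_apply, Module.End.one_apply,
    Module.algebraMap_end_apply, AlgHom.toLinearMap_apply,
    AlgHom.toLinearMap_apply, exteriorMap_transvec, exteriorMap_transvec, add_sub_cancel_left,
    add_smul, one_smul, add_sub_add_left_eq_sub,
    map_sub, e, map_smul, sub_self, mul_zero, LinearMap.zero_apply]

theorem exteriorMap_transvec_of_ι_mul_eq_zero {φ : Module.Dual R U} {α : U}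
    {x : ExteriorAlgebra R U} (h : ExteriorAlgebra.ι R α * x = 0) :
    ExteriorAlgebra.map (transvec φ α) x = (1 + φ α) • x := by
  have h' := congrArg (contractLeft φ) h
  rw [map_zero] at h'
  erw [contractLeft_ι_mul] at h'
  rw [exteriorMap_transvec, add_smul, one_smul, sub_eq_zero.1 h']

end transvection

section scale

variable {K : Type} [Field K] {A : Type*} [Ring A] [Algebra K A] {d q : K} {n : ℕ}

/-- Rescale all terms of a sequence but the first. -/
def scale (q : K) (g : ℕ → A) (i : ℕ) : A := if i = 0 then g 0 else q • g i

theorem scale_zero (g : ℕ → A) : scale q g 0 = g 0 := rfl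

theorem scale_succ (g : ℕ → A) (i : ℕ) : scale q g (i + 1) = q • g (i + 1) := rfl

theorem ell_scale (g : ℕ → A) (k : ℕ) :
    ell q (scale q g) k = q ^ k • ell (1 : K) g k := by
  induction k with
  | zero => simp [ell, scale_zero]
  | succ k ih =>
    simp only [ell, scale_succ, ih, smul_mul_assoc, mul_smul_comm, smul_smul, inv_one]
    congr 1
    field_simp
    ring

/-- The defining relations for a rescaled sequence of generators. -/
theorem isHeckeSeq_scale (hq : q ≠ 0) {g : ℕ → A}
    (h0 : (g 0 - 1) * (g 0 - algebraMap K A d) = 0)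
    (hs : ∀ i, (g (i + 1) - 1) * (g (i + 1) - algebraMap K A (-q⁻¹)) = 0)
    (hb0 : g 0 * g 1 * g 0 * g 1 = g 1 * g 0 * g 1 * g 0)
    (hb : ∀ i, g (i + 2) * g (i + 1) * g (i + 2) = g (i + 1) * g (i + 2) * g (i + 1))
    (hc : ∀ i j, i + 1 < j → g i * g j = g j * g i) (n : ℕ) :
    IsHeckeSeq d q n (scale q g) where
  quad_zero _ := h0
  quad i hi _ := by
    obtain ⟨i, rfl⟩ := Nat.exists_eq_succ_of_ne_zero hi.ne'
    have h := congrArg (q ^ 2 • ·) (hs i)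
    simp only [smul_zero, Nat.succ_eq_add_one, scale_succ] at h ⊢
    rw [← h, Algebra.algebraMap_eq_smul_one, Algebra.algebraMap_eq_smul_one]
    simp only [mul_sub, add_mul, sub_mul, smul_mul_assoc, mul_smul_comm, one_mul, mul_one,
      smul_sub, smul_smul]
    match_scalars <;> field_simp
    ring
  braid_zero _ := by
    rw [show (1 : ℕ) = 0 + 1 from rfl, scale_zero, scale_succ]
    simp only [mul_smul_comm, smul_mul_assoc, zero_add, hb0]
  braid i hi _ := by
    obtain ⟨i, rfl⟩ := Nat.exists_eq_succ_of_ne_zero hi.ne'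
    simp only [Nat.succ_eq_add_one, scale_succ, mul_smul_comm, smul_mul_assoc, hb i]
  comm i j hij _ := by
    unfold scale
    split_ifs <;> simp_all [hc i j hij]

end scale

end HeckeB

namespace HeckeB

open CliffordAlgebra

section exteriorRep

variable {K : Type} [Field K] (d q : K) (R : Type) [CommRing R] [Algebra K R]

/-- The linear forms defining the deformed reflection representation of `H_q(B_n)`. -/
noncomputable def reflForm : ℕ → Module.Dual R (ℕ →₀ R)
  | 0 => algebraMap K R (d - 1) • Finsupp.lapply 0 + algebraMap K R (q⁻¹ - d) • Finsupp.lapply 1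
  | i + 1 => Finsupp.lapply i - algebraMap K R (1 + q⁻¹) • Finsupp.lapply (i + 1) +
      algebraMap K R q⁻¹ • Finsupp.lapply (i + 2)

/-- The `i`-th standard basis vector. -/
noncomputable abbrev vec (i : ℕ) : ℕ →₀ R := Finsupp.single i 1

/-- The (rescaled) action of the generators on the reflection representation. -/
noncomputable def reflGen (i : ℕ) : Module.End R (ℕ →₀ R) :=
  transvec (reflForm d q R i) (vec R i)

/-- The (rescaled) action of the generators on the exterior algebra of the reflection
representation. -/
noncomputable def extGen (i : ℕ) : Module.End R (ExteriorAlgebra R (ℕ →₀ R)) :=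
  (ExteriorAlgebra.map (reflGen d q R i)).toLinearMap

variable {d q R}

theorem one_add_reflForm_zero :
    1 + reflForm d q R 0 (vec R 0) = algebraMap K R d := by
  simp [reflForm]

theorem one_add_reflForm_succ (i : ℕ) :
    1 + reflForm d q R (i + 1) (vec R (i + 1)) = algebraMap K R (-q⁻¹) := by
  simp [reflForm]

theorem reflForm_zero_one : reflForm d q R 0 (vec R 1) = algebraMap K R (q⁻¹ - d) := by
  simp [reflForm]

theorem reflForm_succ_self (i : ℕ) : reflForm d q R (i + 1) (vec R i) = 1 := by
  simp [reflForm]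

theorem reflForm_succ_succ (i : ℕ) :
    reflForm d q R (i + 1) (vec R (i + 2)) = algebraMap K R q⁻¹ := by
  simp [reflForm, ← Algebra.algebraMap_eq_smul_one]

theorem reflForm_of_lt {i j : ℕ} (h : i + 1 < j) : reflForm d q R i (vec R j) = 0 := by
  rcases i with _ | i <;> simp [reflForm, Finsupp.single_apply] <;> grind

theorem reflForm_of_gt {i j : ℕ} (h : i + 1 < j) : reflForm d q R j (vec R i) = 0 := by
  obtain ⟨j, rfl⟩ := Nat.exists_eq_succ_of_ne_zero (by omega : j ≠ 0)
  simp [reflForm, Finsupp.single_apply]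
  grind

theorem reflGen_braid_zero : reflGen d q R 0 * reflGen d q R 1 * reflGen d q R 0 * reflGen d q R 1 =
    reflGen d q R 1 * reflGen d q R 0 * reflGen d q R 1 * reflGen d q R 0 := by
  refine transvec_braid_four ?_
  rw [one_add_reflForm_zero, one_add_reflForm_succ, reflForm_zero_one, reflForm_succ_self, mul_one,
    ← map_add, ← map_add, show d + -q⁻¹ + (q⁻¹ - d) = 0 by ring, map_zero]

theorem reflGen_braid (i : ℕ) :
    reflGen d q R (i + 2) * reflGen d q R (i + 1) * reflGen d q R (i + 2) =
      reflGen d q R (i + 1) * reflGen d q R (i + 2) * reflGen d q R (i + 1) := by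
  refine transvec_braid ?_ ?_
  · rw [← add_right_inj (1 : R), one_add_reflForm_succ, one_add_reflForm_succ]
  · rw [one_add_reflForm_succ, reflForm_succ_self, reflForm_succ_succ]
    simp

theorem reflGen_comm {i j : ℕ} (h : i + 1 < j) :
    reflGen d q R i * reflGen d q R j = reflGen d q R j * reflGen d q R i :=
  transvec_commute (reflForm_of_lt h) (reflForm_of_gt h)

theorem extGen_mul (u v : Module.End R (ℕ →₀ R)) :
    (ExteriorAlgebra.map (u * v)).toLinearMap =
      ((ExteriorAlgebra.map u).toLinearMap * (ExteriorAlgebra.map v).toLinearMap :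
        Module.End R (ExteriorAlgebra R (ℕ →₀ R))) := by
  rw [Module.End.mul_eq_comp, ← ExteriorAlgebra.map_comp_map]
  rfl

theorem isHeckeSeq_reflGen (hq : q ≠ 0) (n : ℕ) :
    IsHeckeSeq d q n (scale q (reflGen d q R)) := by
  refine isHeckeSeq_scale hq ?_ (fun i => ?_) reflGen_braid_zero reflGen_braid
    (fun _ _ => reflGen_comm) n
  · have := transvec_mul_self (reflForm d q R 0) (vec R 0)
    rwa [one_add_reflForm_zero, ← IsScalarTower.algebraMap_apply] at this
  · have := transvec_mul_self (reflForm d q R (i + 1)) (vec R (i + 1))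
    rwa [one_add_reflForm_succ, ← IsScalarTower.algebraMap_apply] at this

theorem isHeckeSeq_extGen (hq : q ≠ 0) (n : ℕ) :
    IsHeckeSeq d q n (scale q (extGen d q R)) := by
  refine isHeckeSeq_scale hq ?_ (fun i => ?_) ?_ (fun i => ?_) (fun i j h => ?_) n
  · have := exteriorMap_transvec_mul_self (reflForm d q R 0) (vec R 0)
    rwa [one_add_reflForm_zero, ← IsScalarTower.algebraMap_apply] at this
  · have := exteriorMap_transvec_mul_self (reflForm d q R (i + 1)) (vec R (i + 1))
    rwa [one_add_reflForm_succ, ← IsScalarTower.algebraMap_apply] at this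
  · simp only [extGen, ← extGen_mul, reflGen_braid_zero]
  · simp only [extGen, ← extGen_mul, reflGen_braid]
  · simp only [extGen, ← extGen_mul, reflGen_comm h]

theorem ell_extGen (k : ℕ) : ell (1 : K) (extGen d q R) k =
    (ExteriorAlgebra.map (ell (1 : K) (reflGen d q R) k)).toLinearMap := by
  induction k with
  | zero => rfl
  | succ k ih => simp only [ell, inv_one, one_smul, ih, extGen_mul]; rfl

theorem reflGen_apply_of_eq_zero {i : ℕ} {u : ℕ →₀ R} (h : reflForm d q R i u = 0) :
    reflGen d q R i u = u := by
  rw [reflGen, transvec_apply, h, zero_smul, add_zero]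

theorem ell_reflGen_vec_zero (k : ℕ) : ell (1 : K) (reflGen d q R) (k + 1) (vec R 0) =
    q⁻¹ • vec R 0 := by
  induction k with
  | zero =>
    have h1 : reflGen d q R 1 (vec R 0) = vec R 0 + vec R 1 := by
      rw [reflGen, transvec_apply, reflForm_succ_self, one_smul]
    have h2 : reflGen d q R 1 (vec R 1) = -q⁻¹ • vec R 1 := by
      rw [reflGen, transvec_apply, ← algebraMap_smul R (-q⁻¹), ← one_add_reflForm_succ (d := d) 0,
        add_smul, one_smul]
    have h3 : reflGen d q R 0 (vec R 0 + vec R 1) = q⁻¹ • vec R 0 + vec R 1 := by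
      have h : algebraMap K R d + algebraMap K R (q⁻¹ - d) = algebraMap K R q⁻¹ := by
        rw [← map_add, add_sub_cancel]
      rw [reflGen, transvec_apply, map_add, reflForm_zero_one, ← algebraMap_smul R q⁻¹, ← h,
        ← one_add_reflForm_zero (d := d) (q := q)]
      module
    rw [ell, ell, inv_one, one_smul, Module.End.mul_apply, Module.End.mul_apply, zero_add, h1, h3,
      map_add, LinearMap.map_smul_of_tower, h1, h2]
    module
  | succ k ih =>
    have h := reflGen_apply_of_eq_zero (reflForm_of_gt (d := d) (q := q) (R := R)
      (by omega : 0 + 1 < k + 2))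
    rw [ell, inv_one, one_smul, Module.End.mul_apply, Module.End.mul_apply, h, ih,
      LinearMap.map_smul_of_tower, h]

theorem ell_reflGen_vec (hq : q ≠ 0) {i k : ℕ} (h : i < k) :
    ell (1 : K) (reflGen d q R) k (vec R i) = q⁻¹ • vec R i := by
  induction i with
  | zero =>
    obtain ⟨k, rfl⟩ := Nat.exists_eq_succ_of_ne_zero h.ne'
    exact ell_reflGen_vec_zero k
  | succ i ih =>
    have hc := commute_ell_of_lt (isHeckeSeq_reflGen (d := d) (R := R) hq (k + 1)) h k.lt_succ_self
    rw [ell_scale, scale_succ] at hc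
    have hc' : Commute (reflGen d q R (i + 1)) (ell (1 : K) (reflGen d q R) k) := by
      have := (hc.smul_left q⁻¹).smul_right (q ^ k)⁻¹
      rwa [smul_smul, smul_smul, inv_mul_cancel₀ hq, inv_mul_cancel₀ (pow_ne_zero _ hq), one_smul,
        one_smul] at this
    have e : vec R (i + 1) = reflGen d q R (i + 1) (vec R i) - vec R i := by
      rw [reflGen, transvec_apply, reflForm_succ_self, one_smul, add_sub_cancel_left]
    have h1 := LinearMap.congr_fun hc'.eq (vec R i)
    rw [Module.End.mul_apply, Module.End.mul_apply] at h1
    rw [e, map_sub, ← h1, ih (by omega), LinearMap.map_smul_of_tower, smul_sub]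

variable (R) in
/-- The product of the first `m` basis vectors in the exterior algebra. -/
noncomputable def topForm : ℕ → ExteriorAlgebra R (ℕ →₀ R)
  | 0 => 1
  | m + 1 => ExteriorAlgebra.ι R (vec R m) * topForm m

theorem ι_mul_topForm {i m : ℕ} (h : i < m) : ExteriorAlgebra.ι R (vec R i) * topForm R m = 0 := by
  induction m with
  | zero => omega
  | succ m ih =>
    rw [topForm, ← mul_assoc]
    rcases Nat.lt_succ_iff_lt_or_eq.1 h with h | rfl
    · rw [eq_neg_of_add_eq_zero_left (ExteriorAlgebra.ι_add_mul_swap (vec R i) (vec R m)), neg_mul,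
        mul_assoc, ih h, mul_zero, neg_zero]
    · rw [ExteriorAlgebra.ι_sq_zero, zero_mul]

theorem map_topForm {g : Module.End R (ℕ →₀ R)} {c : K} {m : ℕ}
    (h : ∀ i < m, g (vec R i) = c • vec R i) :
    ExteriorAlgebra.map g (topForm R m) = c ^ m • topForm R m := by
  induction m with
  | zero => simp [topForm]
  | succ m ih =>
    rw [topForm, map_mul, ExteriorAlgebra.map_apply_ι, h m m.lt_succ_self,
      ih fun i hi => h i (by omega), LinearMap.map_smul_of_tower, smul_mul_smul_comm, pow_succ']

theorem exists_dual_topForm (m : ℕ) :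
    ∃ κ : ExteriorAlgebra R (ℕ →₀ R) →ₗ[R] R, κ (topForm R m) = 1 := by
  induction m with
  | zero => exact ⟨ExteriorAlgebra.algebraMapInv.toLinearMap, by simp [topForm]⟩
  | succ m ih =>
    obtain ⟨κ, hκ⟩ := ih
    have hz : ∀ l ≤ m,
        contractLeft (Finsupp.lapply m : Module.Dual R (ℕ →₀ R)) (topForm R l) = 0 := by
      intro l hl
      induction l with
      | zero => exact contractLeft_one (Q := 0) _
      | succ l ih =>
        rw [topForm]
        erw [contractLeft_ι_mul]
        rw [ih (by omega), mul_zero, sub_zero, Finsupp.lapply_apply,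
          Finsupp.single_eq_of_ne (by omega), zero_smul]
    refine ⟨κ ∘ₗ contractLeft (Finsupp.lapply m : Module.Dual R (ℕ →₀ R)), ?_⟩
    rw [LinearMap.comp_apply, topForm]
    erw [contractLeft_ι_mul]
    rw [hz m le_rfl, mul_zero, sub_zero, Finsupp.lapply_apply, Finsupp.single_eq_same, one_smul, hκ]

theorem extGen_topForm_zero {m : ℕ} (h : 0 < m) :
    extGen d q R 0 (topForm R m) = d • topForm R m := by
  rw [extGen, reflGen, AlgHom.toLinearMap_apply, exteriorMap_transvec_of_ι_mul_eq_zero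
    (ι_mul_topForm h), one_add_reflForm_zero, algebraMap_smul]

theorem extGen_topForm_succ {i m : ℕ} (h : i + 1 < m) :
    extGen d q R (i + 1) (topForm R m) = -q⁻¹ • topForm R m := by
  rw [extGen, reflGen, AlgHom.toLinearMap_apply, exteriorMap_transvec_of_ι_mul_eq_zero
    (ι_mul_topForm h), one_add_reflForm_succ, algebraMap_smul]

theorem ell_extGen_topForm_of_lt {k m : ℕ} (h : k < m) :
    ell q (scale q (extGen d q R)) k (topForm R m) = (d * q⁻¹ ^ k) • topForm R m := by
  induction k with
  | zero => rw [ell, scale_zero, extGen_topForm_zero h, pow_zero, mul_one]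
  | succ k ih =>
    rw [ell, scale_succ]
    simp only [LinearMap.smul_apply, Module.End.mul_apply, extGen_topForm_succ h,
      LinearMap.map_smul_of_tower, ih (by omega), smul_smul]
    congr 1
    by_cases hq : q = 0
    · simp [hq]
    · rw [pow_succ]
      field_simp

theorem ell_extGen_topForm_of_le (hq : q ≠ 0) {k m : ℕ} (h : m ≤ k) :
    ell q (scale q (extGen d q R)) k (topForm R m) = (q ^ k * q⁻¹ ^ m) • topForm R m := by
  rw [ell_scale, LinearMap.smul_apply, ell_extGen, AlgHom.toLinearMap_apply,
    map_topForm fun i hi => ell_reflGen_vec hq (by omega), smul_smul]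

end exteriorRep

end HeckeB

namespace HeckeB

variable {K : Type} [Field K] {d q : K}

/-- An eigenvector of the Jucys-Murphy elements which has a unit coordinate generates a module
with the corresponding content. -/
theorem exists_cyclic_module (hq : q ≠ 0) {R M : Type} [CommRing R] [Algebra K R]
    [Module.Finite K R] [AddCommGroup M] [Module K M] [Module R M] [IsScalarTower K R M] {n : ℕ}
    (ρ : H d q n →ₐ[K] Module.End R M) (v : M) (κ : M →ₗ[R] R) (hκ : κ v = 1) {a : ℕ → R}
    (h : ∀ k < n, ρ (ell q (gen d q n) k) v = a k • v) :
    ∃ (N : Type) (_ : AddCommGroup N) (_ : Module K N) (_ : Module R N) (_ : IsScalarTower K R N)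
      (_ : Module.Finite K N) (ρ : H d q n →ₐ[K] Module.End R N) (v : N) (κ : N →ₗ[R] R),
      κ v = 1 ∧ HasContent ρ ((Multiset.range n).map a) := by
  let f : H d q n →ₗ[K] M :=
    { toFun := fun x => ρ x v
      map_add' := fun x y => by simp
      map_smul' := fun c x => by simp }
  let N : Submodule R M := Submodule.span R (Set.range fun x => ρ x v)
  have hN (x : H d q n) : ∀ m ∈ N, ρ x m ∈ N := by
    intro m hm
    induction hm using Submodule.span_induction with
    | mem m hm =>
      obtain ⟨y, rfl⟩ := hm
      exact Submodule.subset_span ⟨x * y, by simp⟩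
    | zero => rw [map_zero]; exact N.zero_mem
    | add y z _ _ hy hz => rw [map_add]; exact N.add_mem hy hz
    | smul r y _ hy => rw [map_smul]; exact N.smul_mem r hy
  let ρ' : H d q n →ₐ[K] Module.End R N :=
    { toFun := fun x => (ρ x).restrict (hN x)
      map_one' := by ext; simp
      map_mul' := fun x y => by ext; simp
      map_zero' := by ext; simp
      map_add' := fun x y => by ext; simp
      commutes' := fun c => by ext; simp [Module.algebraMap_end_apply] }
  have hv : v ∈ N := Submodule.subset_span ⟨1, by simp⟩
  have : Module.Finite K (H d q n) := finite_H hq n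
  have : Module.Finite R N := by
    have hfg : (⊤ : Submodule K (H d q n)).FG := Module.Finite.fg_top
    obtain ⟨s, hs⟩ := hfg
    classical
    refine Module.Finite.iff_fg.2 ⟨s.image f, le_antisymm (Submodule.span_mono ?_) ?_⟩
    · rintro _ hx
      obtain ⟨x, -, rfl⟩ := Finset.mem_image.1 (Finset.mem_coe.1 hx)
      exact ⟨x, rfl⟩
    · refine Submodule.span_le.2 ?_
      rintro _ ⟨x, rfl⟩
      have hx : x ∈ Submodule.span K (s : Set (H d q n)) := hs ▸ Submodule.mem_top
      have h1 : f x ∈ Submodule.span K (f '' s) := by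
        rw [← Submodule.map_span]
        exact ⟨x, hx, rfl⟩
      rw [Finset.coe_image]
      exact Submodule.span_le_restrictScalars K R _ h1
  refine ⟨N, inferInstance, inferInstance, inferInstance, inferInstance,
    Module.Finite.trans R N, ρ', ⟨v, hv⟩, κ ∘ₗ N.subtype, hκ, ?_⟩
  refine hasContent_of_eigenvector hq (v := (⟨v, hv⟩ : N)) (fun k hk => Subtype.ext (h k hk)) ?_
  rintro ⟨m, hm⟩
  induction hm using Submodule.span_induction with
  | mem m hm =>
    obtain ⟨y, rfl⟩ := hm
    exact Submodule.subset_span ⟨y, rfl⟩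
  | zero => exact Submodule.zero_mem _
  | add y z hy hz hy' hz' => exact Submodule.add_mem _ hy' hz'
  | smul r y hy hy' => exact Submodule.smul_mem _ r hy'

/-- A module of content `d, d q⁻¹, …, d q^{1 - m}, 1, q, …, q^{m - 1}`. -/
theorem exists_exterior_module (hq : q ≠ 0) (R : Type) [CommRing R] [Algebra K R]
    [Module.Finite K R] (m : ℕ) : ∃ (M : Type) (_ : AddCommGroup M) (_ : Module K M)
      (_ : Module R M) (_ : IsScalarTower K R M) (_ : Module.Finite K M)
      (ρ : H d q (m + m) →ₐ[K] Module.End R M) (v : M) (κ : M →ₗ[R] R),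
      κ v = 1 ∧ HasContent ρ (((Multiset.range m).map (d * q⁻¹ ^ ·) +
        (Multiset.range m).map (q ^ ·)).map (algebraMap K R)) := by
  obtain ⟨κ, hκ⟩ := exists_dual_topForm (R := R) m
  have e : ((Multiset.range m).map (d * q⁻¹ ^ ·) + (Multiset.range m).map (q ^ ·)).map
      (algebraMap K R) = (Multiset.range (m + m)).map fun k =>
        algebraMap K R (if k < m then d * q⁻¹ ^ k else q ^ k * q⁻¹ ^ m) := by
    rw [Multiset.range_add, Multiset.map_add, Multiset.map_add, Multiset.map_map,
      Multiset.map_map, Multiset.map_map]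
    congr 1
    · refine Multiset.map_congr rfl fun k hk => ?_
      rw [Function.comp_apply, if_pos (Multiset.mem_range.1 hk)]
    · refine Multiset.map_congr rfl fun k hk => ?_
      rw [Function.comp_apply, Function.comp_apply, if_neg (by omega), pow_add, mul_comm (q ^ m),
        mul_assoc, ← mul_pow, mul_inv_cancel₀ hq, one_pow, mul_one]
  rw [e]
  refine exists_cyclic_module hq (lift (isHeckeSeq_extGen hq (m + m))) (topForm R m) κ hκ
    fun k hk => ?_
  rw [ell_map, ell_congr (t := scale q (extGen d q R)) fun i hi => lift_gen _ (by omega),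
    algebraMap_smul]
  split_ifs with h
  · exact ell_extGen_topForm_of_lt h
  · exact ell_extGen_topForm_of_le hq (by omega)

end HeckeB

namespace HeckeB

section numerics

variable {K : Type} [Field K] {d q : K}

theorem exists_eq_cons_cons_of_le {α : Type*} {a : α} {s : Multiset α}
    (h : {a} + {a} ≤ s) : ∃ u, s = a ::ₘ a ::ₘ u := by
  obtain ⟨u, rfl⟩ := Multiset.le_iff_exists_add.1 h
  exact ⟨u, by simp⟩

theorem map_mul_le_bigContent (s : Multiset K) : s.map (q * ·) ≤ bigContent d q s :=
  ((Multiset.le_add_right _ _).trans (Multiset.le_cons_self _ _)).trans (Multiset.le_cons_self _ _)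

theorem map_inv_mul_le_bigContent (s : Multiset K) : s.map (q⁻¹ * ·) ≤ bigContent d q s :=
  ((Multiset.le_add_left _ _).trans (Multiset.le_cons_self _ _)).trans (Multiset.le_cons_self _ _)

theorem pair_map_le {s t : Multiset K} {a b c : K} (has : a ∈ s) (hat : a ∈ t) (h : c * a = b) :
    {b} + {b} ≤ (s + t).map (c * ·) := by
  have h1 : ({a} + {a} : Multiset K) ≤ s + t :=
    add_le_add (Multiset.singleton_le.2 has) (Multiset.singleton_le.2 hat)
  simpa [h] using Multiset.map_le_map (f := (c * ·)) h1

theorem pow_ne_pow_of_lt (hq : q ≠ 0) {e i j : ℕ} (hqe : ∀ i, 0 < i → i < e → q ^ i ≠ 1)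
    (hij : i < j) (hj : j < i + e) : q ^ j ≠ q ^ i := by
  obtain ⟨l, rfl⟩ := Nat.exists_eq_add_of_lt hij
  intro h
  refine hqe (l + 1) (by omega) (by omega) (mul_left_cancel₀ (pow_ne_zero i hq) ?_)
  rw [← pow_add, mul_one, ← h, add_assoc]

theorem hasDeformation_of_lt (hq : q ≠ 0) (f : ℕ) (hqe : ∀ i, 0 < i → i < f + 3 → q ^ i ≠ 1) :
    HasDeformation K (H (q ^ f) q (2 * f + 4)) := by
  have hne {i j : ℕ} (hij : i < j) (hj : j < i + (f + 3)) := pow_ne_pow_of_lt hq hqe hij hj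
  refine hasDeformation_of_content (n := 2 * f + 1) hq (pow_ne_zero f hq)
    (ζ := q ^ (f + 1)) (ζ' := q⁻¹)
    (s₀ := (Multiset.range (f + 1)).map (q ^ f * q⁻¹ ^ ·) + (Multiset.range (f + 1)).map (q ^ ·))
    ?_ ?_ ?_ ?_ ?_ (Or.inl ?_) ?_
  · simp
    ring
  · simp only [Multiset.mem_add, Multiset.mem_map, Multiset.mem_range, not_or, not_exists, not_and]
    refine ⟨fun k hk h => ?_, fun k hk h => hne (by omega) (by omega) h.symm⟩
    refine hne (i := f) (j := f + 1 + k) (by omega) (by omega) ?_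
    rw [pow_add, ← h, mul_assoc, ← mul_pow, inv_mul_cancel₀ hq, one_pow, mul_one]
  · simp only [Multiset.mem_add, Multiset.mem_map, Multiset.mem_range, not_or, not_exists, not_and]
    refine ⟨fun k hk h => ?_, fun k hk h => ?_⟩
    · refine hne (i := k) (j := f + 1) (by omega) (by omega) ?_
      rw [inv_pow, ← div_eq_mul_inv, div_eq_iff (pow_ne_zero k hq)] at h
      rw [pow_succ, h, mul_right_comm, inv_mul_cancel₀ hq, one_mul]
    · refine hqe (k + 1) (by omega) (by omega) ?_
      rw [pow_succ, h, inv_mul_cancel₀ hq]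
  · intro h
    refine hqe (f + 2) (by omega) (by omega) ?_
    rw [pow_succ, ← h, inv_mul_cancel₀ hq]
  · refine exists_eq_cons_cons_of_le ((pair_map_le (a := q ^ f) ?_ ?_ ?_).trans
      (map_mul_le_bigContent _))
    · exact Multiset.mem_map.2 ⟨0, Multiset.mem_range.2 (by omega), by simp⟩
    · exact Multiset.mem_map.2 ⟨f, by simp, rfl⟩
    · rw [pow_succ']
  · refine exists_eq_cons_cons_of_le ((pair_map_le (a := 1) ?_ ?_ ?_).trans
      (map_inv_mul_le_bigContent _))
    · exact Multiset.mem_map.2 ⟨f, by simp, by rw [← mul_pow, mul_inv_cancel₀ hq, one_pow]⟩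
    · exact Multiset.mem_map.2 ⟨0, Multiset.mem_range.2 (by omega), pow_zero q⟩
    · rw [mul_one]
  · intro R _ _ _
    rw [show 2 * f + 1 + 1 = f + 1 + (f + 1) by ring]
    exact exists_exterior_module hq R (f + 1)

theorem hasDeformation_of_eq (hq : q ≠ 0) (f : ℕ) (hqe : ∀ i, 0 < i → i < f + 3 → q ^ i ≠ 1)
    (he : q ^ (f + 3) = 1) : HasDeformation K (H (q ^ (f + 1)) q (f + 3)) := by
  have hne {i j : ℕ} (hij : i < j) (hj : j < i + (f + 3)) := pow_ne_pow_of_lt hq hqe hij hj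
  have hmem {k : ℕ} (hk : k < f + 1) : q ^ k ∈ (Multiset.range (f + 1)).map (q ^ ·) :=
    Multiset.mem_map.2 ⟨k, Multiset.mem_range.2 hk, rfl⟩
  refine hasDeformation_of_content (n := f) hq (pow_ne_zero _ hq)
    (ζ := q ^ (f + 1)) (ζ' := q ^ (f + 2)) (s₀ := (Multiset.range (f + 1)).map (q ^ ·))
    (by simp) ?_ ?_ ?_ ?_ (Or.inr ⟨pow_succ' q _, ?_⟩) ?_
  · simp only [Multiset.mem_map, Multiset.mem_range, not_exists, not_and]
    exact fun k hk h => hne (by omega) (by omega) h.symm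
  · simp only [Multiset.mem_map, Multiset.mem_range, not_exists, not_and]
    exact fun k hk h => hne (by omega) (by omega) h.symm
  · exact hne (by omega) (by omega)
  · refine exists_eq_cons_cons_of_le ((add_le_add le_rfl ?_).trans
      ((Multiset.singleton_add _ _).le.trans (Multiset.le_cons_self _ _)))
    refine (Multiset.singleton_le.2 (Multiset.mem_map.2 ⟨q ^ f, hmem (by omega), ?_⟩)).trans
      (Multiset.le_add_right _ _)
    exact (pow_succ' q f).symm
  · refine Multiset.mem_of_le (map_inv_mul_le_bigContent _)
      (Multiset.mem_map.2 ⟨q ^ 0, hmem (by omega), ?_⟩)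
    rw [pow_zero, mul_one]
    exact inv_eq_of_mul_eq_one_right (by rw [← pow_succ', he])
  · exact fun R _ _ _ => exists_trivial_module hq R (f + 1)

end numerics

end HeckeB

theorem pow_ne_one_of_lt_multOrder {M : Type*} [Monoid M] {x : M} {i : ℕ} (hi : 0 < i)
    (h : (i : ℕ∞) < multOrder x) : x ^ i ≠ 1 := by
  intro h1
  have hd := Nat.le_of_dvd hi (orderOf_dvd_of_pow_eq_one h1)
  have h0 : orderOf x ≠ 0 := fun h0 => by
    have := orderOf_dvd_of_pow_eq_one h1
    rw [h0, zero_dvd_iff] at this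
    omega
  rw [multOrder, if_neg h0, Nat.cast_lt] at h
  omega

theorem pow_eq_one_of_multOrder_eq {M : Type*} [Monoid M] {x : M} {e : ℕ}
    (h : multOrder x = e) : x ^ e = 1 := by
  unfold multOrder at h
  split_ifs at h with h0
  · exact absurd h.symm (ENat.natCast_ne_top e)
  · rw [← Nat.cast_inj.1 h, pow_orderOf_eq_one]

theorem heckeB_infinite_representation_type_of_two_f_add_four_le_n
    (K : Type) [Field K] (q : K) (hq : q ≠ 0) (he : 3 ≤ multOrder q)
    (f : ℕ) (hf : ((2 * f : ℕ) : ℕ∞) ≤ multOrder q) (n : ℕ) (hn : 2 * f + 4 ≤ n) :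
    ¬ HasFiniteRepresentationType K (HeckeB K 1 (q ^ f) q n) := by
  intro h
  obtain ⟨τ, hτ⟩ := HeckeB.exists_opposite_hom (q ^ f) q n
  obtain ⟨b, hb⟩ := HeckeB.exists_boundedBy_of_hasFiniteRepresentationType h τ hτ
  by_cases h3 : ((f + 3 : ℕ) : ℕ∞) ≤ multOrder q
  · exact (HeckeB.hasDeformation_of_lt hq f fun i hi hlt => pow_ne_one_of_lt_multOrder hi
      ((Nat.cast_lt.2 hlt).trans_le h3)).not_boundedBy b (hb.of_le hq hn)
  · obtain ⟨e, heq⟩ := ENat.ne_top_iff_exists.1 (ne_top_of_lt (not_le.1 h3))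
    rw [← heq, Nat.cast_le] at h3 hf
    rw [← heq] at he
    have he' : 3 ≤ e := by exact_mod_cast he
    obtain ⟨f, rfl⟩ : ∃ g, f = g + 1 := ⟨f - 1, by omega⟩
    obtain rfl : e = f + 3 := by omega
    refine (HeckeB.hasDeformation_of_eq hq f (fun i hi hlt => ?_)
      (pow_eq_one_of_multOrder_eq heq.symm)).not_boundedBy b (hb.of_le hq (by omega))
    exact pow_ne_one_of_lt_multOrder hi (heq ▸ Nat.cast_lt.2 hlt)
end

section
/- Let f ≥ 0 and n be integers with n ≤ 2f + 3, and let λ be a bipartition of n. Then, for the counts attached to the f-shifted path sequence of λ, one has b_l + d_l = a_m + c_m + a_r + c_r. -/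
/-- A partition: a non-increasing sequence of non-negative integers with finite sum.
Here `part i` is the `(i+1)`-st part `λ_{i+1}`. -/
structure PartitionSeq : Type where
  part : ℕ → ℕ
  antitone' : ∀ {i j : ℕ}, i ≤ j → part j ≤ part i
  eventually_zero : ∃ N : ℕ, ∀ i : ℕ, N ≤ i → part i = 0

/-- The size `|λ| = Σ_i λ_i` of a partition. -/
noncomputable def PartitionSeq.size (μ : PartitionSeq) : ℕ := ∑ᶠ i : ℕ, μ.part i

open scoped Classical in
/-- The path sequence (Maya diagram) of a partition: `p_λ(i) = 0` if
`i = λ_j - j + 1` for some `j ≥ 1` (i.e. `i = part j - j` for some `j : ℕ` in the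
0-indexed convention used here), and `p_λ(i) = 1` otherwise. -/
noncomputable def PartitionSeq.path (μ : PartitionSeq) (i : ℤ) : ℕ :=
  if ∃ j : ℕ, i = (μ.part j : ℤ) - (j : ℤ) then 0 else 1

section PathCounts

variable (μ₁ μ₂ : PartitionSeq) (f : ℕ)

/-- Predicate: position `i` of the `f`-shifted path sequence of the bipartition
`(μ₁, μ₂)` carries the pair `A = (0,1)`. -/
def pairA (i : ℤ) : Prop := μ₁.path i = 0 ∧ μ₂.path (i - f) = 1

/-- Pair `B = (1,0)` at position `i`. -/
def pairB (i : ℤ) : Prop := μ₁.path i = 1 ∧ μ₂.path (i - f) = 0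

/-- Pair `C = (0,0)` at position `i`. -/
def pairC (i : ℤ) : Prop := μ₁.path i = 0 ∧ μ₂.path (i - f) = 0

/-- Pair `D = (1,1)` at position `i`. -/
def pairD (i : ℤ) : Prop := μ₁.path i = 1 ∧ μ₂.path (i - f) = 1

/-- The number of positions `i ≤ 0` (the left region) where `P` holds. -/
noncomputable def countL (P : ℤ → Prop) : ℕ := Set.ncard {i : ℤ | i ≤ 0 ∧ P i}

/-- The number of positions `1 ≤ i ≤ f` (the middle region) where `P` holds. -/
noncomputable def countM (P : ℤ → Prop) : ℕ :=
  Set.ncard {i : ℤ | 1 ≤ i ∧ i ≤ (f : ℤ) ∧ P i}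

/-- The number of positions `i > f` (the right region) where `P` holds. -/
noncomputable def countR (P : ℤ → Prop) : ℕ := Set.ncard {i : ℤ | (f : ℤ) < i ∧ P i}

end PathCounts

namespace PartitionSeq

variable (μ : PartitionSeq)

theorem path_eq_zero_iff (i : ℤ) : μ.path i = 0 ↔ ∃ j : ℕ, i = (μ.part j : ℤ) - j := by
  unfold path
  split_ifs with h <;> simp [h]

theorem path_eq_one_iff (i : ℤ) : μ.path i = 1 ↔ ¬ μ.path i = 0 := by
  unfold path
  split_ifs <;> simp

theorem path_eq_zero_or_one (i : ℤ) : μ.path i = 0 ∨ μ.path i = 1 := by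
  rw [path_eq_one_iff]
  exact em _

theorem part_sub_strictAnti : StrictAnti fun j : ℕ => (μ.part j : ℤ) - j := by
  intro a b h
  have := μ.antitone' h.le
  dsimp only
  omega

/-- The side length of the Durfee square: the position where the diagonal of the
Young diagram leaves the diagram. -/
theorem exists_durfee : ∃ d : ℕ, ∀ j : ℕ, j < d ↔ j < μ.part j := by
  classical
  obtain ⟨N, hN⟩ := μ.eventually_zero
  have hex : ∃ j, μ.part j ≤ j := ⟨N, by simp [hN N le_rfl]⟩
  refine ⟨Nat.find hex, fun j => ⟨fun h => not_le.1 (Nat.find_min hex h), fun h => ?_⟩⟩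
  by_contra! hj
  have h₁ := μ.antitone' hj
  have h₂ := Nat.find_spec hex
  omega

theorem zeros_right_eq_image {d : ℕ} (hd : ∀ j : ℕ, j < d ↔ j < μ.part j) :
    {i : ℤ | 0 < i ∧ μ.path i = 0} =
      ((Finset.range d).image fun j : ℕ => (μ.part j : ℤ) - j : Finset ℤ) := by
  ext i
  simp only [Set.mem_ofPred_eq, path_eq_zero_iff, Finset.coe_image, Set.mem_image,
    Finset.coe_range, Set.mem_Iio]
  constructor
  · rintro ⟨hi, j, rfl⟩
    exact ⟨j, (hd j).2 (by omega), rfl⟩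
  · rintro ⟨j, hj, rfl⟩
    have := (hd j).1 hj
    exact ⟨by omega, j, rfl⟩

theorem ones_left_eq_sdiff {d N : ℕ} (hd : ∀ j : ℕ, j < d ↔ j < μ.part j)
    (hN : ∀ i : ℕ, N ≤ i → μ.part i = 0) :
    {i : ℤ | i ≤ 0 ∧ μ.path i = 1} =
      (Finset.Ioc (-N : ℤ) 0 \ (Finset.Ico d N).image fun j : ℕ => (μ.part j : ℤ) - j :
        Finset ℤ) := by
  ext i
  simp only [Set.mem_ofPred_eq, path_eq_one_iff, path_eq_zero_iff, Finset.coe_sdiff,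
    Finset.coe_image, Set.mem_sdiff, Set.mem_image, Finset.coe_Ioc, Set.mem_Ioc, Finset.coe_Ico,
    Set.mem_Ico]
  constructor
  · rintro ⟨hi, h⟩
    refine ⟨⟨?_, hi⟩, fun ⟨j, _, hj⟩ => h ⟨j, hj.symm⟩⟩
    by_contra! hlt
    have := hN i.natAbs (by omega)
    exact h ⟨i.natAbs, by omega⟩
  · rintro ⟨⟨hlt, hi⟩, h⟩
    refine ⟨hi, ?_⟩
    rintro ⟨j, rfl⟩
    refine h ⟨j, ⟨?_, ?_⟩, rfl⟩
    · by_contra! hj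
      have := (hd j).1 hj
      omega
    · by_contra! hj
      have := hN j hj
      omega

theorem finite_zeros_right : {i : ℤ | 0 < i ∧ μ.path i = 0}.Finite := by
  obtain ⟨d, hd⟩ := μ.exists_durfee
  rw [μ.zeros_right_eq_image hd]
  exact Finset.finite_toSet _

theorem finite_ones_left : {i : ℤ | i ≤ 0 ∧ μ.path i = 1}.Finite := by
  obtain ⟨d, hd⟩ := μ.exists_durfee
  obtain ⟨N, hN⟩ := μ.eventually_zero
  rw [μ.ones_left_eq_sdiff hd hN]
  exact Finset.finite_toSet _

/-- The path sequence of a partition has charge zero. -/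
theorem ncard_ones_left_eq_ncard_zeros_right :
    {i : ℤ | i ≤ 0 ∧ μ.path i = 1}.ncard = {i : ℤ | 0 < i ∧ μ.path i = 0}.ncard := by
  obtain ⟨d, hd⟩ := μ.exists_durfee
  obtain ⟨N, hN⟩ := μ.eventually_zero
  have hinj := μ.part_sub_strictAnti.injective
  have hdN : d ≤ N := by
    by_contra! h
    have := (hd N).1 h
    have := hN N le_rfl
    omega
  rw [μ.ones_left_eq_sdiff hd hN, μ.zeros_right_eq_image hd, Set.ncard_coe_finset,
    Set.ncard_coe_finset, Finset.card_image_of_injective _ hinj, Finset.card_sdiff_of_subset,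
    Finset.card_image_of_injective _ hinj, Int.card_Ioc, Nat.card_Ico, Finset.card_range]
  · omega
  · intro i hi
    obtain ⟨j, hj, rfl⟩ := Finset.mem_image.1 hi
    rw [Finset.mem_Ico] at hj
    have := (hd j).not.1 (by omega)
    rw [Finset.mem_Ioc]
    omega

end PartitionSeq

/-- Counting the positions where `P` holds according to the two values of a path sequence. -/
theorem PartitionSeq.ncard_path_split (μ : PartitionSeq) (c : ℤ) {P : ℤ → Prop}
    (hP : {i : ℤ | P i}.Finite) :
    {i : ℤ | P i ∧ μ.path (i - c) = 0}.ncard + {i : ℤ | P i ∧ μ.path (i - c) = 1}.ncard =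
      {i : ℤ | P i}.ncard := by
  rw [← Set.ncard_union_eq _ (hP.subset fun _ h => h.1) (hP.subset fun _ h => h.1)]
  · congr 1
    ext i
    have := μ.path_eq_zero_or_one (i - c)
    simp only [Set.mem_union, Set.mem_ofPred_eq]
    tauto
  · rw [Set.disjoint_left]
    rintro i ⟨_, h₀⟩ ⟨_, h₁⟩
    omega

theorem path_counts_left_eq
    (f n : ℕ) (hn : n ≤ 2 * f + 3) (μ₁ μ₂ : PartitionSeq)
    (hsize : μ₁.size + μ₂.size = n) :
    countL (pairB μ₁ μ₂ f) + countL (pairD μ₁ μ₂ f) =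
      countM f (pairA μ₁ μ₂ f) + countM f (pairC μ₁ μ₂ f) +
        countR f (pairA μ₁ μ₂ f) + countR f (pairC μ₁ μ₂ f) := by
  have hL := μ₂.ncard_path_split f μ₁.finite_ones_left
  have hR := μ₁.finite_zeros_right
  have hM : {i : ℤ | (1 ≤ i ∧ i ≤ (f : ℤ)) ∧ μ₁.path i = 0}.Finite :=
    hR.subset fun i h => ⟨by have := h.1.1; omega, h.2⟩
  have hF : {i : ℤ | (f : ℤ) < i ∧ μ₁.path i = 0}.Finite :=
    hR.subset fun i h => ⟨by have := h.1; omega, h.2⟩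
  have hMF : {i : ℤ | (1 ≤ i ∧ i ≤ (f : ℤ)) ∧ μ₁.path i = 0}.ncard +
      {i : ℤ | (f : ℤ) < i ∧ μ₁.path i = 0}.ncard = {i : ℤ | 0 < i ∧ μ₁.path i = 0}.ncard := by
    rw [← Set.ncard_union_eq _ hM hF]
    · congr 1
      ext i
      simp only [Set.mem_union, Set.mem_ofPred_eq, ← or_and_right]
      exact and_congr_left fun _ => by omega
    · rw [Set.disjoint_left]
      rintro i ⟨h₁, _⟩ ⟨h₂, _⟩
      omega
  have hM' := μ₂.ncard_path_split f hM
  have hF' := μ₂.ncard_path_split f hF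
  have hbal := μ₁.ncard_ones_left_eq_ncard_zeros_right
  simp only [and_assoc] at hL hM' hF' hMF
  unfold countL countM countR pairA pairB pairC pairD
  omega
end
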